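/- arXiv:2303.13380 — 3 statements merged into one kernel-verified Lean document; each statement's English description precedes it below -/
import Mathlib

section
/- For every n-vertex graph G with average degree d, the number of homomorphisms from the path on 2t−1 vertices into G satisfies hom(P_{2t−1}, G) ≥ n·d^{2t−2}. -/
open SimpleGraph

/-- The number of homomorphisms from the path on `m` vertices into `G`
(i.e. walks of length `m-1` in `G`). -/
noncomputable def homPathCount {V : Type*} (G : SimpleGraph V) (m : ℕ) : ℕ :=
  Nat.card (pathGraph m →g G)


noncomputable def sidA {V : Type*} (G : SimpleGraph V) (u v : V) : ℝ :=
  by classical exact if G.Adj u v then 1 else 0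

noncomputable def sidOp {V : Type*} [Fintype V] (G : SimpleGraph V) (g : V → ℝ) : V → ℝ :=
  fun v => ∑ u, sidA G v u * g u

lemma sidA_symm {V : Type*} (G : SimpleGraph V) (u v : V) : sidA G u v = sidA G v u := by
  have h := G.adj_comm u v
  unfold sidA
  split_ifs <;> tauto

lemma sidOp_symm {V : Type*} [Fintype V] (G : SimpleGraph V) (g h : V → ℝ) :
    ∑ v, sidOp G g v * h v = ∑ v, g v * sidOp G h v := by
  simp only [sidOp, Finset.sum_mul, Finset.mul_sum]
  rw [Finset.sum_comm]
  refine Finset.sum_congr rfl fun u _ => Finset.sum_congr rfl fun v _ => ?_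
  rw [sidA_symm]; ring

lemma sidOp_iter_symm {V : Type*} [Fintype V] (G : SimpleGraph V) (s : ℕ) (g h : V → ℝ) :
    ∑ v, (sidOp G)^[s] g v * h v = ∑ v, g v * (sidOp G)^[s] h v := by
  induction s generalizing g h with
  | zero => simp
  | succ s ih =>
    rw [Function.iterate_succ_apply, ih, sidOp_symm, Function.iterate_succ_apply']

lemma sid_count {V : Type*} [Fintype V] (G : SimpleGraph V) (k : ℕ) (g : V → ℝ) :
    ∑ p : Fin (k + 1) → V, (∏ i : Fin k, sidA G (p i.castSucc) (p i.succ)) * g (p 0)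
      = ∑ v, (sidOp G)^[k] g v := by
  induction k generalizing g with
  | zero =>
    simp only [Finset.univ_eq_empty, Finset.prod_empty, one_mul, Function.iterate_zero, id]
    exact Fintype.sum_equiv (Equiv.funUnique (Fin 1) V) _ _ (fun p => rfl)
  | succ k ih =>
    rw [Function.iterate_succ_apply, ← ih,
      ← (Fin.consEquiv (fun _ : Fin (k + 2) => V)).sum_comp, Fintype.sum_prod_type_right]
    refine Finset.sum_congr rfl fun p _ => ?_
    simp only [sidOp, Finset.mul_sum]
    refine Finset.sum_congr rfl fun x _ => ?_
    rw [Fin.prod_univ_succ]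
    simp only [Fin.consEquiv_apply, Fin.castSucc_zero, Fin.cons_zero, Fin.cons_succ,
      ← Fin.succ_castSucc]
    rw [sidA_symm G x]; ring

lemma sid_hom {V : Type*} [Fintype V] (G : SimpleGraph V) (k : ℕ) :
    (homPathCount G (k + 1) : ℝ) = ∑ v, (sidOp G)^[k] (fun _ => 1) v := by
  classical
  rw [← sid_count]
  have e : (pathGraph (k + 1) →g G) ≃
      {p : Fin (k + 1) → V // ∀ i : Fin k, G.Adj (p i.castSucc) (p i.succ)} :=
    { toFun := fun f => ⟨f, fun i => f.map_rel (by simp [pathGraph_adj])⟩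
      invFun := fun p => ⟨p.1, by
        intro a b hab
        rw [pathGraph_adj] at hab
        rcases hab with h | h
        · have := p.2 ⟨a, by omega⟩
          convert this using 2 <;> ext <;> simp [h]
        · have := (p.2 ⟨b, by omega⟩).symm
          convert this using 2 <;> ext <;> simp [h]⟩
      left_inv := fun f => rfl
      right_inv := fun p => rfl }
  rw [homPathCount, Nat.card_congr e, Nat.card_eq_fintype_card, Fintype.card_subtype]
  simp only [sidA, Finset.prod_ite_zero, Finset.prod_const_one, mul_one]
  simp

lemma sid_deg {V : Type*} [Fintype V] (G : SimpleGraph V) :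
    ∑ v, sidOp G (fun _ => 1) v = 2 * (G.edgeSet.ncard : ℝ) := by
  classical
  have h := G.sum_degrees_eq_twice_card_edges
  rw [← coe_edgeFinset, Set.ncard_coe_finset]
  have h2 : ((∑ v, G.degree v : ℕ) : ℝ) = ((2 * G.edgeFinset.card : ℕ) : ℝ) := by rw [h]
  push_cast at h2
  rw [← h2]
  refine Finset.sum_congr rfl fun v _ => ?_
  simp [sidOp, sidA, ← card_neighborFinset_eq_degree, neighborFinset_eq_filter]

lemma sid_even {V : Type*} [Fintype V] (G : SimpleGraph V) (hn : 0 < Fintype.card V) (s : ℕ) :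
    (Fintype.card V : ℝ) * (2 * (G.edgeSet.ncard : ℝ) / (Fintype.card V)) ^ (2 * s) ≤
      ∑ v, ((sidOp G)^[s] (fun _ => 1) v) ^ 2 := by
  set n : ℝ := (Fintype.card V : ℝ) with hnn
  have hn' : 0 < n := by rw [hnn]; exact_mod_cast hn
  set d : ℝ := 2 * (G.edgeSet.ncard : ℝ) / n with hd
  set m : ℕ → ℝ := fun s => ∑ v, ((sidOp G)^[s] (fun _ => 1) v) ^ 2 with hm
  have m0 : m 0 = n := by simp [hm, hnn]
  have hd0 : 0 ≤ d := by positivity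
  have m1 : d ^ 2 * n ≤ m 1 := by
    have h := Finset.sum_mul_sq_le_sq_mul_sq Finset.univ (fun _ : V => (1 : ℝ))
      (sidOp G (fun _ => 1))
    simp only [one_mul, sid_deg] at h
    have hdn : 2 * (G.edgeSet.ncard : ℝ) = d * n := by rw [hd]; field_simp
    rw [hdn] at h
    have h' : (d * n) ^ 2 ≤ n * m 1 := by simpa [hm, hnn] using h
    nlinarith
  have mc : ∀ s, m (s + 1) ^ 2 ≤ m s * m (s + 2) := by
    intro s
    have h := Finset.sum_mul_sq_le_sq_mul_sq Finset.univ
      ((sidOp G)^[s] (fun _ => 1)) ((sidOp G)^[s + 2] (fun _ => 1))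
    rw [Function.iterate_succ_apply' _ (s + 1), ← sidOp_symm,
      ← Function.iterate_succ_apply' (sidOp G) s, ← Function.iterate_succ_apply' (sidOp G)] at h
    simpa only [hm, ← pow_two] using h
  show n * d ^ (2 * s) ≤ m s
  rcases hd0.eq_or_lt with h0 | hpos
  · rw [← h0]
    rcases s with _ | s
    · simp [m0]
    · have : 0 ≤ m (s + 1) := Finset.sum_nonneg fun _ _ => sq_nonneg _
      simpa using this
  · have key : ∀ s, 0 < m s ∧ d ^ 2 * m s ≤ m (s + 1) := by
      intro s
      induction s with
      | zero => rw [m0]; exact ⟨hn', m1⟩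
      | succ s ih =>
        obtain ⟨h1, h2⟩ := ih
        have hp : 0 < m (s + 1) := lt_of_lt_of_le (by positivity) h2
        refine ⟨hp, ?_⟩
        have h3 : m s * (d ^ 2 * m (s + 1)) ≤ m s * m (s + 2) := by
          nlinarith [mc s]
        exact le_of_mul_le_mul_left h3 h1
    induction s with
    | zero => simp [m0]
    | succ s ih =>
      refine le_trans ?_ (key s).2
      rw [show n * d ^ (2 * (s + 1)) = d ^ 2 * (n * d ^ (2 * s)) by ring]
      gcongr

/-- Sidorenko's property for paths (Blakley–Roy): an `n`-vertex graph with average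
degree `d = 2e(G)/n` has at least `n·d^{2t-2}` homomorphic copies of the path on
`2t-1` vertices. -/
theorem sidorenko_paths {V : Type*} [Fintype V] (t : ℕ) (ht : 0 < t)
    (G : SimpleGraph V) (hn : 0 < Fintype.card V) :
    (Fintype.card V : ℝ) *
        (2 * (G.edgeSet.ncard : ℝ) / (Fintype.card V)) ^ (2 * t - 2) ≤
      (homPathCount G (2 * t - 1) : ℝ) := by
  obtain ⟨s, rfl⟩ : ∃ s, t = s + 1 := ⟨t - 1, by omega⟩
  rw [show 2 * (s + 1) - 2 = 2 * s by omega, show 2 * (s + 1) - 1 = 2 * s + 1 by omega, sid_hom]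
  refine (sid_even G hn s).trans_eq ?_
  have h := sidOp_iter_symm G s (fun _ => 1) ((sidOp G)^[s] (fun _ => 1))
  rw [← Function.iterate_add_apply, ← two_mul] at h
  simpa [pow_two] using h
end

section
/- Let t be a positive integer and let n be sufficiently large in terms of t. Then every n-vertex graph with more than 5t^{3/2}n^{3/2} edges contains the t × t grid F_{t,t} as a subgraph; i.e., ex(n, F_{t,t}) ≤ 5t^{3/2}n^{3/2}. -/
open SimpleGraph

/-- `F` has an (injective) copy in `G`. -/
def Contains {W V : Type*} (F : SimpleGraph W) (G : SimpleGraph V) : Prop :=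
  ∃ f : W → V, Function.Injective f ∧ ∀ a b, F.Adj a b → G.Adj (f a) (f b)

/-- The `t × t` grid `F_{t,t}`. -/
def gridGraph (t : ℕ) : SimpleGraph (Fin t × Fin t) :=
  pathGraph t □ pathGraph t

/-- Deletion lemma. -/
lemma exists_closed_family {Ω ι κ : Type*} [DecidableEq Ω] [DecidableEq ι] [DecidableEq κ]
    (I : Finset ι) (φ : ι → Ω → κ) (K : ℕ) (S₀ : Finset Ω)
    (h : ∑ i ∈ I, K * (S₀.image (φ i)).card < S₀.card) :
    ∃ S : Finset Ω, S.Nonempty ∧ ∀ w ∈ S, ∀ i ∈ I,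
      K ≤ (S.filter (fun w' => φ i w' = φ i w)).card := by
  induction hn : S₀.card using Nat.strong_induction_on generalizing S₀ with
  | _ n ih =>
    by_cases hS : ∀ w ∈ S₀, ∀ i ∈ I, K ≤ (S₀.filter (fun w' => φ i w' = φ i w)).card
    · refine ⟨S₀, ?_, hS⟩
      rw [← Finset.card_pos]; omega
    · push Not at hS
      obtain ⟨w, hw, i, hi, hlt⟩ := hS
      have hsplit := Finset.card_filter_add_card_filter_not (s := S₀) (fun w' => φ i w' = φ i w)
      have hpos : 0 < (S₀.filter (fun w' => φ i w' = φ i w)).card :=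
        Finset.card_pos.2 ⟨w, by simp [hw]⟩
      refine ih (S₀.filter (fun w' => ¬ φ i w' = φ i w)).card (by omega) _ ?_ rfl
      have hsum : ∑ j ∈ I, K * ((S₀.filter (fun w' => ¬ φ i w' = φ i w)).image (φ j)).card + K
          ≤ ∑ j ∈ I, K * (S₀.image (φ j)).card := by
        rw [← Finset.add_sum_erase _ _ hi, ← Finset.add_sum_erase _ _ hi]
        have h1 : ((S₀.filter (fun w' => ¬ φ i w' = φ i w)).image (φ i)).card + 1
            ≤ (S₀.image (φ i)).card := by
          apply Finset.card_lt_card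
          rw [Finset.ssubset_iff_of_subset (Finset.image_subset_image (Finset.filter_subset _ _))]
          refine ⟨φ i w, Finset.mem_image_of_mem _ hw, ?_⟩
          simp only [Finset.mem_image, Finset.mem_filter, not_exists, not_and]
          rintro x ⟨_, hx⟩ hx'
          exact hx hx'
        have h2 : ∑ j ∈ I.erase i, K * ((S₀.filter (fun w' => ¬ φ i w' = φ i w)).image (φ j)).card
            ≤ ∑ j ∈ I.erase i, K * (S₀.image (φ j)).card := by
          apply Finset.sum_le_sum
          intro j _
          exact Nat.mul_le_mul_left _ (Finset.card_le_card
            (Finset.image_subset_image (Finset.filter_subset _ _)))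
        have h3 := Nat.mul_le_mul_left K h1
        rw [Nat.mul_add] at h3
        omega
      omega

/-- Min degree subgraph. -/
lemma exists_min_degree {n : ℕ} (G : SimpleGraph (Fin n)) [DecidableRel G.Adj]
    (P : ℕ) (hP : 0 < P) (hPe : P ≤ ∑ x, (Finset.univ.filter (G.Adj x)).card) :
    ∃ T : Finset (Fin n), T.Nonempty ∧ ∀ v ∈ T, P ≤ 2 * n * (T.filter (G.Adj v)).card := by
  classical
  have key : ∀ (k : ℕ) (S : Finset (Fin n)), S.card = k → S.Nonempty →
      P * S.card ≤ n * ∑ x ∈ S, (S.filter (G.Adj x)).card →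
      ∃ T : Finset (Fin n), T.Nonempty ∧ ∀ v ∈ T, P ≤ 2 * n * (T.filter (G.Adj v)).card := by
    intro k
    induction k with
    | zero =>
      intro S h0 hne _
      exact absurd h0 (Finset.card_pos.2 hne).ne'
    | succ k ih =>
      intro S hk hne hS
      by_cases hall : ∀ v ∈ S, P ≤ 2 * n * (S.filter (G.Adj v)).card
      · exact ⟨S, hne, hall⟩
      · push Not at hall
        obtain ⟨v, hv, hlt⟩ := hall
        have hcard : (S.erase v).card = k := by rw [Finset.card_erase_of_mem hv]; omega
        have hsum : ∑ x ∈ S, (S.filter (G.Adj x)).card =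
            ∑ x ∈ S.erase v, ((S.erase v).filter (G.Adj x)).card
              + 2 * (S.filter (G.Adj v)).card := by
          rw [← Finset.add_sum_erase _ _ hv]
          have : ∀ x ∈ S.erase v, (S.filter (G.Adj x)).card =
              ((S.erase v).filter (G.Adj x)).card + if G.Adj v x then 1 else 0 := by
            intro x hx
            rw [Finset.filter_erase]
            split_ifs with h
            · rw [Finset.card_erase_add_one]
              simp [hv, h.symm]
            · rw [Finset.erase_eq_of_notMem]
              · rfl
              · simp [G.adj_comm x v, h]
          rw [Finset.sum_congr rfl this, Finset.sum_add_distrib, ← Finset.card_filter,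
            Finset.filter_erase (G.Adj v) v S,
            Finset.erase_eq_of_notMem (s := S.filter (G.Adj v)) (a := v) (by simp)]
          ring
        have hS' : P * (S.erase v).card ≤
            n * ∑ x ∈ S.erase v, ((S.erase v).filter (G.Adj x)).card := by
          rw [hsum, hk] at hS
          rw [hcard]
          nlinarith
        rcases Nat.eq_zero_or_pos k with h0 | h0
        · exfalso
          have : S.erase v = ∅ := Finset.card_eq_zero.1 (hcard.trans h0)
          rw [hsum, hk, this] at hS
          simp only [Finset.sum_empty] at hS
          nlinarith
        · exact ih _ hcard (Finset.card_pos.1 (by omega)) hS'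
  have hn : 0 < n := by
    rcases Nat.eq_zero_or_pos n with h | h
    · subst h; simp at hPe; omega
    · exact h
  refine key n Finset.univ (by simp) ⟨⟨0, hn⟩, Finset.mem_univ _⟩ ?_
  rw [Finset.card_univ, Fintype.card_fin, mul_comm]
  exact Nat.mul_le_mul_left _ hPe

/-- The walk starting from `a` following out-neighbour choices `c`. -/
def walkEval {α : Type*} {M D : ℕ} (o : α → Fin D → α) (a : α) (c : Fin M → Fin D) : ℕ → α
  | 0 => a
  | j + 1 => if h : j < M then o (walkEval o a c j) (c ⟨j, h⟩) else walkEval o a c j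

lemma walkEval_congr {α : Type*} {M D : ℕ} (o : α → Fin D → α) (a : α)
    (c c' : Fin M → Fin D) (k : ℕ) (h : ∀ j : Fin M, j.1 < k → c j = c' j) :
    ∀ j ≤ k, walkEval o a c j = walkEval o a c' j := by
  intro j
  induction j with
  | zero => intro _; rfl
  | succ j ih =>
    intro hj
    simp only [walkEval]
    rw [ih (by omega)]
    split_ifs with hM
    · rw [h ⟨j, hM⟩ (by simpa using hj)]
    · rfl

lemma walkEval_congr' {α : Type*} {M D : ℕ} (o : α → Fin D → α) (a a' : α)
    (c c' : Fin M → Fin D) (k : ℕ) (h0 : walkEval o a c k = walkEval o a' c' k)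
    (h : ∀ j : Fin M, k ≤ j.1 → c j = c' j) :
    ∀ j, k ≤ j → walkEval o a c j = walkEval o a' c' j := by
  intro j hj
  induction j, hj using Nat.le_induction with
  | base => exact h0
  | succ j hj ih =>
    simp only [walkEval]
    rw [ih]
    split_ifs with hM
    · rw [h ⟨j, hM⟩ hj]
    · rfl

/-- The flexible family of walks. -/
lemma exists_walk_family {α : Type*} [Fintype α] [Nonempty α] {M D : ℕ} (o : α → Fin D → α)
    (ho : ∀ a, Function.Injective (o a)) (K : ℕ) (hD : M * K * Fintype.card α < D ^ 2)
    (hM : 0 < M) :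
    ∃ F : Set (ℕ → α), F.Nonempty ∧ (∀ v ∈ F, ∀ j < M, ∃ k, v (j + 1) = o (v j) k) ∧
      ∀ v ∈ F, ∀ i, 0 < i → i < M → ∀ S : Finset α, S.card < K →
        ∃ v' ∈ F, (∀ j, j ≠ i → v' j = v j) ∧ v' i ∉ S := by
  classical
  have hDpos : 0 < D := by
    rcases Nat.eq_zero_or_pos D with h | h
    · subst h; simp at hD
    · exact h
  let z : Fin D := ⟨0, hDpos⟩
  let φ : ℕ → (α × (Fin M → Fin D)) → (α × α × (Fin M → Fin D)) := fun i w =>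
    (w.1, walkEval o w.1 w.2 (i + 1), fun j => if j.1 + 1 = i ∨ j.1 = i then z else w.2 j)
  have hn : 0 < Fintype.card α := Fintype.card_pos
  have himg : ∀ i ∈ Finset.Ioo 0 M, (Finset.univ.image (φ i)).card * D ^ 2
      ≤ Fintype.card α * (Fintype.card α * D ^ M) := by
    intro i hi
    rw [Finset.mem_Ioo] at hi
    let B : Finset (Fin M → Fin D) :=
      Finset.univ.filter (fun c => ∀ j : Fin M, (j.1 + 1 = i ∨ j.1 = i) → c j = z)
    have hB : B.card * D ^ 2 ≤ D ^ M := by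
      have : (B ×ˢ (Finset.univ : Finset (Fin D × Fin D))).card
          ≤ (Finset.univ : Finset (Fin M → Fin D)).card := by
        apply Finset.card_le_card_of_injOn
          (fun p j => if j.1 + 1 = i then p.2.1 else if j.1 = i then p.2.2 else p.1 j)
        · intro _ _; simp
        · rintro ⟨c, x, y⟩ hc ⟨c', x', y'⟩ hc' heq
          simp only [B, Finset.coe_product, Set.mem_prod, Finset.mem_coe, Finset.mem_filter,
            Finset.mem_univ, true_and, and_true] at hc hc'
          simp only at heq
          have hx : x = x' := by
            have := congrFun heq ⟨i - 1, by omega⟩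
            simpa [Nat.sub_add_cancel hi.1] using this
          have hy : y = y' := by
            have := congrFun heq ⟨i, hi.2⟩
            simpa using this
          have hcc : c = c' := by
            funext j
            by_cases hj : j.1 + 1 = i ∨ j.1 = i
            · rw [hc j hj, hc' j hj]
            · have := congrFun heq j
              push Not at hj
              simpa [hj.1, hj.2] using this
          rw [hx, hy, hcc]
      simpa [Finset.card_product, sq] using this
    have hsub : Finset.univ.image (φ i) ⊆
        (Finset.univ : Finset α) ×ˢ ((Finset.univ : Finset α) ×ˢ B) := by
      intro p hp
      rw [Finset.mem_image] at hp
      obtain ⟨w, _, rfl⟩ := hp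
      simp only [φ, B, Finset.mem_product, Finset.mem_univ, true_and, Finset.mem_filter]
      intro j hj
      rw [if_pos hj]
    have hcard := Finset.card_le_card hsub
    rw [Finset.card_product, Finset.card_product, Finset.card_univ] at hcard
    calc _ ≤ (Fintype.card α * (Fintype.card α * B.card)) * D ^ 2 :=
          Nat.mul_le_mul_right _ hcard
      _ = Fintype.card α * (Fintype.card α * (B.card * D ^ 2)) := by ring
      _ ≤ _ := by gcongr
  have hsum : ∑ i ∈ Finset.Ioo 0 M, K * (Finset.univ.image (φ i)).card
      < (Finset.univ : Finset (α × (Fin M → Fin D))).card := by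
    have hcardΩ : (Finset.univ : Finset (α × (Fin M → Fin D))).card = Fintype.card α * D ^ M := by
      simp
    rw [hcardΩ]
    have h1 : (∑ i ∈ Finset.Ioo 0 M, K * (Finset.univ.image (φ i)).card) * D ^ 2
        ≤ M * (K * (Fintype.card α * (Fintype.card α * D ^ M))) := by
      rw [Finset.sum_mul]
      calc _ ≤ ∑ i ∈ Finset.Ioo 0 M, K * (Fintype.card α * (Fintype.card α * D ^ M)) := by
            apply Finset.sum_le_sum
            intro i hi
            rw [mul_assoc]
            exact Nat.mul_le_mul_left _ (himg i hi)
        _ ≤ _ := by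
            rw [Finset.sum_const, smul_eq_mul, Nat.card_Ioo]
            exact Nat.mul_le_mul_right _ (by omega)
    have hpos : 0 < Fintype.card α * D ^ M := by positivity
    have h2 : M * (K * (Fintype.card α * (Fintype.card α * D ^ M)))
        < (Fintype.card α * D ^ M) * D ^ 2 := by
      calc _ = (Fintype.card α * D ^ M) * (M * K * Fintype.card α) := by ring
        _ < _ := Nat.mul_lt_mul_of_pos_left hD hpos
    exact lt_of_mul_lt_mul_right (lt_of_le_of_lt h1 h2) (Nat.zero_le _)
  obtain ⟨S, hSne, hS⟩ := exists_closed_family (Finset.Ioo 0 M) φ K Finset.univ hsum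
  refine ⟨{v | ∃ w ∈ S, v = walkEval o w.1 w.2}, ?_, ?_, ?_⟩
  · obtain ⟨w, hw⟩ := hSne
    exact ⟨_, w, hw, rfl⟩
  · rintro _ ⟨w, hw, rfl⟩ j hj
    exact ⟨w.2 ⟨j, hj⟩, by simp [walkEval, hj]⟩
  · rintro _ ⟨w, hw, rfl⟩ i hi0 hiM X hX
    have hK := hS w hw i (by simp [hi0, hiM])
    have hagree : ∀ w₁ w₂ : α × (Fin M → Fin D), φ i w₁ = φ i w₂ →
        ∀ j, j ≠ i → walkEval o w₁.1 w₁.2 j = walkEval o w₂.1 w₂.2 j := by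
      rintro ⟨a, c⟩ ⟨a', c'⟩ h j hj
      simp only [φ, Prod.mk.injEq] at h
      obtain ⟨rfl, h2, h3⟩ := h
      have h4 : ∀ j : Fin M, ¬ (j.1 + 1 = i ∨ j.1 = i) → c j = c' j := by
        intro j hj
        have := congrFun h3 j
        simpa [hj] using this
      rcases lt_or_gt_of_ne hj with hlt | hgt
      · exact walkEval_congr o a c c' (i - 1) (fun j hj => h4 j (by omega)) j (by omega)
      · exact walkEval_congr' o a a c c' (i + 1) h2 (fun j hj => h4 j (by omega)) j (by omega)
    have hinj : Set.InjOn (fun w' : α × (Fin M → Fin D) => walkEval o w'.1 w'.2 i)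
        (S.filter (fun w' => φ i w' = φ i w) : Finset _) := by
      intro w₁ h₁ w₂ h₂ heq
      simp only [Finset.coe_filter, Set.mem_ofPred_eq] at h₁ h₂
      have h12 : φ i w₁ = φ i w₂ := h₁.2.trans h₂.2.symm
      have hag := hagree w₁ w₂ h12
      have hall : ∀ j, walkEval o w₁.1 w₁.2 j = walkEval o w₂.1 w₂.2 j := by
        intro j
        by_cases hj : j = i
        · subst hj; exact heq
        · exact hag j hj
      refine Prod.ext (hall 0) ?_
      funext j
      have h1 := hall (j.1 + 1)
      simp only [walkEval, j.2, dif_pos] at h1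
      rw [hall j.1] at h1
      exact ho _ h1
    have hcard := Finset.card_image_of_injOn hinj
    have hlt : X.card < ((S.filter (fun w' => φ i w' = φ i w)).image
        (fun w' : α × (Fin M → Fin D) => walkEval o w'.1 w'.2 i)).card := by
      rw [hcard]; omega
    obtain ⟨x, hx, hxX⟩ := Finset.exists_mem_notMem_of_card_lt_card hlt
    rw [Finset.mem_image] at hx
    obtain ⟨w', hw', rfl⟩ := hx
    rw [Finset.mem_filter] at hw'
    exact ⟨_, ⟨w', hw'.1, rfl⟩, hagree w' w hw'.2, hxX⟩

/-- Iterated flips. -/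
lemma exists_flip_sequence {α : Type*} {M K : ℕ} (F : Set (ℕ → α)) (hne : F.Nonempty)
    (hflip : ∀ v ∈ F, ∀ i, 0 < i → i < M → ∀ S : Finset α, S.card < K →
        ∃ v' ∈ F, (∀ j, j ≠ i → v' j = v j) ∧ v' i ∉ S)
    (q : ℕ → ℕ) (N : ℕ) (hNK : N ≤ K) (hq : ∀ s < N, 0 < q s ∧ q s < M) :
    ∃ W : ℕ → ℕ → α, (∀ s ≤ N, W s ∈ F) ∧ (∀ s < N, ∀ j, j ≠ q s → W (s + 1) j = W s j) ∧
      ∀ s < N, ∀ r < s, W (s + 1) (q s) ≠ W (r + 1) (q r) := by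
  classical
  induction N with
  | zero =>
    obtain ⟨v, hv⟩ := hne
    exact ⟨fun _ => v, fun _ _ => hv, by simp, by simp⟩
  | succ N ih =>
    obtain ⟨W, h1, h2, h3⟩ := ih (by omega) (fun s hs => hq s (by omega))
    obtain ⟨v', hv', hag, hnot⟩ := hflip (W N) (h1 N le_rfl) (q N) (hq N (by omega)).1
      (hq N (by omega)).2 ((Finset.range N).image (fun r => W (r + 1) (q r)))
      (lt_of_le_of_lt Finset.card_image_le (by simp; omega))
    refine ⟨fun s => if s = N + 1 then v' else W s, ?_, ?_, ?_⟩
    · intro s hs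
      dsimp only
      split_ifs with h
      · exact hv'
      · exact h1 s (by omega)
    · intro s hs j hj
      dsimp only
      rw [if_neg (show ¬ s = N + 1 by omega)]
      by_cases h : s = N
      · subst h; simpa using hag j hj
      · rw [if_neg (by omega)]
        exact h2 s (by omega) j hj
    · intro s hs r hr
      dsimp only
      rw [if_neg (show ¬ r + 1 = N + 1 by omega)]
      by_cases h : s = N
      · subst h
        rw [if_pos rfl]
        intro heq
        exact hnot (Finset.mem_image.2 ⟨r, Finset.mem_range.2 hr, heq.symm⟩)
      · rw [if_neg (by omega)]
        exact h3 s (by omega) r hr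

/-- Building the grid from a flexible family of walks. -/
lemma grid_of_family {α : Type*} (G : SimpleGraph α) (t : ℕ) (F : Set (ℕ → α))
    (hne : F.Nonempty) (hadj : ∀ v ∈ F, ∀ j < 2 * t, G.Adj (v j) (v (j + 1)))
    (hflip : ∀ v ∈ F, ∀ i, 0 < i → i < 2 * t → ∀ S : Finset α, S.card < t * t →
        ∃ v' ∈ F, (∀ j, j ≠ i → v' j = v j) ∧ v' i ∉ S) :
    Contains (gridGraph t) G := by
  -- step `a * t + b` creates the vertex in row `a`, column `t - 1 - b`
  have hq0 : ∀ a b, b < t → (a * t + b) / t + (t - (a * t + b) % t) = a + (t - b) := by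
    intro a b hb
    rw [mul_comm a t, Nat.mul_add_div (by omega), Nat.mul_add_mod, Nat.div_eq_of_lt hb,
      Nat.mod_eq_of_lt hb, add_zero]
  have hqb : ∀ s < t * t, 0 < s / t + (t - s % t) ∧ s / t + (t - s % t) < 2 * t := by
    intro s hs
    have ht : 0 < t := by
      rcases Nat.eq_zero_or_pos t with h | h
      · subst h; simp at hs
      · exact h
    have h1 : s / t < t := Nat.div_lt_of_lt_mul hs
    have h2 := Nat.mod_lt s ht
    generalize s / t = a at *
    generalize s % t = b at *
    omega
  obtain ⟨W, h1, h2, h3⟩ := exists_flip_sequence F hne hflip (fun s => s / t + (t - s % t))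
    (t * t) le_rfl hqb
  have hlt : ∀ a b, a < t → b < t → a * t + b < t * t := by
    intro a b ha hb
    nlinarith
  let x : ℕ → ℕ → α := fun a b => W (a * t + b + 1) (a + (t - b))
  -- horizontal adjacency
  have hH : ∀ a b, a < t → b + 1 < t → G.Adj (x a (b + 1)) (x a b) := by
    intro a b ha hb
    have hs := hlt a (b + 1) ha hb
    have e := h2 (a * t + (b + 1)) hs (a + (t - b)) (by rw [hq0 a (b + 1) hb]; omega)
    have := hadj _ (h1 (a * t + (b + 1) + 1) (by omega)) (a + (t - (b + 1))) (by omega)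
    rw [show a + (t - (b + 1)) + 1 = a + (t - b) by omega, e] at this
    exact this
  -- vertical adjacency
  have hV : ∀ a b, a + 1 < t → b < t → G.Adj (x a b) (x (a + 1) b) := by
    intro a b ha hb
    have hend := hlt (a + 1) b ha hb
    have hmul : (a + 1) * t = a * t + t := by ring
    have hstay : ∀ k, k ≤ t → W (a * t + b + 1 + k) (a + (t - b)) = x a b := by
      intro k
      induction k with
      | zero => intro _; rfl
      | succ k ih =>
        intro hk
        rw [← ih (by omega), ← add_assoc]
        apply h2 _ (by omega)
        by_cases hbk : b + 1 + k < t
        · rw [show a * t + b + 1 + k = a * t + (b + 1 + k) by ring, hq0 a _ hbk]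
          omega
        · rw [show a * t + b + 1 + k = (a + 1) * t + (b + 1 + k - t) by omega,
            hq0 (a + 1) _ (by omega)]
          omega
    have e := hstay t le_rfl
    have := hadj _ (h1 ((a + 1) * t + b + 1) (by omega)) (a + (t - b)) (by omega)
    rw [show a + (t - b) + 1 = (a + 1) + (t - b) by omega] at this
    rw [show a * t + b + 1 + t = (a + 1) * t + b + 1 by omega] at e
    rw [e] at this
    exact this
  refine ⟨fun p => x p.1.1 p.2.1, ?_, ?_⟩
  · have hne' : ∀ a b a' b', a < t → b < t → a' < t → b' < t → a * t + b < a' * t + b' →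
        x a b ≠ x a' b' := by
      intro a b a' b' ha hb ha' hb' hl heq
      have := h3 (a' * t + b') (hlt a' b' ha' hb') (a * t + b) hl
      rw [hq0 a b hb, hq0 a' b' hb'] at this
      exact this heq.symm
    rintro ⟨a, b⟩ ⟨a', b'⟩ heq
    have hE : a.1 * t + b.1 = a'.1 * t + b'.1 := by
      rcases lt_trichotomy (a.1 * t + b.1) (a'.1 * t + b'.1) with h | h | h
      · exact absurd heq (hne' _ _ _ _ a.2 b.2 a'.2 b'.2 h)
      · exact h
      · exact absurd heq.symm (hne' _ _ _ _ a'.2 b'.2 a.2 b.2 h)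
    have hm : b.1 = b'.1 := by
      have := congrArg (· % t) hE
      simpa [Nat.mul_add_mod', Nat.mod_eq_of_lt b.2, Nat.mod_eq_of_lt b'.2] using this
    have hd : a.1 = a'.1 := by
      rw [hm] at hE
      exact Nat.eq_of_mul_eq_mul_right (by have := a.2; omega) (Nat.add_right_cancel hE)
    exact Prod.ext (Fin.ext hd) (Fin.ext hm)
  · rintro ⟨a, b⟩ ⟨a', b'⟩ h
    simp only [gridGraph, boxProd_adj, pathGraph_adj] at h
    have ha := a.2
    have hb := b.2
    have ha' := a'.2
    have hb' := b'.2
    dsimp only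
    rcases h with ⟨h | h, e⟩ | ⟨h | h, e⟩
    · rw [← e, ← h]; exact hV _ _ (by omega) hb
    · rw [← e, ← h]; exact (hV _ _ (by omega) hb).symm
    · rw [← e, ← h]; exact (hH _ _ ha (by omega)).symm
    · rw [← e, ← h]; exact hH _ _ ha (by omega)

/-- For every positive integer `t` and all sufficiently large `n`,
`ex(n, F_{t,t}) ≤ 5 t^{3/2} n^{3/2}`. -/
theorem turan_grid (t : ℕ) (ht : 0 < t) :
    ∃ n₀ : ℕ, ∀ n ≥ n₀, ∀ G : SimpleGraph (Fin n),
      ¬ Contains (gridGraph t) G →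
      (G.edgeSet.ncard : ℝ) ≤ 5 * (t : ℝ) ^ ((3 : ℝ) / 2) * (n : ℝ) ^ ((3 : ℝ) / 2) := by
  classical
  refine ⟨1, fun n hn G hG => ?_⟩
  by_contra hcon
  push Not at hcon
  apply hG
  have hnR : (0 : ℝ) < n := by exact_mod_cast hn
  have htR : (0 : ℝ) < t := by exact_mod_cast ht
  have hdeg : ∑ x, (Finset.univ.filter (G.Adj x)).card = 2 * G.edgeSet.ncard := by
    rw [Set.ncard_eq_toFinset_card', ← SimpleGraph.edgeFinset,
      ← SimpleGraph.sum_degrees_eq_twice_card_edges]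
    refine Finset.sum_congr rfl fun x _ => ?_
    rw [← SimpleGraph.card_neighborFinset_eq_degree, SimpleGraph.neighborFinset_eq_filter]
  have hepos : 0 < G.edgeSet.ncard := by
    have : (0 : ℝ) < G.edgeSet.ncard := lt_trans (by positivity) hcon
    exact_mod_cast this
  obtain ⟨T, hT, hTdeg⟩ := exists_min_degree G (2 * G.edgeSet.ncard) (by omega) hdeg.ge
  set y : ℝ := 5 * (t : ℝ) ^ ((3 : ℝ) / 2) * (n : ℝ) ^ ((1 : ℝ) / 2) with hy
  have hy0 : 0 ≤ y := by positivity
  have hysq : y ^ 2 = 25 * t ^ 3 * n := by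
    have e1 : ((t : ℝ) ^ ((3 : ℝ) / 2)) ^ 2 = t ^ 3 := by
      rw [← Real.rpow_natCast, ← Real.rpow_mul htR.le, ← Real.rpow_natCast]
      norm_num
    have e2 : ((n : ℝ) ^ ((1 : ℝ) / 2)) ^ 2 = n := by
      rw [← Real.rpow_natCast, ← Real.rpow_mul hnR.le]
      norm_num
    rw [hy, mul_pow, mul_pow, e1, e2]
    norm_num
  have hyn : y * n = 5 * (t : ℝ) ^ ((3 : ℝ) / 2) * (n : ℝ) ^ ((3 : ℝ) / 2) := by
    have : (n : ℝ) ^ ((3 : ℝ) / 2) = (n : ℝ) ^ ((1 : ℝ) / 2) * n := by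
      rw [← Real.rpow_add_one hnR.ne']
      norm_num
    rw [hy, this]; ring
  rw [← hyn] at hcon
  set D := ⌈y⌉₊ with hD
  have hDdeg : ∀ v ∈ T, D ≤ (T.filter (G.Adj v)).card := by
    intro v hv
    rw [hD, Nat.ceil_le]
    have h1 : (G.edgeSet.ncard : ℝ) ≤ n * (T.filter (G.Adj v)).card := by
      have := hTdeg v hv
      rw [mul_assoc] at this
      exact_mod_cast Nat.le_of_mul_le_mul_left this (by norm_num)
    have h2 : y * n ≤ (T.filter (G.Adj v)).card * n := by linarith
    exact le_of_mul_le_mul_right h2 hnR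
  have hDsq : 2 * t * (t * t) * Fintype.card T < D ^ 2 := by
    have h1 : y ≤ D := Nat.le_ceil y
    have h2 : y ^ 2 ≤ (D : ℝ) ^ 2 := by gcongr
    rw [hysq] at h2
    have h3 : 25 * t ^ 3 * n ≤ D ^ 2 := by exact_mod_cast h2
    have h4 : Fintype.card T ≤ n := by
      rw [Fintype.card_coe]
      simpa using Finset.card_le_univ T
    have h5 : 0 < t ^ 3 * n := by positivity
    calc 2 * t * (t * t) * Fintype.card T ≤ 2 * t * (t * t) * n := Nat.mul_le_mul_left _ h4
      _ = 2 * (t ^ 3 * n) := by ring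
      _ < 25 * (t ^ 3 * n) := by omega
      _ ≤ _ := by rw [← mul_assoc]; exact h3
  have hout : ∀ v : T, ∃ o : Fin D → T, Function.Injective o ∧ ∀ k, G.Adj v.1 (o k).1 := by
    intro v
    obtain ⟨A, hA, hAc⟩ := Finset.exists_subset_card_eq (hDdeg v.1 v.2)
    let e := A.equivFinOfCardEq hAc
    have hmem : ∀ k, (e.symm k).1 ∈ T ∧ G.Adj v.1 (e.symm k).1 := fun k => by
      simpa using hA (e.symm k).2
    refine ⟨fun k => ⟨(e.symm k).1, (hmem k).1⟩, ?_, fun k => (hmem k).2⟩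
    intro k k' h
    have := congrArg Subtype.val h
    exact e.symm.injective (Subtype.ext this)
  choose o ho hoadj using hout
  have : Nonempty T := hT.to_subtype
  obtain ⟨F, hF1, hF2, hF3⟩ := exists_walk_family (M := 2 * t) o ho (t * t) hDsq (by omega)
  obtain ⟨f, hf, hfadj⟩ := grid_of_family (G.induce (T : Set (Fin n))) t F hF1
    (fun v hv j hj => by
      obtain ⟨k, hk⟩ := hF2 v hv j hj
      rw [hk]
      exact hoadj _ k) hF3
  exact ⟨fun p => (f p).1, Subtype.val_injective.comp hf, fun a b h => hfadj a b h⟩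
end

section
/- For every integer ℓ ≥ 4 there is a constant c(ℓ) such that every n-vertex graph with more than c(ℓ)·n^{3/2} edges contains the 2ℓ-prism C_{2ℓ} □ K₂ as a subgraph; consequently ex(n, C_{2ℓ}□K₂) = O_ℓ(n^{3/2}). -/
open SimpleGraph

/-- The `2ℓ`-prism `C_{2ℓ} □ K₂`. -/
def prism (l : ℕ) : SimpleGraph (Fin (2 * l) × Fin 2) :=
  cycleGraph (2 * l) □ (⊤ : SimpleGraph (Fin 2))

open Finset

set_option linter.unusedSectionVars false
set_option linter.unusedVariables false
set_option linter.style.longLine false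
section walks
variable {X : Type*} [Fintype X] [DecidableEq X]

/-- ordered matrix product -/
noncomputable def mprod (B : ℕ → Matrix X X ℝ) : ℕ → Matrix X X ℝ
  | 0 => 1
  | k+1 => mprod B k * B k

lemma path_sum (B : ℕ → Matrix X X ℝ) (k : ℕ) (h : X → X → ℝ) :
    ∑ w : Fin (k+1) → X, (∏ i : Fin k, B i (w i.castSucc) (w i.succ)) * h (w 0) (w (Fin.last k))
      = ∑ x, ∑ y, mprod B k x y * h x y := by
  induction k generalizing h with
  | zero =>
    rw [← (Equiv.funUnique (Fin 1) X).symm.sum_comp]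
    simp [mprod, Matrix.one_apply]
  | succ k ih =>
    rw [← (Fin.snocEquiv (fun _ : Fin (k+2) => X)).sum_comp, Fintype.sum_prod_type, sum_comm]
    have h1 : ∀ (w : Fin (k+1) → X) (z : X),
        (∏ i : Fin (k+1), B i ((Fin.snocEquiv (fun _ : Fin (k+2) => X)) (z, w) i.castSucc)
          ((Fin.snocEquiv (fun _ : Fin (k+2) => X)) (z, w) i.succ)) *
          h ((Fin.snocEquiv (fun _ : Fin (k+2) => X)) (z, w) 0)
            ((Fin.snocEquiv (fun _ : Fin (k+2) => X)) (z, w) (Fin.last (k+1)))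
        = (∏ i : Fin k, B i (w i.castSucc) (w i.succ)) * (B k (w (Fin.last k)) z * h (w 0) z) := by
      intro w z
      rw [Fin.prod_univ_castSucc]
      have e0 : ((Fin.snocEquiv (fun _ : Fin (k+2) => X)) (z, w) 0) = w 0 := by
        change Fin.snoc (α := fun _ => X) w z (Fin.castSucc 0) = w 0
        simp
      have e1 : ((Fin.snocEquiv (fun _ : Fin (k+2) => X)) (z, w) (Fin.last (k+1))) = z := by
        change Fin.snoc (α := fun _ => X) w z (Fin.last (k+1)) = z
        simp
      have e2 : ∀ i : Fin (k+1), ((Fin.snocEquiv (fun _ : Fin (k+2) => X)) (z, w) i.castSucc) = w i := by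
        intro i
        change Fin.snoc (α := fun _ => X) w z i.castSucc = w i
        simp
      have e3 : ∀ i : Fin k, ((Fin.snocEquiv (fun _ : Fin (k+2) => X)) (z, w) i.castSucc.succ) = w i.succ := by
        intro i
        rw [Fin.succ_castSucc]; exact e2 _
      rw [e0, e1]
      simp only [e2, e3, Fin.succ_last, e1]
      simp [mul_assoc]
    simp_rw [h1, ← mul_sum]
    rw [ih (fun x y => ∑ z, B k y z * h x z)]
    apply sum_congr rfl; intro x _
    simp only [mprod, Matrix.mul_apply, sum_mul, mul_sum]
    rw [sum_comm]
    simp only [mul_assoc]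

lemma mprod_const (A : Matrix X X ℝ) (k : ℕ) : mprod (fun _ => A) k = A ^ k := by
  induction k with
  | zero => rfl
  | succ k ih => rw [mprod, ih, pow_succ]

/-- weight of a closed walk -/
noncomputable def cw (A : Matrix X X ℝ) (k : ℕ) (w : Fin (k+1) → X) : ℝ :=
  ∏ i : Fin (k+1), A (w i) (w (i+1))

lemma cw_eq (A : Matrix X X ℝ) (k : ℕ) (w : Fin (k+1) → X) :
    cw A k w = (∏ i : Fin k, A (w i.castSucc) (w i.succ)) * A (w (Fin.last k)) (w 0) := by
  rw [cw, Fin.prod_univ_castSucc]; simp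

lemma cw_trace (A : Matrix X X ℝ) (k : ℕ) : ∑ w, cw A k w = (A ^ (k+1)).trace := by
  simp_rw [cw_eq]
  rw [path_sum (fun _ => A) k (fun x y => A y x), mprod_const, pow_succ]
  simp [Matrix.trace, Matrix.mul_apply]

lemma mprod_ins (A : Matrix X X ℝ) (v : X → ℝ) (p : ℕ) (k : ℕ) :
    mprod (fun i => if i = p then A * Matrix.diagonal v else A) k =
      if p < k then A ^ (p+1) * Matrix.diagonal v * A ^ (k - (p+1)) else A ^ k := by
  induction k with
  | zero => simp [mprod]
  | succ k ih =>
    rw [mprod, ih]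
    rcases lt_trichotomy p k with h | h | h
    · have h2 : p < k + 1 := by omega
      have h3 : k + 1 - (p+1) = (k - (p+1)) + 1 := by omega
      rw [if_pos h, if_neg (by omega), if_pos h2, h3, pow_succ A (k - (p+1))]
      simp only [mul_assoc]
    · subst h
      simp [pow_succ, mul_assoc]
    · rw [if_neg (by omega), if_neg (by omega), if_neg (by omega), pow_succ]

lemma cw_zero (A : Matrix X X ℝ) (k : ℕ) (h : X → X → ℝ) (p : Fin (k+1)) (hp : p ≠ 0) :
    ∑ w, cw A k w * h (w 0) (w p)
      = ∑ x, ∑ y, h x y * ((A ^ (p:ℕ)) x y * (A ^ (k+1-p)) y x) := by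
  have key : ∀ x : X, ∑ w : Fin (k+1) → X, (if w 0 = x then cw A k w * h (w 0) (w p) else 0)
      = ∑ y, h x y * ((A ^ (p:ℕ)) x y * (A ^ (k+1-p)) y x) := by
    intro x
    have hp0 : 0 < (p:ℕ) := Nat.pos_of_ne_zero (fun h => hp (Fin.ext h))
    obtain ⟨r, hr⟩ : ∃ r, (p:ℕ) = r + 1 := ⟨p - 1, by omega⟩
    have hrk : r < k := by have := p.2; omega
    have := path_sum (fun i => if i = r then A * Matrix.diagonal (h x) else A) k
      (fun a b => if a = x then A b a else 0)
    rw [mprod_ins, if_pos hrk] at this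
    have e : ∀ w : Fin (k+1) → X, (if w 0 = x then cw A k w * h (w 0) (w p) else 0) =
       (∏ i : Fin k, (if (i:ℕ) = r then A * Matrix.diagonal (h x) else A) (w i.castSucc) (w i.succ)) *
        (if w 0 = x then A (w (Fin.last k)) (w 0) else 0) := by
      intro w
      split_ifs with hx
      · rw [cw_eq]
        have : ∀ i : Fin k, (if (i:ℕ) = r then A * Matrix.diagonal (h x) else A) (w i.castSucc) (w i.succ)
          = A (w i.castSucc) (w i.succ) * (if i = (⟨r, hrk⟩ : Fin k) then h (w 0) (w p) else 1) := by
          intro i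
          by_cases hi : (i:ℕ) = r
          · have hi' : i = (⟨r, hrk⟩ : Fin k) := Fin.ext hi
            rw [if_pos hi, if_pos hi', Matrix.mul_diagonal, hx]
            have : i.succ = p := by ext; simp [hi, hr]
            rw [this]
          · have hi' : i ≠ (⟨r, hrk⟩ : Fin k) := fun h => hi (by rw [h])
            rw [if_neg hi, if_neg hi', mul_one]
        simp_rw [this, prod_mul_distrib]
        rw [Finset.prod_ite_eq' univ (⟨r, hrk⟩ : Fin k)]
        simp; ring
      · simp
    simp_rw [e]
    rw [this]
    rw [Finset.sum_eq_single x (by intro b _ hb; simp [hb]) (by simp)]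
    simp only [if_true]
    have h3 : k + 1 - (p:ℕ) = (k - (r+1)) + 1 := by omega
    rw [h3, hr]
    simp only [Matrix.mul_apply (M := A ^ (r+1) * Matrix.diagonal (h x)), Matrix.mul_diagonal]
    simp_rw [pow_succ A (k - (r+1)), Matrix.mul_apply (M := A ^ (k - (r+1))), mul_sum, sum_mul]
    rw [sum_comm]
    apply sum_congr rfl; intro y _; apply sum_congr rfl; intro z _; ring
  rw [← sum_congr rfl (fun x _ => key x), sum_comm]
  simp

lemma cw_rot (A : Matrix X X ℝ) (k : ℕ) (h : X → X → ℝ) (i j : Fin (k+1)) (hij : i ≠ j) :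
    ∑ w, cw A k w * h (w i) (w j)
      = ∑ x, ∑ y, h x y * ((A ^ ((j - i : Fin (k+1)):ℕ)) x y * (A ^ (k+1-((j - i : Fin (k+1)):ℕ))) y x) := by
  rw [← cw_zero A k h (j - i) (sub_ne_zero.2 hij.symm)]
  rw [← (Equiv.arrowCongr (Equiv.addRight i) (Equiv.refl X)).sum_comp]
  apply sum_congr rfl; intro w _
  have e1 : ∀ t, (Equiv.arrowCongr (Equiv.addRight i) (Equiv.refl X)) w t = w (t - i) := by
    intro t; simp [Equiv.arrowCongr, sub_eq_add_neg]
  rw [e1, e1, sub_self]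
  congr 1
  unfold cw
  simp_rw [e1]
  rw [← Equiv.prod_comp (Equiv.addRight i)]
  apply prod_congr rfl; intro t _
  simp [add_right_comm t i 1]

end walks

open Finset

section spectral
variable {X : Type*} [Fintype X] [DecidableEq X]

lemma spec_exists (A : Matrix X X ℝ) (hA : A.IsHermitian) :
    ∃ (lam : X → ℝ) (u : X → X → ℝ),
      (∀ p x y, (A ^ p) x y = ∑ i, lam i ^ p * (u i x * u i y)) ∧
      (∀ i, ∑ x, u i x ^ 2 = 1) ∧ (∀ x y, ∑ i, u i x * u i y = if x = y then 1 else 0) := by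
  let U : Matrix X X ℝ := (hA.eigenvectorUnitary : Matrix X X ℝ)
  have hU1 : star U * U = 1 := Unitary.coe_star_mul_self hA.eigenvectorUnitary
  have hU2 : U * star U = 1 := Unitary.coe_mul_star_self hA.eigenvectorUnitary
  obtain ⟨ev, hs⟩ : ∃ ev : X → ℝ, A = U * Matrix.diagonal ev * star U := by
    refine ⟨hA.eigenvalues, ?_⟩
    have := hA.spectral_theorem
    simpa [Unitary.conjStarAlgAut_apply, Function.comp_def, U] using this
  have hp : ∀ p, A ^ p = U * Matrix.diagonal (fun i => ev i ^ p) * star U := by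
    clear_value U
    intro p
    induction p with
    | zero => simp [hU2]
    | succ p ih =>
      rw [pow_succ, ih]
      calc _ = U * Matrix.diagonal (fun i => ev i ^ p) * star U * (U * Matrix.diagonal ev * star U) := by rw [← hs]
        _ = U * Matrix.diagonal (fun i => ev i ^ p) * (star U * U) * Matrix.diagonal ev * star U := by
            simp only [mul_assoc]
        _ = _ := by
          rw [hU1, mul_one, mul_assoc U, Matrix.diagonal_mul_diagonal]
          simp [pow_succ]
  refine ⟨ev, fun i x => U x i, ?_, ?_, ?_⟩
  · intro p x y
    rw [hp]
    simp only [Matrix.mul_apply (N := star U), Matrix.mul_diagonal]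
    apply sum_congr rfl; intro i _
    simp [Matrix.star_apply]; ring
  · intro i
    have := congrFun (congrFun hU1 i) i
    simpa [Matrix.mul_apply, Matrix.star_apply, pow_two] using this
  · intro x y
    have := congrFun (congrFun hU2 x) y
    simpa [Matrix.mul_apply, Matrix.star_apply, Matrix.one_apply] using this

lemma trace_spec (A : Matrix X X ℝ) (lam : X → ℝ) (u : X → X → ℝ)
    (h1 : ∀ p x y, (A ^ p) x y = ∑ i, lam i ^ p * (u i x * u i y))
    (h2 : ∀ i, ∑ x, u i x ^ 2 = 1) (p : ℕ) : (A ^ p).trace = ∑ i, lam i ^ p := by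
  simp only [Matrix.trace, Matrix.diag_apply, h1]
  rw [sum_comm]
  apply sum_congr rfl; intro i _
  rw [← mul_sum]
  have : ∑ x, u i x * u i x = 1 := by rw [← h2 i]; apply sum_congr rfl; intros; ring
  rw [this, mul_one]

lemma trace_lower (A : Matrix X X ℝ) (hA : A.IsHermitian) (n : ℕ) (hn : Even n) :
    ((∑ x, ∑ y, A x y) / (Fintype.card X : ℝ)) ^ n ≤ (A ^ n).trace ∨ Fintype.card X = 0 := by
  by_cases h0 : Fintype.card X = 0
  · exact Or.inr h0
  left
  have hc : (0:ℝ) < Fintype.card X := by exact_mod_cast Nat.pos_of_ne_zero h0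
  obtain ⟨lam, u, h1, h2, h3⟩ := spec_exists A hA
  rw [trace_spec A lam u h1 h2]
  set N : ℝ := (Fintype.card X : ℝ) with hN
  let s : X → ℝ := fun i => ∑ x, u i x
  have es : ∀ i, ∑ x, ∑ y, u i x * u i y = s i ^ 2 := by
    intro i; rw [pow_two, sum_mul_sum]
  have hsum : ∑ x, ∑ y, A x y = ∑ i, lam i * s i ^ 2 := by
    have : ∀ x y, A x y = ∑ i, lam i * (u i x * u i y) := by
      intro x y; have := h1 1 x y; simpa using this
    simp_rw [this, ← es, mul_sum]
    rw [sum_congr rfl (fun x _ => sum_comm), sum_comm]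
  have hs1 : ∑ i, s i ^ 2 = N := by
    simp_rw [← es]
    rw [sum_comm, sum_congr rfl (fun x _ => sum_comm)]
    simp_rw [h3]; simp [hN]
  have hs2 : ∀ i, s i ^ 2 ≤ N := by
    intro i
    have := sq_sum_le_card_mul_sum_sq (s := univ) (f := u i)
    rw [h2] at this
    simpa [hN] using this
  have J := Real.pow_arith_mean_le_arith_mean_pow_of_even univ (fun i => s i ^ 2 / N) lam
    (fun i _ => by positivity) (by rw [← sum_div, hs1, div_self hc.ne']) hn
  calc _ = (∑ i, s i ^ 2 / N * lam i) ^ n := by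
        rw [hsum, sum_div]; congr 1; apply sum_congr rfl; intros; ring
    _ ≤ _ := J
    _ ≤ _ := by
      apply sum_le_sum; intro i _
      have : s i ^ 2 / N ≤ 1 := by rw [div_le_one hc]; exact hs2 i
      have h4 : 0 ≤ lam i ^ n := hn.pow_nonneg _
      nlinarith

/-- conflict sum -/
noncomputable def phi {C : Type*} [DecidableEq C] (f : X → C) (A : Matrix X X ℝ) (p q : ℕ) : ℝ :=
  ∑ x, ∑ y, (if f x = f y then 1 else 0) * ((A ^ p) x y * (A ^ q) y x)

lemma scal_nonneg (s t : ℝ) (hs : 0 ≤ s) (ht : 0 ≤ t) (p q : ℕ) :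
    s ^ p * t ^ q + s ^ q * t ^ p ≤ t ^ (p+q) + s ^ (p+q) := by
  have : 0 ≤ (s ^ p - t ^ p) * (s ^ q - t ^ q) := by
    rcases le_total s t with h | h
    · have h1 : s ^ p ≤ t ^ p := by gcongr
      have h2 : s ^ q ≤ t ^ q := by gcongr
      nlinarith
    · have h1 : t ^ p ≤ s ^ p := by gcongr
      have h2 : t ^ q ≤ s ^ q := by gcongr
      nlinarith
  rw [pow_add, pow_add]; nlinarith

lemma scal_ineq (s t : ℝ) (p q : ℕ) (hpq : Even (p+q)) :
    s ^ (p+2) * t ^ (q+2) + s ^ (q+2) * t ^ (p+2) ≤ s ^ 2 * t ^ (p+q+2) + s ^ (p+q+2) * t ^ 2 := by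
  have h := scal_nonneg |s| |t| (abs_nonneg _) (abs_nonneg _) p q
  rw [hpq.pow_abs, hpq.pow_abs] at h
  have h1 : s ^ p * t ^ q ≤ |s| ^ p * |t| ^ q := by
    rw [← abs_pow, ← abs_pow, ← abs_mul]; exact le_abs_self _
  have h2 : s ^ q * t ^ p ≤ |s| ^ q * |t| ^ p := by
    rw [← abs_pow, ← abs_pow, ← abs_mul]; exact le_abs_self _
  have h3 : 0 ≤ s ^ 2 * t ^ 2 := by positivity
  have := mul_le_mul_of_nonneg_left (add_le_add h1 h2 |>.trans h) h3
  calc _ = s ^ 2 * t ^ 2 * (s ^ p * t ^ q + s ^ q * t ^ p) := by ring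
    _ ≤ _ := this
    _ = _ := by ring

lemma phi_spec {C : Type*} [DecidableEq C] [Fintype C] (f : X → C) (A : Matrix X X ℝ) (lam : X → ℝ) (u : X → X → ℝ)
    (h1 : ∀ p x y, (A ^ p) x y = ∑ i, lam i ^ p * (u i x * u i y)) (p q : ℕ) :
    phi f A p q = ∑ i, ∑ j, lam i ^ p * lam j ^ q * ∑ c, (∑ x, if f x = c then u i x * u j x else 0) ^ 2 := by
  have hK : ∀ i j, ∑ c, (∑ x, if f x = c then u i x * u j x else 0) ^ 2
      = ∑ x, ∑ y, (if f x = f y then 1 else 0) * ((u i x * u j x) * (u i y * u j y)) := by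
    intro i j
    simp_rw [pow_two, sum_mul_sum]
    rw [sum_comm]; apply sum_congr rfl; intro x _
    rw [sum_comm]; apply sum_congr rfl; intro y _
    rw [Finset.sum_eq_single (f x)]
    · by_cases h : f x = f y
      · simp [h]
      · simp [h, Ne.symm h]
    · intro c _ hc; simp [Ne.symm hc]
    · simp
  unfold phi
  simp_rw [hK, h1, sum_mul_sum, mul_sum]
  have e : ∀ g : X → X → X → X → ℝ, ∑ x, ∑ y, ∑ i, ∑ j, g x y i j = ∑ i, ∑ j, ∑ x, ∑ y, g x y i j := by
    intro g
    calc _ = ∑ x, ∑ i, ∑ y, ∑ j, g x y i j := sum_congr rfl (fun x _ => sum_comm)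
      _ = ∑ i, ∑ x, ∑ y, ∑ j, g x y i j := sum_comm
      _ = ∑ i, ∑ x, ∑ j, ∑ y, g x y i j := sum_congr rfl (fun i _ => sum_congr rfl fun x _ => sum_comm)
      _ = _ := sum_congr rfl (fun i _ => sum_comm)
  rw [e]
  refine sum_congr rfl fun i _ => sum_congr rfl fun j _ => sum_congr rfl fun x _ => sum_congr rfl fun y _ => ?_
  ring

lemma phi_le {C : Type*} [DecidableEq C] [Fintype C] (f : X → C) (A : Matrix X X ℝ) (hA : A.IsHermitian)
    (p q : ℕ) (hpq : Even (p+q)) : phi f A (p+2) (q+2) ≤ phi f A 2 (p+q+2) := by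
  obtain ⟨lam, u, h1, h2, h3⟩ := spec_exists A hA
  rw [phi_spec f A lam u h1, phi_spec f A lam u h1]
  set K : X → X → ℝ := fun i j => ∑ c, (∑ x, if f x = c then u i x * u j x else 0) ^ 2 with hK
  have hKn : ∀ i j, 0 ≤ K i j := fun i j => sum_nonneg fun c _ => sq_nonneg _
  have hKs : ∀ i j, K i j = K j i := by
    intro i j; simp only [hK]; simp_rw [mul_comm (u i _)]
  have sw : ∀ a b : ℕ, ∑ i, ∑ j, lam i ^ a * lam j ^ b * K i j = ∑ i, ∑ j, lam i ^ b * lam j ^ a * K i j := by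
    intro a b
    rw [sum_comm]
    refine sum_congr rfl fun i _ => sum_congr rfl fun j _ => ?_
    rw [hKs]; ring
  have dbl : ∀ a b : ℕ, 2 * ∑ i, ∑ j, lam i ^ a * lam j ^ b * K i j = ∑ i, ∑ j, (lam i ^ a * lam j ^ b + lam i ^ b * lam j ^ a) * K i j := by
    intro a b
    simp_rw [add_mul, sum_add_distrib]
    rw [sw b a]; ring
  have : 2 * ∑ i, ∑ j, lam i ^ (p+2) * lam j ^ (q+2) * K i j ≤ 2 * ∑ i, ∑ j, lam i ^ 2 * lam j ^ (p+q+2) * K i j := by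
    rw [dbl, dbl]
    refine sum_le_sum fun i _ => sum_le_sum fun j _ => ?_
    exact mul_le_mul_of_nonneg_right (scal_ineq _ _ p q hpq) (hKn i j)
  linarith

lemma young (v y e : ℝ) (hv : 0 ≤ v) (hy : 0 ≤ y) (he : 0 < e) (m : ℕ) :
    v ^ m * y ≤ e * v ^ (m+1) + (e⁻¹) ^ m * y ^ (m+1) := by
  rcases le_total y (e * v) with h | h
  · have : v ^ m * y ≤ v ^ m * (e * v) := by gcongr
    have h2 : 0 ≤ (e⁻¹) ^ m * y ^ (m+1) := by positivity
    calc _ ≤ _ := this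
      _ = e * v ^ (m+1) := by ring
      _ ≤ _ := by linarith
  · have h1 : v ≤ e⁻¹ * y := by
      rw [inv_mul_eq_div, le_div_iff₀ he]; linarith
    have : v ^ m * y ≤ (e⁻¹ * y) ^ m * y := by gcongr
    have h2 : 0 ≤ e * v ^ (m+1) := by positivity
    calc _ ≤ _ := this
      _ = (e⁻¹) ^ m * y ^ (m+1) := by ring
      _ ≤ _ := by linarith

/-- Main spectral estimate. `l = m + 2`. -/
lemma spec_bound (A B : Matrix X X ℝ) (hA : A.IsHermitian) (hB : ∀ x y, 0 ≤ B x y)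
    (hBs : ∀ x y, B x y = B y x) (rho : ℝ) (hrow : ∀ x, ∑ y, B x y ≤ rho) (hrho : 0 ≤ rho)
    (e : ℝ) (he : 0 < e) (m : ℕ) :
    ∑ x, ∑ y, B x y * (A ^ (2*(m+1))) y x ≤ e * (A ^ (2*(m+2))).trace
      + (e⁻¹) ^ (m+1) * rho ^ m * ∑ x, ∑ y, B x y ^ 2 := by
  obtain ⟨lam, u, h1, h2, h3⟩ := spec_exists A hA
  rw [trace_spec A lam u h1 h2]
  let y : X → ℝ := fun i => ∑ x, ∑ z, B x z * (u i x * u i z)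
  have hL : ∑ x, ∑ z, B x z * (A ^ (2*(m+1))) z x = ∑ i, lam i ^ (2*(m+1)) * y i := by
    simp_rw [h1, y, mul_sum]
    calc _ = ∑ x, ∑ i, ∑ z, B x z * (lam i ^ (2*(m+1)) * (u i z * u i x)) := sum_congr rfl (fun x _ => sum_comm)
      _ = ∑ i, ∑ x, ∑ z, B x z * (lam i ^ (2*(m+1)) * (u i z * u i x)) := sum_comm
      _ = _ := by
        refine sum_congr rfl fun i _ => sum_congr rfl fun x _ => sum_congr rfl fun z _ => ?_
        ring
  have hcol : ∀ z, ∑ x, B x z ≤ rho := by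
    intro z; simp_rw [hBs _ z]; exact hrow z
  have hy1 : ∀ i, |y i| ≤ rho := by
    intro i
    have ha : |y i| ≤ ∑ x, ∑ z, B x z * ((u i x ^ 2 + u i z ^ 2) / 2) := by
      refine (abs_sum_le_sum_abs _ _).trans (sum_le_sum fun x _ => ?_)
      refine (abs_sum_le_sum_abs _ _).trans (sum_le_sum fun z _ => ?_)
      rw [abs_mul, abs_of_nonneg (hB x z)]
      apply mul_le_mul_of_nonneg_left _ (hB x z)
      rw [abs_le]; constructor <;> nlinarith [sq_nonneg (u i x + u i z), sq_nonneg (u i x - u i z)]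
    have hb : ∑ x, ∑ z, B x z * ((u i x ^ 2 + u i z ^ 2) / 2) =
        (∑ x, (∑ z, B x z) * u i x ^ 2) / 2 + (∑ z, (∑ x, B x z) * u i z ^ 2) / 2 := by
      simp_rw [sum_mul]
      rw [sum_comm (s := univ) (t := univ) (f := fun z x => B x z * u i z ^ 2), ← add_div, ← sum_add_distrib, sum_div]
      refine sum_congr rfl fun x _ => ?_
      rw [← sum_add_distrib, sum_div]
      refine sum_congr rfl fun z _ => ?_
      ring
    have hc : ∑ x, (∑ z, B x z) * u i x ^ 2 ≤ rho := by
      calc _ ≤ ∑ x, rho * u i x ^ 2 := sum_le_sum fun x _ => mul_le_mul_of_nonneg_right (hrow x) (sq_nonneg _)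
        _ = rho := by rw [← mul_sum, h2, mul_one]
    have hd : ∑ z, (∑ x, B x z) * u i z ^ 2 ≤ rho := by
      calc _ ≤ ∑ x, rho * u i x ^ 2 := sum_le_sum fun x _ => mul_le_mul_of_nonneg_right (hcol x) (sq_nonneg _)
        _ = rho := by rw [← mul_sum, h2, mul_one]
    linarith
  have hy2 : ∑ i, y i ^ 2 ≤ ∑ x, ∑ z, B x z ^ 2 := by
    have ha : ∀ i, y i ^ 2 ≤ ∑ x, (∑ z, B x z * u i z) ^ 2 := by
      intro i
      have : y i = ∑ x, u i x * (∑ z, B x z * u i z) := by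
        simp only [y, mul_sum]
        refine sum_congr rfl fun x _ => sum_congr rfl fun z _ => ?_
        ring
      rw [this]
      have := sum_mul_sq_le_sq_mul_sq univ (u i) (fun x => ∑ z, B x z * u i z)
      rwa [h2, one_mul] at this
    refine (sum_le_sum fun i _ => ha i).trans (le_of_eq ?_)
    rw [sum_comm]
    refine sum_congr rfl fun x _ => ?_
    simp_rw [pow_two, sum_mul_sum]
    calc _ = ∑ z, ∑ i, ∑ t, B x z * u i z * (B x t * u i t) := sum_comm
      _ = ∑ z, ∑ t, ∑ i, B x z * u i z * (B x t * u i t) := sum_congr rfl fun z _ => sum_comm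
      _ = ∑ z, ∑ t, B x z * B x t * ∑ i, u i z * u i t := by
          refine sum_congr rfl fun z _ => sum_congr rfl fun t _ => ?_
          rw [mul_sum]; refine sum_congr rfl fun i _ => ?_
          ring
      _ = _ := by simp_rw [h3]; simp
  rw [hL]
  have hi : ∀ i, lam i ^ (2*(m+1)) * y i ≤ e * lam i ^ (2*(m+2)) + (e⁻¹) ^ (m+1) * rho ^ m * y i ^ 2 := by
    intro i
    have a1 := young (lam i ^ 2) |y i| e (sq_nonneg _) (abs_nonneg _) he (m+1)
    rw [← pow_mul, ← pow_mul] at a1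
    have a2 : lam i ^ (2*(m+1)) * y i ≤ lam i ^ (2*(m+1)) * |y i| := by
      apply mul_le_mul_of_nonneg_left (le_abs_self _); rw [pow_mul]; positivity
    have a3 : |y i| ^ (m+1+1) ≤ rho ^ m * y i ^ 2 := by
      have : |y i| ^ (m+1+1) = |y i| ^ m * y i ^ 2 := by rw [← sq_abs (y i)]; ring
      rw [this]
      have := hy1 i
      gcongr
    have a4 : (e⁻¹) ^ (m+1) * |y i| ^ (m+1+1) ≤ (e⁻¹) ^ (m+1) * (rho ^ m * y i ^ 2) := by gcongr
    calc _ ≤ _ := a2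
      _ ≤ _ := a1
      _ ≤ _ := by rw [mul_assoc]; linarith
  calc _ ≤ _ := sum_le_sum fun i _ => hi i
    _ = e * ∑ i, lam i ^ (2*(m+2)) + (e⁻¹) ^ (m+1) * rho ^ m * ∑ i, y i ^ 2 := by
      rw [sum_add_distrib, mul_sum, mul_sum]
    _ ≤ _ := by gcongr
end spectral

open Finset
set_option linter.unusedSectionVars false

/-- real indicator -/
noncomputable def ind (p : Prop) : ℝ := open Classical in if p then 1 else 0

lemma ind_nonneg (p : Prop) : 0 ≤ ind p := by unfold ind; split_ifs <;> norm_num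
lemma ind_le_one (p : Prop) : ind p ≤ 1 := by unfold ind; split_ifs <;> norm_num
lemma ind_pos {p : Prop} (h : p) : ind p = 1 := by unfold ind; simp [h]
lemma ind_neg {p : Prop} (h : ¬ p) : ind p = 0 := by unfold ind; simp [h]
lemma ind_mono {p q : Prop} (h : p → q) : ind p ≤ ind q := by
  by_cases hp : p
  · rw [ind_pos hp, ind_pos (h hp)]
  · rw [ind_neg hp]; exact ind_nonneg _
lemma ind_and (p q : Prop) : ind (p ∧ q) = ind p * ind q := by
  unfold ind; split_ifs <;> simp_all
lemma ind_sq (p : Prop) : ind p * ind p = ind p := by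
  unfold ind; split_ifs <;> simp

section basic
variable {α β : Type} [Fintype α] [Fintype β]

/-- reversed relation -/
def flp (E : α → β → Prop) : β → α → Prop := fun b a => E a b
noncomputable def sz (E : α → β → Prop) : ℝ := ∑ a, ∑ b, ind (E a b)
noncomputable def dA (E : α → β → Prop) (a : α) : ℝ := ∑ b, ind (E a b)
noncomputable def cA (E : α → β → Prop) (a a' : α) : ℝ := ∑ b, ind (E a b) * ind (E a' b)
noncomputable def Gam (E : α → β → Prop) : ℝ := ∑ a, ∑ a', cA E a a' ^ 2
noncomputable def gg (E : α → β → Prop) (a : α) (b : β) : ℝ :=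
  ∑ a', ∑ b', ind (E a' b) * ind (E a b') * ind (E a' b')

variable (E : α → β → Prop)

lemma sum4 (f : α → α → β → β → ℝ) :
    ∑ a, ∑ a', ∑ b, ∑ b', f a a' b b' = ∑ b, ∑ b', ∑ a, ∑ a', f a a' b b' := by
  calc _ = ∑ a, ∑ b, ∑ a', ∑ b', f a a' b b' := sum_congr rfl fun a _ => sum_comm
    _ = ∑ b, ∑ a, ∑ a', ∑ b', f a a' b b' := sum_comm
    _ = ∑ b, ∑ a, ∑ b', ∑ a', f a a' b b' := sum_congr rfl fun a _ => sum_congr rfl fun _ _ => sum_comm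
    _ = _ := sum_congr rfl fun a _ => sum_comm

lemma sz_flp : sz (flp E) = sz E := by unfold sz flp; exact sum_comm
lemma sz_nonneg : 0 ≤ sz E := sum_nonneg fun _ _ => sum_nonneg fun _ _ => ind_nonneg _
lemma dA_nonneg (a : α) : 0 ≤ dA E a := sum_nonneg fun _ _ => ind_nonneg _
lemma cA_nonneg (a a' : α) : 0 ≤ cA E a a' := sum_nonneg fun _ _ => mul_nonneg (ind_nonneg _) (ind_nonneg _)
lemma Gam_nonneg : 0 ≤ Gam E := sum_nonneg fun _ _ => sum_nonneg fun _ _ => sq_nonneg _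
lemma gg_nonneg (a : α) (b : β) : 0 ≤ gg E a b :=
  sum_nonneg fun _ _ => sum_nonneg fun _ _ => mul_nonneg (mul_nonneg (ind_nonneg _) (ind_nonneg _)) (ind_nonneg _)
lemma cA_comm (a a' : α) : cA E a a' = cA E a' a := by
  unfold cA; simp_rw [mul_comm]
lemma cA_self (a : α) : cA E a a = dA E a := by unfold cA dA; simp_rw [ind_sq]
lemma cA_le (a a' : α) : cA E a a' ≤ dA E a :=
  sum_le_sum fun b _ => by nlinarith [ind_nonneg (E a b), ind_le_one (E a' b), ind_nonneg (E a' b)]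
lemma sz_eq : sz E = ∑ a, dA E a := rfl

lemma mixed (f h k m : α → β → ℝ) :
    ∑ a, ∑ a', (∑ b, f a b * h a' b) * (∑ b, k a b * m a' b)
     = ∑ b, ∑ b', (∑ a, f a b * k a b') * (∑ a, h a b * m a b') := by
  simp_rw [sum_mul_sum]
  rw [sum4]
  refine sum_congr rfl fun b _ => sum_congr rfl fun b' _ => sum_congr rfl fun a _ => sum_congr rfl fun a' _ => ?_
  ring

lemma Gam_flp : Gam (flp E) = Gam E := by
  unfold Gam cA flp
  simp_rw [pow_two]
  rw [mixed]

lemma gg_flp (a : α) (b : β) : gg (flp E) b a = gg E a b := by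
  unfold gg flp
  rw [sum_comm]
  refine sum_congr rfl fun a' _ => sum_congr rfl fun b' _ => ?_
  ring

lemma gg_eq (a : α) (b : β) : gg E a b = ∑ a', ind (E a' b) * cA E a a' := by
  unfold gg cA
  simp_rw [mul_sum, mul_assoc]

lemma Gam_eq4 : Gam E = ∑ a, ∑ a', ∑ b, ∑ b', ind (E a b) * ind (E a' b) * (ind (E a b') * ind (E a' b')) := by
  unfold Gam cA; simp_rw [pow_two, sum_mul_sum]

lemma sum_gg (h : α → β → ℝ) : ∑ a, ∑ b, h a b * gg E a b = ∑ a, ∑ a', (∑ b, h a b * ind (E a' b)) * cA E a a' := by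
  simp_rw [gg_eq, mul_sum, sum_mul]
  refine sum_congr rfl fun a _ => ?_
  rw [sum_comm]
  refine sum_congr rfl fun a' _ => sum_congr rfl fun b' _ => ?_
  ring

lemma sum_gg_E : ∑ a, ∑ b, ind (E a b) * gg E a b = Gam E := by
  rw [sum_gg]; unfold Gam; simp_rw [pow_two]; rfl

lemma sum_cA : ∑ a, ∑ a', cA E a a' = ∑ b, dA (flp E) b ^ 2 := by
  unfold cA dA flp
  simp_rw [pow_two, sum_mul_sum]
  rw [sum_congr rfl fun a _ => sum_comm, sum_comm]

lemma sum_cA_le (D : ℝ) (hD : ∀ b, dA (flp E) b ≤ D) : ∑ a, ∑ a', cA E a a' ≤ D * sz E := by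
  rw [sum_cA, ← sz_flp, sz_eq, mul_sum]
  refine sum_le_sum fun b _ => ?_
  rw [pow_two]; exact mul_le_mul_of_nonneg_right (hD b) (dA_nonneg _ _)

lemma sz_ge_one (h : 0 < sz E) : 1 ≤ sz E := by
  by_contra hlt
  push Not at hlt
  have : ∀ a b, ¬ E a b := by
    intro a b hab
    have h1 : ind (E a b) ≤ ∑ b', ind (E a b') := single_le_sum (f := fun b' => ind (E a b')) (fun _ _ => ind_nonneg _) (mem_univ b)
    have h2 : ∑ b', ind (E a b') ≤ sz E :=
      single_le_sum (f := fun a => ∑ b', ind (E a b')) (fun _ _ => sum_nonneg fun _ _ => ind_nonneg _) (mem_univ a)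
    rw [ind_pos hab] at h1
    linarith
  have : sz E = 0 := by unfold sz; simp [ind_neg (this _ _)]
  linarith

lemma sz_mono {E E' : α → β → Prop} (h : ∀ a b, E' a b → E a b) : sz E' ≤ sz E :=
  sum_le_sum fun a _ => sum_le_sum fun b _ => ind_mono (h a b)
lemma dA_mono {E E' : α → β → Prop} (h : ∀ a b, E' a b → E a b) (a : α) : dA E' a ≤ dA E a :=
  sum_le_sum fun b _ => ind_mono (h a b)

structure ExtK (K D : ℝ) (E : α → β → Prop) : Prop where
  pos : 0 < sz E
  degA : ∀ a, dA E a ≤ D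
  degB : ∀ b, dA (flp E) b ≤ D
  dens : K * D * sz E ≤ Gam E
  mx : ∀ (E' : α → β → Prop) (D' : ℝ), (∀ a b, E' a b → E a b) → (∀ a, dA E' a ≤ D') →
    (∀ b, dA (flp E') b ≤ D') → Gam E' < K * D' * sz E' ∨ Gam E' ^ 3 * sz E ^ 4 ≤ Gam E ^ 3 * sz E' ^ 4

lemma ExtK.flip {K D : ℝ} {E : α → β → Prop} (h : ExtK K D E) : ExtK K D (flp E) where
  pos := by rw [sz_flp]; exact h.pos
  degA := h.degB
  degB := h.degA
  dens := by rw [sz_flp, Gam_flp]; exact h.dens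
  mx := by
    intro E' D' h1 h2 h3
    have := h.mx (flp E') D' (fun a b hab => h1 b a hab) h3 h2
    rw [sz_flp, Gam_flp] at this
    rw [sz_flp, Gam_flp]; exact this

lemma ExtK.lin {K D : ℝ} {E : α → β → Prop} (h : ExtK K D E) (E' : α → β → Prop) (hE : ∀ a b, E' a b → E a b) :
    Gam E' * sz E ≤ Gam E * sz E' := by
  have hs' := sz_nonneg E'
  have hs := h.pos
  have hG := Gam_nonneg E
  have hG' := Gam_nonneg E'
  rcases h.mx E' D hE (fun a => (dA_mono hE a).trans (h.degA a))
    (fun b => (dA_mono (E := flp E) (fun b a hab => hE a b hab) b).trans (h.degB b)) with h1 | h1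
  · have := h.dens
    calc _ ≤ K * D * sz E' * sz E := by gcongr
      _ = K * D * sz E * sz E' := by ring
      _ ≤ _ := by gcongr
  · have h2 : sz E' ≤ sz E := sz_mono hE
    have h3 : (Gam E' * sz E) ^ 3 * sz E ≤ (Gam E * sz E') ^ 3 * sz E := by
      calc _ = Gam E' ^ 3 * sz E ^ 4 := by ring
        _ ≤ _ := h1
        _ = Gam E ^ 3 * sz E' ^ 3 * sz E' := by ring
        _ ≤ Gam E ^ 3 * sz E' ^ 3 * sz E := by gcongr
        _ = _ := by ring
    have h4 := le_of_mul_le_mul_right h3 hs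
    exact le_of_pow_le_pow_left₀ (by norm_num) (by positivity) h4

/-- regular flags -/
def Reg (E : α → β → Prop) : α → β → Prop := fun a b => E a b ∧ gg E a b ≤ 10^6 * (Gam E / sz E)
/-- heavy flags -/
def Hv (E : α → β → Prop) : α → β → Prop := fun a b => E a b ∧ 10^6 * (Gam E / sz E) < gg E a b

lemma Reg_flp (a : α) (b : β) : Reg (flp E) b a ↔ Reg E a b := by
  unfold Reg; rw [gg_flp, Gam_flp, sz_flp]; rfl
lemma flp_Reg : flp (Reg E) = Reg (flp E) := by
  funext b a; exact propext (Reg_flp E a b).symm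
lemma Hv_flp (a : α) (b : β) : Hv (flp E) b a ↔ Hv E a b := by
  unfold Hv; rw [gg_flp, Gam_flp, sz_flp]; rfl
lemma ind_split (a : α) (b : β) : ind (E a b) = ind (Reg E a b) + ind (Hv E a b) := by
  by_cases h : E a b
  · by_cases h2 : gg E a b ≤ 10^6 * (Gam E / sz E)
    · rw [ind_pos h, ind_pos (show Reg E a b from ⟨h, h2⟩), ind_neg (show ¬ Hv E a b from fun h3 => absurd h3.2 (not_lt.2 h2))]; ring
    · rw [ind_pos h, ind_neg (show ¬ Reg E a b from fun h3 => h2 h3.2), ind_pos (show Hv E a b from ⟨h, not_le.1 h2⟩)]; ring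
  · rw [ind_neg h, ind_neg (show ¬ Reg E a b from fun h3 => h h3.1), ind_neg (show ¬ Hv E a b from fun h3 => h h3.1)]; ring

lemma heavy {K D : ℝ} {E : α → β → Prop} (h : ExtK K D E) :
    ∑ a, ∑ b, ind (Hv E a b) * gg E a b ≤ Gam E / 100 := by
  set S := ∑ a, ∑ b, ind (Hv E a b) * gg E a b with hS
  have hs := h.pos
  have hG := Gam_nonneg E
  have hS0 : 0 ≤ S := sum_nonneg fun _ _ => sum_nonneg fun _ _ => mul_nonneg (ind_nonneg _) (gg_nonneg _ _ _)
  have h1 : S ^ 2 ≤ (∑ a, ∑ a', (∑ b, ind (Hv E a b) * ind (E a' b)) ^ 2) * Gam E := by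
    rw [hS, sum_gg]; unfold Gam
    have := sum_mul_sq_le_sq_mul_sq (univ : Finset (α × α)) (fun p => ∑ b, ind (Hv E p.1 b) * ind (E p.2 b)) (fun p => cA E p.1 p.2)
    simpa only [Fintype.sum_prod_type] using this
  have h2 : (∑ a, ∑ a', (∑ b, ind (Hv E a b) * ind (E a' b)) ^ 2) ^ 2 ≤ Gam (Hv E) * Gam E := by
    simp_rw [pow_two (∑ b, ind (Hv E _ b) * ind (E _ b))]
    rw [mixed, ← Gam_flp E, ← Gam_flp (Hv E)]; unfold Gam
    have := sum_mul_sq_le_sq_mul_sq (univ : Finset (β × β)) (fun p => cA (flp (Hv E)) p.1 p.2) (fun p => cA (flp E) p.1 p.2)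
    simp only [Fintype.sum_prod_type] at this
    exact this
  have h3 := h.lin (Hv E) (fun a b hab => hab.1)
  have h4 : 10^6 * Gam E * sz (Hv E) ≤ S * sz E := by
    have : 10^6 * (Gam E / sz E) * sz (Hv E) ≤ S := by
      unfold sz
      rw [mul_sum]; refine sum_le_sum fun a _ => ?_
      rw [mul_sum]; refine sum_le_sum fun b _ => ?_
      by_cases hh : Hv E a b
      · rw [ind_pos hh, mul_one, one_mul]; exact hh.2.le
      · rw [ind_neg hh]; simp
    calc _ = 10^6 * (Gam E / sz E) * sz (Hv E) * sz E := by field_simp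
      _ ≤ _ := by gcongr
  set Q := ∑ a, ∑ a', (∑ b, ind (Hv E a b) * ind (E a' b)) ^ 2
  have h5 : S ^ 4 ≤ Gam (Hv E) * Gam E ^ 3 := by
    calc S ^ 4 = (S ^ 2) ^ 2 := by ring
      _ ≤ (Q * Gam E) ^ 2 := by gcongr
      _ = Q ^ 2 * Gam E ^ 2 := by ring
      _ ≤ (Gam (Hv E) * Gam E) * Gam E ^ 2 := by gcongr
      _ = _ := by ring
  have h6 : 10^6 * S ^ 4 ≤ S * Gam E ^ 3 := by
    have : (10^6 * S ^ 4) * sz E ≤ (S * Gam E ^ 3) * sz E := by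
      calc _ ≤ (10^6 * (Gam (Hv E) * Gam E ^ 3)) * sz E := by gcongr
        _ = 10^6 * (Gam (Hv E) * sz E) * Gam E ^ 3 := by ring
        _ ≤ 10^6 * (Gam E * sz (Hv E)) * Gam E ^ 3 := by gcongr
        _ = (10^6 * Gam E * sz (Hv E)) * Gam E ^ 3 := by ring
        _ ≤ (S * sz E) * Gam E ^ 3 := by gcongr
        _ = _ := by ring
    exact le_of_mul_le_mul_right this hs
  rcases hS0.eq_or_lt with h7 | h7
  · rw [← h7]; positivity
  · have h8 : S ^ 3 ≤ (Gam E / 100) ^ 3 := by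
      have : S * (10^6 * S^3) ≤ S * Gam E ^ 3 := by calc _ = 10^6 * S ^ 4 := by ring
                                                      _ ≤ _ := h6
      have := le_of_mul_le_mul_left this h7
      rw [div_pow]; rw [le_div_iff₀ (by norm_num)]; linarith
    exact le_of_pow_le_pow_left₀ (by norm_num) (by positivity) h8
end basic

open Finset
set_option linter.unusedSectionVars false

section counting
open Classical

lemma sum_ind_card {W : Type*} [Fintype W] (P : W → Prop) [Fintype {w // P w}] : ∑ w, ind (P w) = (Fintype.card {w // P w} : ℝ) := by
  unfold ind
  rw [Fintype.card_subtype, sum_boole]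

lemma sum_sub {W : Type*} [Fintype W] (P : W → Prop) [Fintype {w // P w}] (f : W → ℝ) :
    ∑ x : {w // P w}, f x = ∑ w, ind (P w) * f w := by
  unfold ind
  simp_rw [ite_mul, one_mul, zero_mul]
  rw [← sum_filter]
  exact (Finset.sum_subtype _ (by simp) f).symm

lemma sum_sub2 {W : Type*} [Fintype W] (P : W → Prop) [Fintype {w // P w}] (f : W → W → ℝ) :
    ∑ x : {w // P w}, ∑ y : {w // P w}, f x y = ∑ w, ind (P w) * ∑ w', ind (P w') * f w w' := by
  rw [sum_sub P (fun x => ∑ y : {w // P w}, f x y)]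
  exact sum_congr rfl fun w _ => by rw [sum_sub P (f w)]

lemma sum_sub3 {W : Type*} [Fintype W] (P : W → Prop) [Fintype {w // P w}] (f : W → W → W → ℝ) :
    ∑ x : {w // P w}, ∑ y : {w // P w}, ∑ z : {w // P w}, f x y z
      = ∑ w, ind (P w) * ∑ w', ind (P w') * ∑ w'', ind (P w'') * f w w' w'' := by
  rw [sum_sub P (fun x => ∑ y : {w // P w}, ∑ z : {w // P w}, f x y z)]
  exact sum_congr rfl fun w _ => by rw [sum_sub2 P (f w)]

variable {X ι : Type} [Fintype X] [Fintype ι] [DecidableEq ι]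

lemma count_rep (i j : ι) (hij : i ≠ j) :
    ∑ w : ι → X, ind (w i = w j) ≤ (Fintype.card X : ℝ) ^ (Fintype.card ι - 1) := by
  rw [sum_ind_card]
  have : Fintype.card {w : ι → X // w i = w j} ≤ Fintype.card ({t : ι // t ≠ j} → X) := by
    apply Fintype.card_le_of_injective (fun w t => w.1 t.1)
    intro w w' h
    apply Subtype.ext; funext t
    by_cases ht : t = j
    · rw [ht, ← w.2, ← w'.2]; exact congrFun h ⟨i, hij⟩
    · exact congrFun h ⟨t, ht⟩
  rw [Fintype.card_fun] at this
  have h2 : Fintype.card {t : ι // t ≠ j} = Fintype.card ι - 1 := by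
    rw [Fintype.card_subtype_compl]; simp
  rw [h2] at this
  exact_mod_cast this

lemma count_tri (i j k : ι) (hij : i ≠ j) (hjk : j ≠ k) (hik : i ≠ k) (T : X → X → X → Prop) :
    ∑ w : ι → X, ind (T (w i) (w j) (w k)) ≤
      (∑ x, ∑ y, ∑ z, ind (T x y z)) * (Fintype.card X : ℝ) ^ (Fintype.card ι - 3) := by
  have e : ∑ x, ∑ y, ∑ z, ind (T x y z) = ∑ t : X × X × X, ind (T t.1 t.2.1 t.2.2) := by
    simp [Fintype.sum_prod_type]
  rw [e, sum_ind_card, sum_ind_card]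
  have : Fintype.card {w : ι → X // T (w i) (w j) (w k)} ≤
     Fintype.card ({t : X × X × X // T t.1 t.2.1 t.2.2} × ({t : ι // t ∉ ({i, j, k} : Finset ι)} → X)) := by
    apply Fintype.card_le_of_injective (fun w => (⟨(w.1 i, w.1 j, w.1 k), w.2⟩, fun t => w.1 t.1))
    intro w w' h
    simp only [Prod.mk.injEq, Subtype.mk.injEq] at h
    obtain ⟨⟨h1, h2, h3⟩, h4⟩ := h
    apply Subtype.ext; funext t
    by_cases ht : t ∈ ({i, j, k} : Finset ι)
    · simp at ht
      rcases ht with rfl | rfl | rfl <;> assumption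
    · exact congrFun h4 ⟨t, ht⟩
  rw [Fintype.card_prod, Fintype.card_fun] at this
  have h2 : Fintype.card {t : ι // t ∉ ({i, j, k} : Finset ι)} = Fintype.card ι - 3 := by
    rw [Fintype.card_subtype_compl]
    congr 1
    rw [Fintype.card_coe, Finset.card_eq_three.2 ⟨i, j, k, hij, hik, hjk, rfl⟩]
  rw [h2] at this
  exact_mod_cast this

lemma direct_local (k : ℕ) (hk : 3 ≤ k) (hev : Even (k+1)) (Y : X → X → Prop) (hY : ∀ x y, Y x y → Y y x)
    (T : X → X → X → Prop)
    (hT : ∀ w : Fin (k+1) → X, Function.Injective w → (∀ i, Y (w i) (w (i+1))) → ∃ i, T (w (i-1)) (w i) (w (i+1))) :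
    ∑ x, ∑ y, ind (Y x y) ≤ (Fintype.card X : ℝ) ^ 2 / 16 + 16 ^ (k+1) *
      (((k:ℝ)+1) ^ 2 * (Fintype.card X : ℝ) + ((k:ℝ)+1) * ∑ x, ∑ y, ∑ z, ind (T x y z)) := by
  set B := ∑ x, ∑ y, ∑ z, ind (T x y z) with hB
  have hB0 : 0 ≤ B := sum_nonneg fun _ _ => sum_nonneg fun _ _ => sum_nonneg fun _ _ => ind_nonneg _
  set c : ℝ := (Fintype.card X : ℝ) with hc
  have hc0 : 0 ≤ c := Nat.cast_nonneg _
  set S := ∑ x, ∑ y, ind (Y x y) with hS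
  have hSle : S ≤ c ^ 2 := by
    calc S ≤ ∑ x : X, ∑ y : X, (1:ℝ) := sum_le_sum fun _ _ => sum_le_sum fun _ _ => ind_le_one _
      _ = c ^ 2 := by simp [hc, pow_two]
  by_cases h1 : S ≤ c ^ 2 / 16
  · have : 0 ≤ (16:ℝ) ^ (k+1) * (((k:ℝ)+1) ^ 2 * c + ((k:ℝ)+1) * B) := by positivity
    linarith
  push Not at h1
  let A : Matrix X X ℝ := fun x y => ind (Y x y)
  have hA : A.IsHermitian := by
    ext x y
    simp only [Matrix.conjTranspose_apply, star_trivial, A]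
    exact le_antisymm (ind_mono (hY _ _)) (ind_mono (hY _ _))
  rcases trace_lower A hA (k+1) hev with h2 | h2
  swap
  · have : c = 0 := by rw [hc, h2]; simp
    rw [this] at h1 hSle; norm_num at h1 hSle; linarith
  have hcpos : 1 ≤ c := by
    have : Fintype.card X ≠ 0 := by
      intro h; rw [hc, h] at h1 hSle; norm_num at h1 hSle; linarith
    have := Nat.one_le_iff_ne_zero.2 this
    rw [hc]; exact_mod_cast this
  have h3 : (c / 16) ^ (k+1) ≤ (A ^ (k+1)).trace := by
    refine le_trans ?_ h2
    refine pow_le_pow_left₀ (by positivity) ?_ _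
    change c / 16 ≤ S / c
    rw [le_div_iff₀ (by linarith)]; nlinarith
  have h4 : (A ^ (k+1)).trace ≤ ((k:ℝ)+1) ^ 2 * c ^ k + ((k:ℝ)+1) * (B * c ^ (k-2)) := by
    rw [← cw_trace]
    have hw : ∀ w : Fin (k+1) → X, cw A k w ≤ (∑ i, ∑ j, if i = j then 0 else ind (w i = w j)) + ∑ i, ind (T (w (i-1)) (w i) (w (i+1))) := by
      intro w
      have hn1 : 0 ≤ ∑ i, ∑ j, if i = j then 0 else ind (w i = w j) :=
        sum_nonneg fun i _ => sum_nonneg fun j _ => by split_ifs; exacts [le_rfl, ind_nonneg _]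
      have hn2 : 0 ≤ ∑ i, ind (T (w (i-1)) (w i) (w (i+1))) := sum_nonneg fun _ _ => ind_nonneg _
      by_cases hY2 : ∀ i, Y (w i) (w (i+1))
      · have hcw : cw A k w ≤ 1 := prod_le_one (fun i _ => ind_nonneg _) (fun i _ => ind_le_one _)
        by_cases hinj : Function.Injective w
        · obtain ⟨i, hi⟩ := hT w hinj hY2
          have : ind (T (w (i-1)) (w i) (w (i+1))) ≤ ∑ i, ind (T (w (i-1)) (w i) (w (i+1))) :=
            single_le_sum (f := fun i => ind (T (w (i-1)) (w i) (w (i+1)))) (fun _ _ => ind_nonneg _) (mem_univ i)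
          rw [ind_pos hi] at this; linarith
        · simp only [Function.Injective, not_forall] at hinj
          obtain ⟨i, j, hij, hne⟩ := hinj
          have a1 : (if i = j then 0 else ind (w i = w j)) ≤ ∑ j, if i = j then 0 else ind (w i = w j) :=
            single_le_sum (f := fun j => if i = j then 0 else ind (w i = w j)) (fun j _ => by split_ifs; exacts [le_rfl, ind_nonneg _]) (mem_univ j)
          have a2 : (∑ j, if i = j then 0 else ind (w i = w j)) ≤ ∑ i, ∑ j, if i = j then 0 else ind (w i = w j) :=
            single_le_sum (f := fun i => ∑ j, if i = j then 0 else ind (w i = w j)) (fun i _ => sum_nonneg fun j _ => by split_ifs; exacts [le_rfl, ind_nonneg _]) (mem_univ i)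
          rw [if_neg hne, ind_pos hij] at a1; linarith
      · push Not at hY2
        obtain ⟨i, hi⟩ := hY2
        have : cw A k w = 0 := prod_eq_zero (mem_univ i) (ind_neg hi)
        rw [this]; linarith
    have s1 : ∑ w : Fin (k+1) → X, ∑ i, ∑ j, (if i = j then 0 else ind (w i = w j)) ≤ ((k:ℝ)+1) ^ 2 * c ^ k := by
      rw [sum_comm]
      rw [sum_congr rfl fun i _ => sum_comm]
      calc _ ≤ ∑ i : Fin (k+1), ∑ j : Fin (k+1), c ^ k := by
            refine sum_le_sum fun i _ => sum_le_sum fun j _ => ?_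
            by_cases hij : i = j
            · simp [hij]; positivity
            · simp only [hij, if_false]
              have := count_rep (X := X) i j hij
              simpa using this
        _ = _ := by simp; ring
    have s2 : ∑ w : Fin (k+1) → X, ∑ i, ind (T (w (i-1)) (w i) (w (i+1))) ≤ ((k:ℝ)+1) * (B * c ^ (k-2)) := by
      rw [sum_comm]
      calc _ ≤ ∑ i : Fin (k+1), B * c ^ (k-2) := by
            refine sum_le_sum fun i _ => ?_
            have hone : (1 : Fin (k+1)) ≠ 0 := by
              intro h; have := congrArg Fin.val h; simp at this; omega
            have htwo : (1 + 1 : Fin (k+1)) ≠ 0 := by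
              intro h; have := congrArg Fin.val h
              rw [Fin.val_add, Fin.val_one', Nat.mod_eq_of_lt (by omega : 1 < k+1)] at this
              simp at this
              rw [Nat.mod_eq_of_lt (by omega)] at this; omega
            have := count_tri (X := X) (i-1) i (i+1) (by simpa [sub_eq_iff_eq_add] using hone) (by simpa using hone)
              (by intro h; apply htwo; rw [sub_eq_iff_eq_add, add_assoc] at h; simpa using h) T
            simpa using this
        _ = _ := by simp
    calc _ ≤ _ := sum_le_sum fun w _ => hw w
      _ ≤ _ := by rw [sum_add_distrib]; linarith
  have h5 : c ^ 2 * c ^ (k-1) ≤ (16 ^ (k+1) * (((k:ℝ)+1) ^ 2 * c + ((k:ℝ)+1) * B)) * c ^ (k-1) := by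
    have e1 : c ^ 2 * c ^ (k-1) = c ^ (k+1) := by rw [← pow_add]; congr 1; omega
    have e2 : c ^ k = c * c ^ (k-1) := by rw [← pow_succ']; congr 1; omega
    have e3 : c ^ (k-2) ≤ c ^ (k-1) := pow_le_pow_right₀ hcpos (by omega)
    rw [e1]
    have := h3.trans h4
    rw [div_pow, div_le_iff₀ (by positivity)] at this
    refine this.trans ?_
    rw [e2]
    have : ((k:ℝ)+1) * (B * c ^ (k-2)) ≤ ((k:ℝ)+1) * (B * c ^ (k-1)) := by gcongr
    calc _ ≤ (((k:ℝ)+1) ^ 2 * (c * c ^ (k-1)) + ((k:ℝ)+1) * (B * c ^ (k-1))) * 16 ^ (k+1) := by gcongr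
      _ = _ := by ring
  have h6 := le_of_mul_le_mul_right h5 (by positivity)
  have : 0 ≤ c ^ 2 / 16 := by positivity
  linarith
end counting

section direct
variable {α β : Type} [Fintype α] [Fintype β] {V V' : Type}

def PSeq (E : α → β → Prop) (πA : α → V) (πB : β → V') (k : ℕ) : Prop :=
  ∃ (a : Fin (k+1) → α) (b : Fin (k+1) → β),
    (∀ i, E (a i) (b i) ∧ E (a i) (b (i+1)) ∧ E (a (i+1)) (b i)) ∧
    Function.Injective (πA ∘ a) ∧ Function.Injective (πB ∘ b)

lemma PSeq_flp (E : α → β → Prop) (πA : α → V) (πB : β → V') (k : ℕ) (h : PSeq (flp E) πB πA k) :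
    PSeq E πA πB k := by
  obtain ⟨b, a, h1, h2, h3⟩ := h
  exact ⟨a, b, fun i => ⟨(h1 i).1, (h1 i).2.2, (h1 i).2.1⟩, h3, h2⟩

structure LI (E : α → β → Prop) (πA : α → V) (πB : β → V') : Prop where
  hB : ∀ a b b', E a b → E a b' → πB b = πB b' → b = b'
  hA : ∀ a a' b, E a b → E a' b → πA a = πA a' → a = a'

lemma LI.flip {E : α → β → Prop} {πA : α → V} {πB : β → V'} (h : LI E πA πB) : LI (flp E) πB πA where
  hB := fun b a a' h1 h2 h3 => h.hA a a' b h1 h2 h3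
  hA := fun b b' a h1 h2 h3 => h.hB a b b' h1 h2 h3

noncomputable def tri (E : α → β → Prop) (b1 b2 b3 : β) : ℝ := ∑ a, ind (E a b1) * ind (E a b2) * ind (E a b3)

lemma hall_seq {E : α → β → Prop} {πA : α → V} {πB : β → V'} (hLI : LI E πA πB) (k : ℕ) (b : Fin (k+1) → β)
    (hb : Function.Injective (πB ∘ b)) (ht : ∀ i, (k:ℝ)+1 ≤ tri E (b (i-1)) (b i) (b (i+1))) :
    PSeq E πA πB k := by
  classical
  let s : Fin (k+1) → Finset α := fun i => univ.filter fun a => E a (b (i-1)) ∧ E a (b i) ∧ E a (b (i+1))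
  have hs : ∀ i, k + 1 ≤ ((s i).image πA).card := by
    intro i
    rw [card_image_of_injOn]
    · have := ht i
      have e : tri E (b (i-1)) (b i) (b (i+1)) = ((s i).card : ℝ) := by
        unfold tri
        simp_rw [← ind_and, ind]
        simp only [s, sum_boole, and_assoc]
      rw [e] at this; exact_mod_cast this
    · intro x hx y hy hxy
      simp [s] at hx hy
      exact hLI.hA x y (b i) hx.2.1 hy.2.1 hxy
  have := (Finset.all_card_le_biUnion_card_iff_exists_injective (fun i => (s i).image πA)).1 (by
    intro S
    rcases S.eq_empty_or_nonempty with rfl | ⟨i, hi⟩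
    · simp
    · calc S.card ≤ k + 1 := by simpa using S.card_le_univ
        _ ≤ _ := hs i
        _ ≤ _ := card_le_card (subset_biUnion_of_mem (fun i => (s i).image πA) hi))
  obtain ⟨f, hf, hfm⟩ := this
  have : ∀ i, ∃ a, (E a (b (i-1)) ∧ E a (b i) ∧ E a (b (i+1))) ∧ πA a = f i := by
    intro i
    have := hfm i
    simp only [mem_image, s, mem_filter, mem_univ, true_and] at this
    exact this
  choose a ha1 ha2 using this
  refine ⟨a, b, fun i => ⟨(ha1 i).2.1, (ha1 i).2.2, ?_⟩, ?_, hb⟩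
  · have := (ha1 (i+1)).1
    rwa [add_sub_cancel_right] at this
  · intro i j hij
    simp only [Function.comp, ha2] at hij
    exact hf hij

lemma Reg.sub {E : α → β → Prop} {a : α} {b : β} (h : Reg E a b) : E a b := h.1

lemma direct {K D : ℝ} {E : α → β → Prop} (h : ExtK K D E) {πA : α → V} {πB : β → V'} (hLI : LI E πA πB)
    (k : ℕ) (hk : 3 ≤ k) (hev : Even (k+1)) (hno : ¬ PSeq E πA πB k) (C M : ℝ) (hM0 : 0 ≤ M) (hK : 0 < K) (hC : 0 < C)
    (hM : M ^ 2 = C ^ 2 * (Gam E / sz E)) (hG : 0 < Gam E)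
    (hKC : 16 ^ (k+1) * (((k:ℝ)+1) ^ 2 / K + ((k:ℝ)+1) ^ 2 * 10 ^ 6 / C ^ 2) ≤ 1 / 16) :
    ∑ a, ∑ a', ∑ b, ∑ b', ind (M ≤ cA (flp E) b b') * (ind (Reg E a b) * ind (E a' b)) * (ind (Reg E a b') * ind (E a' b'))
      ≤ Gam E / 8 := by
  classical
  set T : β → β → β → Prop := fun b1 b2 b3 => M ≤ cA (flp E) b1 b2 ∧ M ≤ cA (flp E) b2 b3 ∧ tri E b1 b2 b3 < k + 1 with hTdef
  set B : α → α → ℝ := fun a a' => ∑ b1, ind (Reg E a b1 ∧ E a' b1) * ∑ b2, ind (Reg E a b2 ∧ E a' b2) * ∑ b3, ind (Reg E a b3 ∧ E a' b3) * ind (T b1 b2 b3) with hBdef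
  have hs := h.pos
  have hreg : ∀ a a', ∑ b, ind (Reg E a b ∧ E a' b) ≤ cA E a a' := by
    intro a a'
    unfold cA
    refine sum_le_sum fun b _ => ?_
    rw [ind_and]
    exact mul_le_mul_of_nonneg_right (ind_mono Reg.sub) (ind_nonneg _)
  have loc : ∀ a a', ∑ b, ∑ b', ind (M ≤ cA (flp E) b b') * (ind (Reg E a b) * ind (E a' b)) * (ind (Reg E a b') * ind (E a' b'))
      ≤ cA E a a' ^ 2 / 16 + 16 ^ (k+1) * (((k:ℝ)+1) ^ 2 * cA E a a' + ((k:ℝ)+1) * B a a') := by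
    intro a a'
    have := direct_local (X := {b // Reg E a b ∧ E a' b}) k hk hev (fun x y => M ≤ cA (flp E) x y)
      (fun x y hxy => by rw [cA_comm]; exact hxy) (fun x y z => T x y z) (by
        intro w hw hY
        by_contra hcon
        push Not at hcon
        apply hno
        apply hall_seq hLI k (fun i => (w i).1)
        · intro i j hij
          apply hw; apply Subtype.ext
          exact hLI.hB a _ _ (w i).2.1.1 (w j).2.1.1 hij
        · intro i
          by_contra hlt
          push Not at hlt
          refine hcon i ⟨?_, hY i, hlt⟩
          have := hY (i-1)
          rwa [sub_add_cancel] at this)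
    have ecard : (Fintype.card {b // Reg E a b ∧ E a' b} : ℝ) = ∑ b, ind (Reg E a b ∧ E a' b) := by
      rw [sum_ind_card]
    rw [ecard] at this
    rw [sum_sub2 (fun b => Reg E a b ∧ E a' b) (fun x y => ind (M ≤ cA (flp E) x y)),
      sum_sub3 (fun b => Reg E a b ∧ E a' b) (fun x y z => ind (T x y z))] at this
    have hx := hreg a a'
    have hx0 : 0 ≤ ∑ b, ind (Reg E a b ∧ E a' b) := sum_nonneg fun _ _ => ind_nonneg _
    calc _ = ∑ w, ind (Reg E a w ∧ E a' w) * ∑ w_1, ind (Reg E a w_1 ∧ E a' w_1) * ind (M ≤ cA (flp E) w w_1) := by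
          refine sum_congr rfl fun b _ => ?_
          rw [mul_sum]; refine sum_congr rfl fun b' _ => ?_
          rw [ind_and, ind_and]; ring
      _ ≤ _ := this
      _ ≤ _ := by gcongr
  have sB : C ^ 2 * ∑ a, ∑ a', B a a' ≤ ((k:ℝ)+1) * 10^6 * Gam E := by
    have hgam : 0 < Gam E / sz E := by positivity
    set ga := Gam E / sz E with hga
    let q : α → β → ℝ := fun a b2 => ∑ b1, ind (Reg E a b1) * ind (M ≤ cA (flp E) b2 b1)
    have hq0 : ∀ a b, 0 ≤ q a b := fun a b => sum_nonneg fun _ _ => mul_nonneg (ind_nonneg _) (ind_nonneg _)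
    have hq : ∀ a b2, M * q a b2 ≤ gg E a b2 := by
      intro a b2
      rw [← gg_flp, gg_eq, mul_sum]
      refine sum_le_sum fun b1 _ => ?_
      have h1 : ind (Reg E a b1) ≤ ind (flp E b1 a) := ind_mono Reg.sub
      have h2 : M * ind (M ≤ cA (flp E) b2 b1) ≤ cA (flp E) b2 b1 := by
        by_cases hh : M ≤ cA (flp E) b2 b1
        · rw [ind_pos hh, mul_one]; exact hh
        · rw [ind_neg hh, mul_zero]; exact cA_nonneg _ _ _
      calc _ = ind (Reg E a b1) * (M * ind (M ≤ cA (flp E) b2 b1)) := by ring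
        _ ≤ ind (flp E b1 a) * cA (flp E) b2 b1 := mul_le_mul h1 h2 (mul_nonneg hM0 (ind_nonneg _)) (ind_nonneg _)
    have hBa : ∀ a, ∑ a', B a a' ≤ ((k:ℝ)+1) * ∑ b2, ind (Reg E a b2) * q a b2 ^ 2 := by
      intro a
      have e1 : ∑ a', B a a' = ∑ b1, ∑ b2, ∑ b3, ind (Reg E a b1) * ind (Reg E a b2) * ind (Reg E a b3) * (ind (T b1 b2 b3) * tri E b1 b2 b3) := by
        simp only [hBdef, mul_sum, tri]
        rw [sum_comm]; refine sum_congr rfl fun b1 _ => ?_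
        rw [sum_comm]; refine sum_congr rfl fun b2 _ => ?_
        rw [sum_comm]; refine sum_congr rfl fun b3 _ => ?_
        refine sum_congr rfl fun a' _ => ?_
        simp only [ind_and]; ring
      have e2 : ((k:ℝ)+1) * ∑ b2, ind (Reg E a b2) * q a b2 ^ 2 = ∑ b1, ∑ b2, ∑ b3, ind (Reg E a b1) * ind (Reg E a b2) * ind (Reg E a b3) * (ind (M ≤ cA (flp E) b2 b1) * ind (M ≤ cA (flp E) b2 b3) * (k+1)) := by
        simp only [q, pow_two, sum_mul_sum]
        simp only [mul_sum]
        rw [sum_comm]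
        refine sum_congr rfl fun b1 _ => sum_congr rfl fun b2 _ => sum_congr rfl fun b3 _ => ?_
        ring
      rw [e1, e2]
      refine sum_le_sum fun b1 _ => sum_le_sum fun b2 _ => sum_le_sum fun b3 _ => ?_
      refine mul_le_mul_of_nonneg_left ?_ (mul_nonneg (mul_nonneg (ind_nonneg _) (ind_nonneg _)) (ind_nonneg _))
      by_cases hT : T b1 b2 b3
      · rw [ind_pos hT, ind_pos (show M ≤ cA (flp E) b2 b1 by rw [cA_comm]; exact hT.1), ind_pos hT.2.1]
        have := hT.2.2
        linarith
      · rw [ind_neg hT, zero_mul]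
        exact mul_nonneg (mul_nonneg (ind_nonneg _) (ind_nonneg _)) (by positivity)
    have hsum : M ^ 2 * ∑ a, ∑ b2, ind (Reg E a b2) * q a b2 ^ 2 ≤ 10 ^ 6 * ga * Gam E := by
      rw [← sum_gg_E E, mul_sum, mul_sum]
      refine sum_le_sum fun a _ => ?_
      rw [mul_sum, mul_sum]
      refine sum_le_sum fun b _ => ?_
      by_cases hr : Reg E a b
      · rw [ind_pos hr, ind_pos hr.1, one_mul, one_mul]
        calc M ^ 2 * q a b ^ 2 = (M * q a b) * (M * q a b) := by ring
          _ ≤ gg E a b * gg E a b := mul_le_mul (hq a b) (hq a b) (mul_nonneg hM0 (hq0 a b)) (gg_nonneg _ _ _)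
          _ ≤ _ := mul_le_mul_of_nonneg_right hr.2 (gg_nonneg _ _ _)
      · rw [ind_neg hr]
        have := mul_nonneg (ind_nonneg (E a b)) (gg_nonneg E a b)
        simp only [zero_mul, mul_zero]; positivity
    have h2 : ∑ a, ∑ a', B a a' ≤ ((k:ℝ)+1) * ∑ a, ∑ b2, ind (Reg E a b2) * q a b2 ^ 2 := by
      rw [mul_sum]; exact sum_le_sum fun a _ => hBa a
    rw [hM] at hsum
    have h3 : C ^ 2 * ∑ a, ∑ b2, ind (Reg E a b2) * q a b2 ^ 2 ≤ 10 ^ 6 * Gam E := by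
      refine le_of_mul_le_mul_left ?_ hgam
      calc _ = C ^ 2 * ga * ∑ a, ∑ b2, ind (Reg E a b2) * q a b2 ^ 2 := by ring
        _ ≤ _ := hsum
        _ = _ := by ring
    calc _ ≤ C ^ 2 * (((k:ℝ)+1) * ∑ a, ∑ b2, ind (Reg E a b2) * q a b2 ^ 2) := by gcongr
      _ = ((k:ℝ)+1) * (C ^ 2 * ∑ a, ∑ b2, ind (Reg E a b2) * q a b2 ^ 2) := by ring
      _ ≤ ((k:ℝ)+1) * (10 ^ 6 * Gam E) := by gcongr
      _ = _ := by ring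
  have sc : ∑ a, ∑ a', cA E a a' ≤ Gam E / K := by
    refine (sum_cA_le E D h.degB).trans ?_
    rw [le_div_iff₀ hK]; have := h.dens; linarith
  have sB' : ∑ a, ∑ a', B a a' ≤ ((k:ℝ)+1) * 10^6 * Gam E / C ^ 2 := by
    rw [le_div_iff₀ (by positivity)]; linarith
  calc _ ≤ ∑ a, ∑ a', (cA E a a' ^ 2 / 16 + 16 ^ (k+1) * (((k:ℝ)+1) ^ 2 * cA E a a' + ((k:ℝ)+1) * B a a')) :=
        sum_le_sum fun a _ => sum_le_sum fun a' _ => loc a a'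
    _ = Gam E / 16 + 16 ^ (k+1) * (((k:ℝ)+1) ^ 2 * (∑ a, ∑ a', cA E a a') + ((k:ℝ)+1) * ∑ a, ∑ a', B a a') := by
        simp only [sum_add_distrib, ← mul_sum, ← sum_div]; rfl
    _ ≤ Gam E / 16 + 16 ^ (k+1) * (((k:ℝ)+1) ^ 2 * (Gam E / K) + ((k:ℝ)+1) * (((k:ℝ)+1) * 10^6 * Gam E / C ^ 2)) := by gcongr
    _ = Gam E / 16 + (16 ^ (k+1) * (((k:ℝ)+1) ^ 2 / K + ((k:ℝ)+1) ^ 2 * 10 ^ 6 / C ^ 2)) * Gam E := by ring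
    _ ≤ Gam E / 16 + (1/16) * Gam E := by gcongr
    _ = _ := by ring
end direct

open Finset
set_option linter.unusedSectionVars false

section hmat
variable {α β : Type} [Fintype α] [Fintype β] {V V' : Type}

/-- adjacency of flags -/
def FAdj (E : α → β → Prop) (M : ℝ) (a : α) (b : β) (a' : α) (b' : β) : Prop :=
  a ≠ a' ∧ b ≠ b' ∧ E a b' ∧ E a' b ∧ cA E a a' < M ∧ cA (flp E) b b' < M

lemma FAdj_flp (E : α → β → Prop) (M : ℝ) (a : α) (b : β) (a' : α) (b' : β) :
    FAdj (flp E) M b a b' a' ↔ FAdj E M a b a' b' := by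
  unfold FAdj
  constructor
  · rintro ⟨h1, h2, h3, h4, h5, h6⟩; exact ⟨h2, h1, h4, h3, h6, h5⟩
  · rintro ⟨h1, h2, h3, h4, h5, h6⟩; exact ⟨h2, h1, h4, h3, h6, h5⟩

lemma FAdj_symm {E : α → β → Prop} {M : ℝ} {a : α} {b : β} {a' : α} {b' : β} (h : FAdj E M a b a' b') :
    FAdj E M a' b' a b := by
  obtain ⟨h1, h2, h3, h4, h5, h6⟩ := h
  exact ⟨h1.symm, h2.symm, h4, h3, by rwa [cA_comm], by rwa [cA_comm]⟩

/-- matrix -/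
noncomputable def HM {X : Type} (E : α → β → Prop) (M : ℝ) (pa : X → α) (pb : X → β) : Matrix X X ℝ :=
  fun x z => ind (FAdj E M (pa x) (pb x) (pa z) (pb z))

lemma HM_flp {X : Type} (E : α → β → Prop) (M : ℝ) (pa : X → α) (pb : X → β) :
    HM (flp E) M pb pa = HM E M pa pb := by
  ext x z; unfold HM; rw [FAdj_flp]

lemma HM_herm {X : Type} (E : α → β → Prop) (M : ℝ) (pa : X → α) (pb : X → β) : (HM E M pa pb).IsHermitian := by
  ext x z
  change ind _ = ind _
  exact le_antisymm (ind_mono FAdj_symm) (ind_mono FAdj_symm)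

lemma HM_symm {X : Type} (E : α → β → Prop) (M : ℝ) (pa : X → α) (pb : X → β) (x z : X) :
    HM E M pa pb x z = HM E M pa pb z x :=
  le_antisymm (ind_mono FAdj_symm) (ind_mono FAdj_symm)

structure FlagSys {X : Type} (E : α → β → Prop) (pa : X → α) (pb : X → β) : Prop where
  inj : ∀ x y, pa x = pa y → pb x = pb y → x = y
  reg : ∀ x, Reg E (pa x) (pb x)

lemma FlagSys.flip {X : Type} {E : α → β → Prop} {pa : X → α} {pb : X → β} (h : FlagSys E pa pb) :
    FlagSys (flp E) pb pa where
  inj := fun x y h1 h2 => h.inj x y h2 h1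
  reg := fun x => (Reg_flp E _ _).2 (h.reg x)

variable {X : Type} [Fintype X] [DecidableEq X]

lemma flag_sum {E : α → β → Prop} {pa : X → α} {pb : X → β} (h : FlagSys E pa pb) (F : α → β → ℝ)
    (hF : ∀ a b, 0 ≤ F a b) : ∑ x, F (pa x) (pb x) ≤ ∑ a, ∑ b, ind (Reg E a b) * F a b := by
  classical
  have e : ∑ x, F (pa x) (pb x) = ∑ p ∈ univ.image (fun x => (pa x, pb x)), F p.1 p.2 := by
    rw [sum_image]
    intro x _ y _ hxy
    simp only [Prod.mk.injEq] at hxy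
    exact h.inj x y hxy.1 hxy.2
  rw [e, ← Fintype.sum_prod_type' (f := fun a b => ind (Reg E a b) * F a b)]
  calc _ = ∑ p ∈ univ.image (fun x => (pa x, pb x)), ind (Reg E p.1 p.2) * F p.1 p.2 := by
        refine sum_congr rfl fun p hp => ?_
        simp only [mem_image, mem_univ, true_and] at hp
        obtain ⟨x, rfl⟩ := hp
        rw [ind_pos (h.reg x), one_mul]
    _ ≤ _ := sum_le_sum_of_subset_of_nonneg (subset_univ _) fun p _ _ => mul_nonneg (ind_nonneg _) (hF _ _)

lemma HM_nonneg (E : α → β → Prop) (M : ℝ) (pa : X → α) (pb : X → β) (x z : X) : 0 ≤ HM E M pa pb x z := ind_nonneg _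

lemma pow_nonneg_entries (A : Matrix X X ℝ) (hA : ∀ x y, 0 ≤ A x y) (p : ℕ) : ∀ x y, 0 ≤ (A ^ p) x y := by
  induction p with
  | zero => intro x y; rw [pow_zero, Matrix.one_apply]; split_ifs <;> norm_num
  | succ p ih => intro x y; rw [pow_succ, Matrix.mul_apply]; exact sum_nonneg fun z _ => mul_nonneg (ih _ _) (hA _ _)

/-- dyadic class -/
def cls (E : α → β → Prop) (M R : ℝ) (s : ℕ) (b b2 : β) : Prop :=
  R ^ s * cA (flp E) b b2 ≤ M ∧ M < R ^ (s+1) * cA (flp E) b b2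

noncomputable def Bs (E : α → β → Prop) (M R : ℝ) (pa : X → α) (pb : X → β) (s : ℕ) : Matrix X X ℝ :=
  fun x y => ind (pb x = pb y) * ∑ z, HM E M pa pb x z * HM E M pa pb z y * ind (cls E M R s (pb x) (pb z))

lemma Bs_nonneg (E : α → β → Prop) (M R : ℝ) (pa : X → α) (pb : X → β) (s : ℕ) (x y : X) : 0 ≤ Bs E M R pa pb s x y :=
  mul_nonneg (ind_nonneg _) (sum_nonneg fun _ _ => mul_nonneg (mul_nonneg (ind_nonneg _) (ind_nonneg _)) (ind_nonneg _))

lemma Bs_symm (E : α → β → Prop) (M R : ℝ) (pa : X → α) (pb : X → β) (s : ℕ) (x y : X) :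
    Bs E M R pa pb s x y = Bs E M R pa pb s y x := by
  unfold Bs
  by_cases h : pb x = pb y
  · rw [ind_pos h, ind_pos h.symm, h]
    congr 1
    refine sum_congr rfl fun z _ => ?_
    rw [HM_symm _ _ _ _ x z, HM_symm _ _ _ _ z y]; ring
  · rw [ind_neg h, ind_neg (Ne.symm h)]; simp

lemma cA_ge_one {E : α → β → Prop} {a a' : α} {b : β} (h : E a b) (h' : E a' b) : 1 ≤ cA E a a' := by
  have : ind (E a b) * ind (E a' b) ≤ cA E a a' :=
    single_le_sum (f := fun b => ind (E a b) * ind (E a' b)) (fun _ _ => mul_nonneg (ind_nonneg _) (ind_nonneg _)) (mem_univ b)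
  rwa [ind_pos h, ind_pos h', one_mul] at this

lemma bad_le [DecidableEq V'] {E : α → β → Prop} {πA : α → V} {πB : β → V'} (hLI : LI E πA πB) (M R : ℝ)
    {pa : X → α} {pb : X → β} (hF : FlagSys E pa pb) (hR : 1 < R) (S : ℕ) (hS : M < R ^ S) (x y : X) :
    (if (πB ∘ pb) x = (πB ∘ pb) y then 1 else 0) * ((HM E M pa pb) ^ 2) x y ≤ ∑ s ∈ range S, Bs E M R pa pb s x y := by
  unfold Bs
  rw [← mul_sum, sum_comm, pow_two, Matrix.mul_apply, mul_sum, mul_sum]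
  refine sum_le_sum fun z _ => ?_
  have hnn : 0 ≤ ind (pb x = pb y) * ∑ s ∈ range S, HM E M pa pb x z * HM E M pa pb z y * ind (cls E M R s (pb x) (pb z)) :=
    mul_nonneg (ind_nonneg _) (sum_nonneg fun _ _ => mul_nonneg (mul_nonneg (ind_nonneg _) (ind_nonneg _)) (ind_nonneg _))
  by_cases h1 : FAdj E M (pa x) (pb x) (pa z) (pb z)
  swap
  · have : HM E M pa pb x z = 0 := ind_neg h1
    rw [this]; simp
  by_cases h2 : FAdj E M (pa z) (pb z) (pa y) (pb y)
  swap
  · have : HM E M pa pb z y = 0 := ind_neg h2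
    rw [this]; simp
  have e1 : HM E M pa pb x z = 1 := ind_pos h1
  have e2 : HM E M pa pb z y = 1 := ind_pos h2
  rw [e1, e2]
  by_cases h3 : (πB ∘ pb) x = (πB ∘ pb) y
  swap
  · rw [if_neg h3, zero_mul]; rw [e1, e2] at hnn; exact hnn
  have h4 : pb x = pb y := hLI.hB (pa z) _ _ h1.2.2.2.1 h2.2.2.1 h3
  rw [if_pos h3, ind_pos h4]
  simp only [one_mul]
  set c := cA (flp E) (pb x) (pb z) with hc
  have hc1 : 1 ≤ c := cA_ge_one (E := flp E) (b := pa x) (hF.reg x).1 h1.2.2.1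
  have hcM : c < M := h1.2.2.2.2.2
  obtain ⟨s, hs1, hs2⟩ := exists_nat_pow_near (show 1 ≤ M / c by rw [le_div_iff₀ (by linarith)]; linarith) hR
  rw [le_div_iff₀ (by linarith)] at hs1
  rw [div_lt_iff₀ (by linarith)] at hs2
  have hsS : s < S := by
    have : R ^ s < R ^ S := by
      have : 0 < R ^ s := by positivity
      nlinarith
    exact (pow_lt_pow_iff_right₀ hR).1 this
  have : ind (cls E M R s (pb x) (pb z)) ≤ ∑ s ∈ range S, ind (cls E M R s (pb x) (pb z)) :=
    single_le_sum (f := fun s => ind (cls E M R s (pb x) (pb z))) (fun _ _ => ind_nonneg _) (mem_range.2 hsS)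
  rw [ind_pos ⟨hs1, hs2⟩] at this
  exact this

lemma HM_row {E : α → β → Prop} {M : ℝ} {pa : X → α} {pb : X → β} (hF : FlagSys E pa pb) (x : X) :
    ∑ z, HM E M pa pb x z ≤ 10^6 * (Gam E / sz E) := by
  refine le_trans ?_ (hF.reg x).2
  calc _ ≤ ∑ z, ind (E (pa z) (pb x)) * ind (E (pa x) (pb z)) := by
        refine sum_le_sum fun z _ => ?_
        rw [← ind_and]
        exact ind_mono fun h => ⟨h.2.2.2.1, h.2.2.1⟩
    _ ≤ ∑ a, ∑ b, ind (Reg E a b) * (ind (E a (pb x)) * ind (E (pa x) b)) :=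
        flag_sum hF (fun a b => ind (E a (pb x)) * ind (E (pa x) b)) fun a b => mul_nonneg (ind_nonneg _) (ind_nonneg _)
    _ ≤ _ := by
      unfold gg
      refine sum_le_sum fun a _ => sum_le_sum fun b _ => ?_
      rw [mul_comm]
      exact mul_le_mul_of_nonneg_left (ind_mono Reg.sub) (mul_nonneg (ind_nonneg _) (ind_nonneg _))

lemma cls_mul {E : α → β → Prop} {M R : ℝ} (hM : 0 ≤ M) (hR : 1 < R) (s : ℕ) (b b2 : β) :
    ind (cls E M R s b b2) * cA (flp E) b b2 ≤ M / R ^ s * ind (cls E M R s b b2) := by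
  by_cases h : cls E M R s b b2
  · rw [ind_pos h, one_mul, mul_one, le_div_iff₀ (by positivity)]
    linarith [h.1]
  · rw [ind_neg h]; simp

lemma Bs_row {E : α → β → Prop} {M R : ℝ} (hM : 0 ≤ M) (hR : 1 < R) {pa : X → α} {pb : X → β} (hF : FlagSys E pa pb) (s : ℕ) (x : X) :
    ∑ y, Bs E M R pa pb s x y ≤ 10^6 * (Gam E / sz E) * (M / R ^ s) := by
  unfold Bs
  simp_rw [mul_sum]
  rw [sum_comm]
  calc _ ≤ ∑ z, HM E M pa pb x z * (M / R ^ s) := by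
        refine sum_le_sum fun z _ => ?_
        have h1 : ∑ y, ind (pb x = pb y) * HM E M pa pb z y ≤ cA (flp E) (pb x) (pb z) := by
          calc _ ≤ ∑ y, ind (pb x = pb y) * ind (E (pa y) (pb z)) :=
                sum_le_sum fun y _ => mul_le_mul_of_nonneg_left (ind_mono fun h => h.2.2.2.1) (ind_nonneg _)
            _ ≤ ∑ a, ∑ b, ind (Reg E a b) * (ind (pb x = b) * ind (E a (pb z))) :=
                flag_sum hF (fun a b => ind (pb x = b) * ind (E a (pb z))) fun a b => mul_nonneg (ind_nonneg _) (ind_nonneg _)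
            _ ≤ _ := by
              unfold cA flp
              refine sum_le_sum fun a _ => ?_
              rw [sum_eq_single (pb x)]
              · rw [ind_pos rfl, one_mul]
                exact mul_le_mul_of_nonneg_right (ind_mono Reg.sub) (ind_nonneg _)
              · intro b _ hb; rw [ind_neg (Ne.symm hb)]; simp
              · simp
        have h2 := cls_mul (E := E) hM hR s (pb x) (pb z)
        have h3 := ind_le_one (cls E M R s (pb x) (pb z))
        have h4 : 0 ≤ M / R ^ s := by positivity
        calc _ = HM E M pa pb x z * (ind (cls E M R s (pb x) (pb z)) * ∑ y, ind (pb x = pb y) * HM E M pa pb z y) := by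
              rw [mul_sum, mul_sum]; refine sum_congr rfl fun y _ => ?_; ring
          _ ≤ HM E M pa pb x z * (ind (cls E M R s (pb x) (pb z)) * cA (flp E) (pb x) (pb z)) :=
              mul_le_mul_of_nonneg_left (mul_le_mul_of_nonneg_left h1 (ind_nonneg _)) (HM_nonneg _ _ _ _ _ _)
          _ ≤ _ := mul_le_mul_of_nonneg_left (h2.trans (mul_le_of_le_one_right h4 h3)) (HM_nonneg _ _ _ _ _ _)
    _ = (∑ z, HM E M pa pb x z) * (M / R ^ s) := by rw [sum_mul]
    _ ≤ _ := by
      have := HM_row (M := M) hF x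
      gcongr

/-- local incidence -/
def II (E : α → β → Prop) (M R : ℝ) (s : ℕ) (b : β) : α → β → Prop :=
  fun a b2 => E a b2 ∧ Reg E a b ∧ cls E M R s b b2

lemma Bs_le {E : α → β → Prop} {M R : ℝ} (hM : 0 ≤ M) (hR : 1 < R) {pa : X → α} {pb : X → β} (hF : FlagSys E pa pb) (s : ℕ) (x y : X) :
    Bs E M R pa pb s x y ≤ ind (pb x = pb y) * (M / R ^ s * cA (II E M R s (pb x)) (pa x) (pa y)) := by
  unfold Bs
  by_cases hxy : pb x = pb y
  swap
  · rw [ind_neg hxy]; simp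
  refine mul_le_mul_of_nonneg_left ?_ (ind_nonneg _)
  calc _ ≤ ∑ z, (ind (E (pa x) (pb z)) * ind (E (pa y) (pb z)) * ind (cls E M R s (pb x) (pb z))) * ind (E (pa z) (pb x)) := by
        refine sum_le_sum fun z _ => ?_
        have a1 : HM E M pa pb x z ≤ ind (E (pa x) (pb z)) * ind (E (pa z) (pb x)) := by
          rw [← ind_and]; exact ind_mono fun h => ⟨h.2.2.1, h.2.2.2.1⟩
        have a2 : HM E M pa pb z y ≤ ind (E (pa y) (pb z)) := ind_mono fun h => h.2.2.2.1
        calc _ ≤ ind (E (pa x) (pb z)) * ind (E (pa z) (pb x)) * ind (E (pa y) (pb z)) * ind (cls E M R s (pb x) (pb z)) := by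
              refine mul_le_mul_of_nonneg_right ?_ (ind_nonneg _)
              exact mul_le_mul a1 a2 (ind_nonneg _) (mul_nonneg (ind_nonneg _) (ind_nonneg _))
          _ = _ := by ring
    _ ≤ ∑ a, ∑ b, ind (Reg E a b) * ((ind (E (pa x) b) * ind (E (pa y) b) * ind (cls E M R s (pb x) b)) * ind (E a (pb x))) :=
        flag_sum hF (fun a b => (ind (E (pa x) b) * ind (E (pa y) b) * ind (cls E M R s (pb x) b)) * ind (E a (pb x)))
          fun a b => mul_nonneg (mul_nonneg (mul_nonneg (ind_nonneg _) (ind_nonneg _)) (ind_nonneg _)) (ind_nonneg _)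
    _ ≤ ∑ a, ∑ b, ind (E a b) * ((ind (E (pa x) b) * ind (E (pa y) b) * ind (cls E M R s (pb x) b)) * ind (E a (pb x))) := by
        refine sum_le_sum fun a _ => sum_le_sum fun b _ => ?_
        exact mul_le_mul_of_nonneg_right (ind_mono Reg.sub) (mul_nonneg (mul_nonneg (mul_nonneg (ind_nonneg _) (ind_nonneg _)) (ind_nonneg _)) (ind_nonneg _))
    _ = ∑ b, (ind (E (pa x) b) * ind (E (pa y) b)) * (ind (cls E M R s (pb x) b) * cA (flp E) (pb x) b) := by
        rw [sum_comm]; refine sum_congr rfl fun b _ => ?_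
        unfold cA flp
        simp_rw [mul_sum]; refine sum_congr rfl fun a _ => ?_
        ring
    _ ≤ ∑ b, (ind (E (pa x) b) * ind (E (pa y) b)) * (M / R ^ s * ind (cls E M R s (pb x) b)) :=
        sum_le_sum fun b _ => mul_le_mul_of_nonneg_left (cls_mul hM hR s _ _) (mul_nonneg (ind_nonneg _) (ind_nonneg _))
    _ = _ := by
        unfold cA II
        rw [mul_sum]; refine sum_congr rfl fun b _ => ?_
        have r1 := ind_pos (hF.reg x)
        have r2 := ind_pos (hF.reg y)
        rw [← hxy] at r2
        simp only [ind_and, r1, r2]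
        have := ind_sq (cls E M R s (pb x) b)
        rw [show ∀ p q c : ℝ, p * (1 * c) * (q * (1 * c)) = p * q * (c * c) by intros; ring, this]
        ring

lemma Bs_frob {E : α → β → Prop} {M R : ℝ} (hM : 0 ≤ M) (hR : 1 < R) {pa : X → α} {pb : X → β} (hF : FlagSys E pa pb) (s : ℕ) :
    ∑ x, ∑ y, Bs E M R pa pb s x y ^ 2 ≤ (M / R ^ s) ^ 2 * ∑ b, Gam (II E M R s b) := by
  set m := M / R ^ s with hm
  have hreg1 : ∀ (F : α → β → ℝ), (∀ a b, 0 ≤ F a b) → ∑ x, F (pa x) (pb x) ≤ ∑ a, ∑ b, F a b := by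
    intro F hF0
    refine (flag_sum hF F hF0).trans (sum_le_sum fun a _ => sum_le_sum fun b _ => ?_)
    exact mul_le_of_le_one_left (hF0 a b) (ind_le_one _)
  calc _ ≤ ∑ x, ∑ y, ind (pb x = pb y) * (m * cA (II E M R s (pb x)) (pa x) (pa y)) ^ 2 := by
        refine sum_le_sum fun x _ => sum_le_sum fun y _ => ?_
        calc _ ≤ (ind (pb x = pb y) * (m * cA (II E M R s (pb x)) (pa x) (pa y))) ^ 2 :=
              pow_le_pow_left₀ (Bs_nonneg _ _ _ _ _ _ _ _) (Bs_le hM hR hF s x y) 2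
          _ = _ := by rw [mul_pow, pow_two (ind _), ind_sq]
    _ ≤ ∑ x, ∑ a', (m * cA (II E M R s (pb x)) (pa x) a') ^ 2 := by
        refine sum_le_sum fun x _ => ?_
        refine (hreg1 (fun a' b' => ind (pb x = b') * (m * cA (II E M R s (pb x)) (pa x) a') ^ 2)
          fun a b => mul_nonneg (ind_nonneg _) (sq_nonneg _)).trans (le_of_eq ?_)
        refine sum_congr rfl fun a' _ => ?_
        rw [sum_eq_single (pb x)]
        · rw [ind_pos rfl, one_mul]
        · intro b _ hb; rw [ind_neg (Ne.symm hb)]; simp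
        · simp
    _ ≤ ∑ a, ∑ b, ∑ a', (m * cA (II E M R s b) a a') ^ 2 :=
        hreg1 (fun a b => ∑ a', (m * cA (II E M R s b) a a') ^ 2) fun a b => sum_nonneg fun _ _ => sq_nonneg _
    _ = _ := by
        rw [sum_comm, mul_sum]; refine sum_congr rfl fun b _ => ?_
        unfold Gam
        simp_rw [mul_pow, mul_sum]

lemma II_bound {K D : ℝ} {E : α → β → Prop} (h : ExtK K D E) {M R : ℝ} (hM : 0 < M) (hR : 1 < R) (s : ℕ) (Rs t : ℝ)
    (hRs1 : R ^ (s+1) * (10^6 * (Gam E / sz E)) ≤ Rs * M) (hRs2 : M / R ^ s ≤ Rs)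
    (ht1 : K * Rs ≤ t) (ht2 : Gam E ^ 3 * (D * Rs) ≤ t ^ 3 * sz E ^ 4) (ht0 : 0 ≤ t) :
    ∑ b, Gam (II E M R s b) ≤ t * (sz E * Rs) := by
  have hRs0 : 0 ≤ Rs := le_trans (by positivity) hRs2
  have dega : ∀ b a, dA (II E M R s b) a ≤ Rs * ind (Reg E a b) := by
    intro b a
    by_cases hr : Reg E a b
    swap
    · rw [ind_neg hr, mul_zero]
      unfold dA II
      refine le_of_eq (sum_eq_zero fun b2 _ => ind_neg fun hh => hr hh.2.1)
    rw [ind_pos hr, mul_one]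
    have h1 : M * dA (II E M R s b) a ≤ R ^ (s+1) * gg E a b := by
      rw [← gg_flp, gg_eq]
      unfold dA
      rw [mul_sum, mul_sum]
      refine sum_le_sum fun b2 _ => ?_
      by_cases hh : II E M R s b a b2
      · rw [ind_pos hh, ind_pos (show flp E b2 a from hh.1)]
        have := hh.2.2.2
        linarith
      · rw [ind_neg hh, mul_zero]
        exact mul_nonneg (by positivity) (mul_nonneg (ind_nonneg _) (cA_nonneg _ _ _))
    have h2 : R ^ (s+1) * gg E a b ≤ R ^ (s+1) * (10^6 * (Gam E / sz E)) := by
      have := hr.2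
      gcongr
    have h3 : M * dA (II E M R s b) a ≤ M * Rs := by linarith
    exact le_of_mul_le_mul_left h3 hM
  have dega' : ∀ b a, dA (II E M R s b) a ≤ Rs := fun b a =>
    (dega b a).trans (mul_le_of_le_one_right hRs0 (ind_le_one _))
  have degb : ∀ b b2, dA (flp (II E M R s b)) b2 ≤ Rs := by
    intro b b2
    by_cases hc : cls E M R s b b2
    swap
    · refine le_trans (le_of_eq (sum_eq_zero fun a _ => ind_neg fun hh => hc hh.2.2)) hRs0
    refine le_trans ?_ hRs2
    have h1 : dA (flp (II E M R s b)) b2 ≤ cA (flp E) b b2 := by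
      unfold dA cA
      refine sum_le_sum fun a _ => ?_
      rw [← ind_and]
      exact ind_mono fun hh => ⟨hh.2.1.1, hh.1⟩
    refine h1.trans ?_
    rw [le_div_iff₀ (by positivity)]
    linarith [hc.1]
  have szle : ∀ b, sz (II E M R s b) ≤ Rs * dA (flp E) b := by
    intro b
    rw [sz_eq]; unfold dA flp
    rw [mul_sum]
    refine sum_le_sum fun a _ => (dega b a).trans ?_
    exact mul_le_mul_of_nonneg_left (ind_mono Reg.sub) hRs0
  have gle : ∀ b, Gam (II E M R s b) ≤ t * sz (II E M R s b) := by
    intro b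
    have hs0 := sz_nonneg (II E M R s b)
    have hs := h.pos
    have hG := Gam_nonneg E
    rcases h.mx (II E M R s b) Rs (fun a b hh => hh.1) (dega' b) (degb b) with h1 | h1
    · refine h1.le.trans ?_
      gcongr
    · have h2 : sz (II E M R s b) ≤ D * Rs := by
        refine (szle b).trans ?_
        rw [mul_comm]
        exact mul_le_mul_of_nonneg_right (h.degB b) hRs0
      have h3 : Gam (II E M R s b) ^ 3 * sz E ^ 4 ≤ (t * sz (II E M R s b)) ^ 3 * sz E ^ 4 := by
        calc _ ≤ _ := h1
          _ = Gam E ^ 3 * sz (II E M R s b) * sz (II E M R s b) ^ 3 := by ring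
          _ ≤ Gam E ^ 3 * (D * Rs) * sz (II E M R s b) ^ 3 := by gcongr
          _ ≤ t ^ 3 * sz E ^ 4 * sz (II E M R s b) ^ 3 := by gcongr
          _ = _ := by ring
      have h4 := le_of_mul_le_mul_right h3 (by positivity)
      exact le_of_pow_le_pow_left₀ (by norm_num) (by positivity) h4
  calc _ ≤ ∑ b, t * (Rs * dA (flp E) b) := sum_le_sum fun b _ => (gle b).trans (by have := szle b; gcongr)
    _ = t * (sz E * Rs) := by
      rw [← mul_sum, ← mul_sum, ← sz_eq, sz_flp]; ring
end hmat

open Finset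
set_option linter.unusedSectionVars false

lemma num_term (j s : ℕ) (e0 eta L C ga N M R ka : ℝ) (he0 : 0 < e0) (heta : 0 < eta) (hL : 0 < L) (hC : 0 < C)
    (hga : 1 ≤ ga) (hN : 0 < N) (hM : 0 < M) (hM2 : M ^ 2 = C ^ 2 * ga) (hR : R = 2 ^ (j+4))
    (hka : ka = (eta / 2) * (e0 / 2) ^ (j+3) / (L ^ (j+2) * C ^ (j+2) * R)) :
    ((e0 / 2 ^ (s+1))⁻¹) ^ (j+3) * (L * ga * (M / R ^ s)) ^ (j+2) *
      ((M / R ^ s) ^ 2 * ((ka * ga ^ 5 * (R ^ s) ^ 2 / (M ^ 3 * N)) * (N * (M * R ^ (s+1))))) ≤ (eta / 2 ^ (s+1)) * ga ^ (2 * (j+4)) := by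
  have hRpos : 0 < R := by rw [hR]; positivity
  have hR1 : 1 ≤ R := by rw [hR]; exact one_le_pow₀ (by norm_num)
  set r := R ^ s with hr
  have hr1 : 1 ≤ r := one_le_pow₀ hR1
  have hr0 : 0 < r := by positivity
  set P : ℝ := 2 ^ s with hP
  have hP0 : 0 < P := by positivity
  have hrP : r = P ^ (j+4) := by rw [hr, hR, hP, ← pow_mul, ← pow_mul, mul_comm]
  have e1 : (M / r) ^ 2 * ((ka * ga ^ 5 * r ^ 2 / (M ^ 3 * N)) * (N * (M * R ^ (s+1)))) = ka * ga ^ 5 * R * r := by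
    rw [pow_succ R s, ← hr]; field_simp
  rw [e1]
  have hMC : M ≤ C * ga := by
    apply le_of_pow_le_pow_left₀ (n := 2) (by norm_num) (by positivity)
    rw [hM2, mul_pow]
    have : ga ≤ ga ^ 2 := by nlinarith
    gcongr
  have hMp : M ^ (j+2) ≤ C ^ (j+2) * ga ^ (j+1) := by
    calc M ^ (j+2) = M ^ j * M ^ 2 := by ring
      _ ≤ (C * ga) ^ j * (C ^ 2 * ga) := by rw [hM2]; gcongr
      _ = _ := by ring
  have h2 : (L * ga * (M / r)) ^ (j+2) ≤ L ^ (j+2) * ga ^ (j+2) * (C ^ (j+2) * ga ^ (j+1)) / r ^ 2 := by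
    have : (L * ga * (M / r)) ^ (j+2) = L ^ (j+2) * ga ^ (j+2) * M ^ (j+2) / r ^ (j+2) := by
      rw [mul_pow, mul_pow, div_pow]; ring
    rw [this]
    have : r ^ 2 ≤ r ^ (j+2) := pow_le_pow_right₀ hr1 (by omega)
    gcongr
  have hkapos : 0 < ka := by rw [hka]; positivity
  have e2 : (e0 / 2 ^ (s+1))⁻¹ = 2 * P / e0 := by rw [pow_succ, ← hP]; field_simp
  rw [e2]
  calc _ ≤ (2 * P / e0) ^ (j+3) * (L ^ (j+2) * ga ^ (j+2) * (C ^ (j+2) * ga ^ (j+1)) / r ^ 2) * (ka * ga ^ 5 * R * r) := by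
        gcongr
    _ = (eta / 2 ^ (s+1)) * ga ^ (2 * (j+4)) := by
      rw [hka, pow_succ (2:ℝ) s, ← hP, hrP]
      rw [div_pow, div_pow, mul_pow]
      have g1 : ga ^ (2 * (j+4)) = ga ^ (j+2) * ga ^ (j+1) * ga ^ 5 := by ring
      have p1 : P ^ (j+4) = P ^ (j+3) * P := by ring
      rw [g1, p1]
      field_simp

section phi2
variable {α β : Type} [Fintype α] [Fintype β] {V V' : Type}
variable {X : Type} [Fintype X] [DecidableEq X]

lemma geom_half (S : ℕ) : ∑ s ∈ range S, (1:ℝ) / 2 ^ (s+1) ≤ 1 := by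
  have : ∑ s ∈ range S, (1:ℝ) / 2 ^ (s+1) = 1 - 1 / 2 ^ S := by
    induction S with
    | zero => simp
    | succ n ih => rw [sum_range_succ, ih]; field_simp; ring
  rw [this]
  have : (0:ℝ) ≤ 1 / 2 ^ S := by positivity
  linarith

lemma phi2 [DecidableEq V'] {K D : ℝ} {E : α → β → Prop} (h : ExtK K D E) {πA : α → V} {πB : β → V'} (hLI : LI E πA πB)
    {pa : X → α} {pb : X → β} (hF : FlagSys E pa pb) (j : ℕ) (e0 eta C ga M R ka F0 : ℝ)
    (hK : 1 ≤ K) (hgadef : ga = Gam E / sz E) (he0 : 0 < e0) (heta : 0 < eta) (hC : 10 ^ 3 ≤ C)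
    (hga : 1 ≤ ga) (hM : 0 < M) (hM2 : M ^ 2 = C ^ 2 * ga) (hR : R = 2 ^ (j+4))
    (hka : ka = (eta / 2) * (e0 / 2) ^ (j+3) / ((10^6) ^ (j+2) * C ^ (j+2) * R))
    (hF0 : 0 ≤ F0) (hF1 : F0 * sz E ≤ ga ^ 3) (hF2 : K * C ^ 4 * R ≤ ka * F0) (hF3 : C ^ 10 * R ≤ ka ^ 3 * F0 ^ 2) :
    phi (πB ∘ pb) (HM E M pa pb) 2 (2 * (j+3)) ≤ e0 * ((HM E M pa pb) ^ (2 * (j+4))).trace + eta * ga ^ (2 * (j+4)) := by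
  set A := HM E M pa pb with hA
  have hN := h.pos
  have hN1 := sz_ge_one E h.pos
  set N := sz E with hNdef
  have hCpos : 0 < C := by linarith
  have hRpos : 0 < R := by rw [hR]; positivity
  have hR1 : 1 < R := by rw [hR]; exact one_lt_pow₀ (by norm_num) (by omega)
  have hkapos : 0 < ka := by rw [hka]; positivity
  have hG : Gam E = ga * N := by rw [hgadef]; field_simp
  have hDga : K * D ≤ ga := by
    have := h.dens
    rw [hG] at this
    exact le_of_mul_le_mul_right this hN
  have hD : D ≤ ga := by
    by_cases hD0 : 0 ≤ D
    · nlinarith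
    · linarith
  obtain ⟨S, hS⟩ := pow_unbounded_of_one_lt M hR1
  have hAn := pow_nonneg_entries A (HM_nonneg E M pa pb) (2 * (j+3))
  have step1 : phi (πB ∘ pb) A 2 (2 * (j+3)) ≤ ∑ s ∈ range S, ∑ x, ∑ y, Bs E M R pa pb s x y * (A ^ (2 * (j+3))) y x := by
    calc phi (πB ∘ pb) A 2 (2 * (j+3)) ≤ ∑ x, ∑ y, (∑ s ∈ range S, Bs E M R pa pb s x y) * (A ^ (2 * (j+3))) y x := by
          unfold phi
          refine sum_le_sum fun x _ => sum_le_sum fun y _ => ?_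
          rw [← mul_assoc]
          exact mul_le_mul_of_nonneg_right (bad_le hLI M R hF hR1 S hS x y) (hAn y x)
      _ = ∑ x, ∑ s ∈ range S, ∑ y, Bs E M R pa pb s x y * (A ^ (2 * (j+3))) y x := by
          refine sum_congr rfl fun x _ => ?_
          simp_rw [sum_mul]
          exact sum_comm
      _ = _ := sum_comm
  have tr0 : 0 ≤ (A ^ (2 * (j+4))).trace := sum_nonneg fun x _ => pow_nonneg_entries A (HM_nonneg E M pa pb) _ x x
  have step2 : ∀ s, ∑ x, ∑ y, Bs E M R pa pb s x y * (A ^ (2 * (j+3))) y x ≤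
      (e0 * (A ^ (2 * (j+4))).trace + eta * ga ^ (2 * (j+4))) * (1 / 2 ^ (s+1)) := by
    intro s
    have b1 := spec_bound A (Bs E M R pa pb s) (HM_herm _ _ _ _) (Bs_nonneg _ _ _ _ _ _) (Bs_symm _ _ _ _ _ _)
      (10^6 * (Gam E / sz E) * (M / R ^ s)) (Bs_row hM.le hR1 hF s) (by rw [← hgadef]; positivity) (e0 / 2 ^ (s+1)) (by positivity) (j+2)
    set r := R ^ s with hr
    have hr1 : 1 ≤ r := one_le_pow₀ hR1.le
    have hr0 : 0 < r := by linarith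
    have b2 := Bs_frob hM.le hR1 hF s
    have hMM : R ^ (s+1) = R * r := by rw [pow_succ, hr]; ring
    have b3 := II_bound h hM hR1 s (M * R ^ (s+1)) (ka * ga ^ 5 * (R ^ s) ^ 2 / (M ^ 3 * N))
      (by
        rw [← hNdef, ← hgadef]
        have : (10:ℝ)^6 ≤ C ^ 2 := by nlinarith
        calc _ ≤ R ^ (s+1) * (C ^ 2 * ga) := by gcongr
          _ = M ^ 2 * R ^ (s+1) := by rw [hM2]; ring
          _ = _ := by ring)
      (by
        rw [div_le_iff₀ (by positivity), hMM, ← hr]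
        have : 1 ≤ R * r * r := one_le_mul_of_one_le_of_one_le (one_le_mul_of_one_le_of_one_le hR1.le hr1) hr1
        nlinarith)
      (by
        rw [← hr, hMM, le_div_iff₀ (by positivity)]
        calc K * (M * (R * r)) * (M ^ 3 * N) = K * R * r * N * (M ^ 2) ^ 2 := by ring
          _ = (K * C ^ 4 * R) * (N * r * ga ^ 2) := by rw [hM2]; ring
          _ ≤ (ka * F0) * (N * r * ga ^ 2) := by gcongr
          _ = (ka * r * ga ^ 2) * (F0 * N) := by ring
          _ ≤ (ka * r * ga ^ 2) * ga ^ 3 := by gcongr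
          _ = ka * ga ^ 5 * r * 1 := by ring
          _ ≤ ka * ga ^ 5 * r * r := by gcongr
          _ = _ := by ring)
      (by
        rw [← hr, ← hNdef, hG, hMM, div_pow, div_mul_eq_mul_div, le_div_iff₀ (by positivity)]
        calc (ga * N) ^ 3 * (D * (M * (R * r))) * (M ^ 3 * N) ^ 3
            ≤ (ga * N) ^ 3 * (ga * (M * (R * r))) * (M ^ 3 * N) ^ 3 := by gcongr
          _ = ga ^ 4 * N ^ 6 * R * r * (M ^ 2) ^ 5 := by ring
          _ = (C ^ 10 * R) * (ga ^ 9 * N ^ 6 * r) := by rw [hM2]; ring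
          _ ≤ (ka ^ 3 * F0 ^ 2) * (ga ^ 9 * N ^ 6 * r) := by gcongr
          _ = ka ^ 3 * ga ^ 9 * N ^ 4 * r * (F0 * N) ^ 2 := by ring
          _ ≤ ka ^ 3 * ga ^ 9 * N ^ 4 * r * (ga ^ 3) ^ 2 := by gcongr
          _ = ka ^ 3 * ga ^ 15 * N ^ 4 * r ^ 1 := by ring
          _ ≤ ka ^ 3 * ga ^ 15 * N ^ 4 * r ^ 6 := by gcongr; norm_num
          _ = _ := by ring)
      (by positivity)
    have b4 := num_term j s e0 eta (10^6) C ga N M R ka he0 heta (by positivity) hCpos hga hN hM hM2 hR hka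
    rw [← hgadef] at b1
    rw [← hr] at b2 b3 b4
    have b5 : ∑ x, ∑ y, Bs E M R pa pb s x y ^ 2 ≤ (M / r) ^ 2 * ((ka * ga ^ 5 * r ^ 2 / (M ^ 3 * N)) * (N * (M * R ^ (s+1)))) :=
      b2.trans (by gcongr)
    calc _ ≤ _ := b1
      _ ≤ e0 / 2 ^ (s+1) * (A ^ (2 * (j+4))).trace + ((e0 / 2 ^ (s+1))⁻¹) ^ (j+3) * (10^6 * ga * (M / r)) ^ (j+2) *
         ((M / r) ^ 2 * ((ka * ga ^ 5 * r ^ 2 / (M ^ 3 * N)) * (N * (M * R ^ (s+1))))) := by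
          gcongr
      _ ≤ e0 / 2 ^ (s+1) * (A ^ (2 * (j+4))).trace + (eta / 2 ^ (s+1)) * ga ^ (2 * (j+4)) := by gcongr
      _ = _ := by ring
  calc _ ≤ _ := step1
    _ ≤ ∑ s ∈ range S, (e0 * (A ^ (2 * (j+4))).trace + eta * ga ^ (2 * (j+4))) * (1 / 2 ^ (s+1)) := sum_le_sum fun s _ => step2 s
    _ = (e0 * (A ^ (2 * (j+4))).trace + eta * ga ^ (2 * (j+4))) * ∑ s ∈ range S, 1 / 2 ^ (s+1) := by rw [mul_sum]
    _ ≤ (e0 * (A ^ (2 * (j+4))).trace + eta * ga ^ (2 * (j+4))) * 1 := by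
      have := geom_half S
      gcongr
    _ = _ := by ring
end phi2

open Finset
set_option linter.unusedSectionVars false

section hsum
variable {α β : Type} [Fintype α] [Fintype β] {V V' : Type}

lemma heavy4 {K D : ℝ} {E : α → β → Prop} (h : ExtK K D E) :
    ∑ a, ∑ a', ∑ b, ∑ b', ind (Hv E a b) * ind (E a' b) * (ind (E a b') * ind (E a' b')) ≤ Gam E / 100 := by
  refine le_trans (le_of_eq ?_) (heavy h)
  rw [sum_gg]
  refine sum_congr rfl fun a _ => sum_congr rfl fun a' _ => ?_
  rw [cA, sum_mul_sum]

lemma deg4 {K D : ℝ} {E : α → β → Prop} (h : ExtK K D E) (hK : 0 < K) :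
    ∑ a, ∑ a', ∑ b, ∑ b', ind (a = a') * (ind (E a b) * ind (E a' b) * (ind (E a b') * ind (E a' b'))) ≤ Gam E / K := by
  classical
  have e : ∑ a, ∑ a', ∑ b, ∑ b', ind (a = a') * (ind (E a b) * ind (E a' b) * (ind (E a b') * ind (E a' b')))
      = ∑ a, dA E a ^ 2 := by
    refine sum_congr rfl fun a _ => ?_
    have : ∀ a', ∑ b, ∑ b', ind (a = a') * (ind (E a b) * ind (E a' b) * (ind (E a b') * ind (E a' b'))) =
        if a = a' then cA E a a' ^ 2 else 0 := by
      intro a'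
      simp_rw [← mul_sum]
      rw [← sum_mul, pow_two, cA]
      split_ifs with h0
      · rw [ind_pos h0, one_mul]
      · rw [ind_neg h0, zero_mul]
    simp_rw [this]
    rw [sum_ite_eq]; simp [cA_self]
  rw [e, le_div_iff₀ hK]
  calc (∑ a, dA E a ^ 2) * K ≤ (∑ a, D * dA E a) * K := by
        gcongr with a
        rw [pow_two]
        exact mul_le_mul_of_nonneg_right (h.degA a) (dA_nonneg _ _)
    _ = K * D * sz E := by rw [← mul_sum, sz_eq]; ring
    _ ≤ _ := h.dens

lemma swapA (f : α → α → β → β → ℝ) : ∑ a, ∑ a', ∑ b, ∑ b', f a a' b b' = ∑ a, ∑ a', ∑ b, ∑ b', f a' a b b' := sum_comm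

lemma swapB (f : α → α → β → β → ℝ) : ∑ a, ∑ a', ∑ b, ∑ b', f a a' b b' = ∑ a, ∑ a', ∑ b, ∑ b', f a a' b' b :=
  sum_congr rfl fun _ _ => sum_congr rfl fun _ _ => sum_comm

lemma pt (E : α → β → Prop) (M : ℝ) (a a' : α) (b b' : β) :
    ind (E a b) * ind (E a' b) * (ind (E a b') * ind (E a' b')) ≤
      ind (Reg E a b) * ind (Reg E a' b') * ind (FAdj E M a b a' b')
      + ind (Hv E a b) * ind (E a' b) * (ind (E a b') * ind (E a' b'))
      + ind (Hv E a' b) * ind (E a b) * (ind (E a' b') * ind (E a b'))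
      + ind (Hv E a b') * ind (E a' b') * (ind (E a b) * ind (E a' b))
      + ind (Hv E a' b') * ind (E a b') * (ind (E a' b) * ind (E a b))
      + ind (a = a') * (ind (E a b) * ind (E a' b) * (ind (E a b') * ind (E a' b')))
      + ind (b = b') * (ind (E a b) * ind (E a b') * (ind (E a' b) * ind (E a' b')))
      + ind (M ≤ cA (flp E) b b') * (ind (Reg E a b) * ind (E a' b)) * (ind (Reg E a b') * ind (E a' b'))
      + ind (M ≤ cA E a a') * (ind (Reg E a b) * ind (E a b')) * (ind (Reg E a' b) * ind (E a' b')) := by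
  have n1 : 0 ≤ ind (Reg E a b) * ind (Reg E a' b') * ind (FAdj E M a b a' b') :=
    mul_nonneg (mul_nonneg (ind_nonneg _) (ind_nonneg _)) (ind_nonneg _)
  have q : ∀ x y z w : Prop, 0 ≤ ind x * ind y * (ind z * ind w) := fun x y z w =>
    mul_nonneg (mul_nonneg (ind_nonneg _) (ind_nonneg _)) (mul_nonneg (ind_nonneg _) (ind_nonneg _))
  have q' : ∀ x y z w u : Prop, 0 ≤ ind u * (ind x * ind y) * (ind z * ind w) := fun x y z w u =>
    mul_nonneg (mul_nonneg (ind_nonneg _) (mul_nonneg (ind_nonneg _) (ind_nonneg _))) (mul_nonneg (ind_nonneg _) (ind_nonneg _))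
  have n2 := q (Hv E a b) (E a' b) (E a b') (E a' b')
  have n3 := q (Hv E a' b) (E a b) (E a' b') (E a b')
  have n4 := q (Hv E a b') (E a' b') (E a b) (E a' b)
  have n5 := q (Hv E a' b') (E a b') (E a' b) (E a b)
  have n6 := mul_nonneg (ind_nonneg (a = a')) (q (E a b) (E a' b) (E a b') (E a' b'))
  have n7 := mul_nonneg (ind_nonneg (b = b')) (q (E a b) (E a b') (E a' b) (E a' b'))
  have n8 := q' (Reg E a b) (E a' b) (Reg E a b') (E a' b') (M ≤ cA (flp E) b b')
  have n9 := q' (Reg E a b) (E a b') (Reg E a' b) (E a' b') (M ≤ cA E a a')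
  by_cases hE : E a b ∧ E a' b ∧ E a b' ∧ E a' b'
  swap
  · have : ind (E a b) * ind (E a' b) * (ind (E a b') * ind (E a' b')) = 0 := by
      rw [← ind_and, ← ind_and, ← ind_and]; exact ind_neg (by tauto)
    rw [this]; linarith
  obtain ⟨h1, h2, h3, h4⟩ := hE
  have r : ∀ {x y}, E x y → ¬ Hv E x y → Reg E x y := by
    intro x y hxy hn
    refine ⟨hxy, ?_⟩
    by_contra hc
    exact hn ⟨hxy, not_le.1 hc⟩
  simp only [ind_pos h1, ind_pos h2, ind_pos h3, ind_pos h4, mul_one, one_mul] at *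
  by_cases c1 : Hv E a b
  · rw [ind_pos c1]; linarith
  by_cases c2 : Hv E a' b
  · rw [ind_pos c2]; linarith
  by_cases c3 : Hv E a b'
  · rw [ind_pos c3]; linarith
  by_cases c4 : Hv E a' b'
  · rw [ind_pos c4]; linarith
  by_cases c5 : a = a'
  · rw [ind_pos c5]; linarith
  by_cases c6 : b = b'
  · rw [ind_pos c6]; linarith
  simp only [ind_pos (r h1 c1), ind_pos (r h2 c2), ind_pos (r h3 c3), ind_pos (r h4 c4), mul_one, one_mul] at *
  by_cases c7 : M ≤ cA (flp E) b b'
  · rw [ind_pos c7]; linarith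
  by_cases c8 : M ≤ cA E a a'
  · rw [ind_pos c8]; linarith
  have : FAdj E M a b a' b' := ⟨c5, c6, h3, h2, not_le.1 c8, not_le.1 c7⟩
  rw [ind_pos this]; linarith

lemma hsum {K D : ℝ} {E : α → β → Prop} (h : ExtK K D E) {πA : α → V} {πB : β → V'} (hLI : LI E πA πB)
    (k : ℕ) (hk : 3 ≤ k) (hev : Even (k+1)) (hno : ¬ PSeq E πA πB k) (C M : ℝ) (hM0 : 0 ≤ M) (hK : 100 ≤ K) (hC : 0 < C)
    (hM : M ^ 2 = C ^ 2 * (Gam E / sz E)) (hG : 0 < Gam E)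
    (hKC : 16 ^ (k+1) * (((k:ℝ)+1) ^ 2 / K + ((k:ℝ)+1) ^ 2 * 10 ^ 6 / C ^ 2) ≤ 1 / 16) :
    Gam E / 2 ≤ ∑ a, ∑ a', ∑ b, ∑ b', ind (Reg E a b) * ind (Reg E a' b') * ind (FAdj E M a b a' b') := by
  have hK0 : 0 < K := by linarith
  have t1 := heavy4 h
  have t2 := t1
  rw [swapA] at t2
  have t3 := t1
  rw [swapB] at t3
  have t4 := t2
  rw [swapB] at t4
  have t5 := deg4 h hK0
  have t6 := deg4 h.flip hK0
  rw [← sum4, Gam_flp] at t6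
  have t7 := direct h hLI k hk hev hno C M hM0 hK0 hC hM hG hKC
  have t8 := direct h.flip hLI.flip k hk hev (fun hc => hno (PSeq_flp _ _ _ _ hc)) C M hM0 hK0 hC
    (by rw [sz_flp, Gam_flp]; exact hM) (by rw [Gam_flp]; exact hG) hKC
  rw [← sum4, Gam_flp] at t8
  have hGK : Gam E / K ≤ Gam E / 100 := by gcongr
  have key : Gam E ≤ _ := le_trans (le_of_eq (Gam_eq4 E)) (sum_le_sum fun a _ => sum_le_sum fun a' _ => sum_le_sum fun b _ =>
    sum_le_sum fun b' _ => pt E M a a' b b')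
  simp only [sum_add_distrib] at key
  have t8' : ∑ a, ∑ a', ∑ b, ∑ b', ind (M ≤ cA E a a') * (ind (Reg E a b) * ind (E a b')) * (ind (Reg E a' b) * ind (E a' b')) ≤ Gam E / 8 := by
    simp only [Reg_flp] at t8; exact t8
  have t6' : ∑ a, ∑ a', ∑ b, ∑ b', ind (b = b') * (ind (E a b) * ind (E a b') * (ind (E a' b) * ind (E a' b'))) ≤ Gam E / K := t6
  linarith
end hsum

section core
variable {α β : Type} [Fintype α] [Fintype β] {V V' : Type}
variable {X : Type} [Fintype X] [DecidableEq X]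

lemma phi_nonneg [DecidableEq V'] (f : X → V') (A : Matrix X X ℝ) (hA : ∀ x y, 0 ≤ A x y) (p q : ℕ) : 0 ≤ phi f A p q := by
  unfold phi
  refine sum_nonneg fun x _ => sum_nonneg fun y _ => mul_nonneg (by split_ifs <;> norm_num)
    (mul_nonneg (pow_nonneg_entries A hA p x y) (pow_nonneg_entries A hA q y x))

lemma phi_conf [DecidableEq V'] [Fintype V'] {E : α → β → Prop} {πA : α → V} {πB : β → V'} (hLI : LI E πA πB)
    {pa : X → α} {pb : X → β} (hF : FlagSys E pa pb) (j : ℕ) (M : ℝ) (p q : ℕ) (hp : 1 ≤ p) (hq : 1 ≤ q) (hpq : p + q = 2 * (j+4)) :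
    phi (πB ∘ pb) (HM E M pa pb) p q ≤ phi (πB ∘ pb) (HM E M pa pb) 2 (2 * (j+3)) := by
  set A := HM E M pa pb with hA
  have hz : ∀ x y, (πB ∘ pb) x = (πB ∘ pb) y → A x y = 0 := by
    intro x y hxy
    apply ind_neg
    rintro ⟨h1, h2, h3, h4, -, -⟩
    exact h2 (hLI.hB _ _ _ (hF.reg x).1 h3 hxy)
  have hnn := phi_nonneg (πB ∘ pb) A (HM_nonneg E M pa pb) 2 (2 * (j+3))
  by_cases hp1 : p = 1
  · refine le_trans (le_of_eq ?_) hnn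
    unfold phi
    refine sum_eq_zero fun x _ => sum_eq_zero fun y _ => ?_
    split_ifs with hxy
    · rw [hp1, pow_one, hz x y hxy]; simp
    · simp
  by_cases hq1 : q = 1
  · refine le_trans (le_of_eq ?_) hnn
    unfold phi
    refine sum_eq_zero fun x _ => sum_eq_zero fun y _ => ?_
    split_ifs with hxy
    · rw [hq1, pow_one, hz y x hxy.symm]; simp
    · simp
  obtain ⟨p', rfl⟩ : ∃ p', p = p' + 2 := ⟨p - 2, by omega⟩
  obtain ⟨q', rfl⟩ : ∃ q', q = q' + 2 := ⟨q - 2, by omega⟩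
  have := phi_le (πB ∘ pb) A (HM_herm E M pa pb) p' q' ⟨j + 2, by omega⟩
  rwa [show p' + q' + 2 = 2 * (j+3) by omega] at this

lemma tr_le [DecidableEq V] [DecidableEq V'] {E : α → β → Prop} {πA : α → V} {πB : β → V'}
    {pa : X → α} {pb : X → β} (hF : FlagSys E pa pb) (k : ℕ) (M : ℝ) (hno : ¬ PSeq E πA πB k) (T : ℝ)
    (hT0 : 0 ≤ T)
    (hT : ∀ p q, 1 ≤ p → 1 ≤ q → p + q = k + 1 → phi (πA ∘ pa) (HM E M pa pb) p q + phi (πB ∘ pb) (HM E M pa pb) p q ≤ T) :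
    ((HM E M pa pb) ^ (k+1)).trace ≤ ((k:ℝ)+1)^2 * T := by
  set A := HM E M pa pb with hA
  set cf : X → X → ℝ := fun x y => (if (πA ∘ pa) x = (πA ∘ pa) y then 1 else 0) + (if (πB ∘ pb) x = (πB ∘ pb) y then 1 else 0) with hcf
  have hcf0 : ∀ x y, 0 ≤ cf x y := fun x y => add_nonneg (by split_ifs <;> norm_num) (by split_ifs <;> norm_num)
  have hcw0 : ∀ w, 0 ≤ cw A k w := fun w => prod_nonneg fun i _ => HM_nonneg E M pa pb _ _
  have key : ∀ w, cw A k w ≤ ∑ i : Fin (k+1), ∑ j : Fin (k+1), if i = j then 0 else cw A k w * cf (w i) (w j) := by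
    intro w
    have nn : ∀ i j : Fin (k+1), 0 ≤ if i = j then 0 else cw A k w * cf (w i) (w j) := fun i j => by
      split_ifs
      · exact le_rfl
      · exact mul_nonneg (hcw0 w) (hcf0 _ _)
    by_cases h0 : cw A k w = 0
    · rw [h0]; simp
    have hadj : ∀ i, FAdj E M (pa (w i)) (pb (w i)) (pa (w (i+1))) (pb (w (i+1))) := by
      intro i
      by_contra hc
      exact h0 (prod_eq_zero (mem_univ i) (ind_neg hc))
    have : ∃ i j, i ≠ j ∧ 1 ≤ cf (w i) (w j) := by
      by_contra hc
      push Not at hc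
      apply hno
      refine ⟨pa ∘ w, pb ∘ w, fun i => ⟨(hF.reg (w i)).1, (hadj i).2.2.1, (hadj i).2.2.2.1⟩, ?_, ?_⟩
      · intro i j hij
        by_contra hne
        have := hc i j hne
        simp only [hcf] at this
        rw [if_pos (c := (πA ∘ pa) (w i) = (πA ∘ pa) (w j)) hij] at this
        have h2 : (0:ℝ) ≤ if (πB ∘ pb) (w i) = (πB ∘ pb) (w j) then 1 else 0 := by split_ifs <;> norm_num
        linarith
      · intro i j hij
        by_contra hne
        have := hc i j hne
        simp only [hcf] at this
        rw [if_pos (c := (πB ∘ pb) (w i) = (πB ∘ pb) (w j)) hij] at this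
        have h2 : (0:ℝ) ≤ if (πA ∘ pa) (w i) = (πA ∘ pa) (w j) then 1 else 0 := by split_ifs <;> norm_num
        linarith
    obtain ⟨i, j, hij, h1⟩ := this
    calc cw A k w ≤ cw A k w * cf (w i) (w j) := le_mul_of_one_le_right (hcw0 w) h1
      _ = if i = j then 0 else cw A k w * cf (w i) (w j) := by rw [if_neg hij]
      _ ≤ ∑ j : Fin (k+1), if i = j then 0 else cw A k w * cf (w i) (w j) :=
          single_le_sum (f := fun j => if i = j then 0 else cw A k w * cf (w i) (w j)) (fun j _ => nn i j) (mem_univ j)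
      _ ≤ _ := single_le_sum (f := fun i => ∑ j : Fin (k+1), if i = j then 0 else cw A k w * cf (w i) (w j))
          (fun i _ => sum_nonneg fun j _ => nn i j) (mem_univ i)
  rw [← cw_trace]
  calc _ ≤ ∑ w, ∑ i : Fin (k+1), ∑ j : Fin (k+1), (if i = j then 0 else cw A k w * cf (w i) (w j)) := sum_le_sum fun w _ => key w
    _ = ∑ i : Fin (k+1), ∑ j : Fin (k+1), ∑ w, (if i = j then 0 else cw A k w * cf (w i) (w j)) := by
      rw [sum_comm]; exact sum_congr rfl fun i _ => sum_comm
    _ ≤ ∑ i : Fin (k+1), ∑ j : Fin (k+1), T := by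
      refine sum_le_sum fun i _ => sum_le_sum fun j _ => ?_
      by_cases hij : i = j
      · simp [hij, hT0]
      · simp only [hij, if_false]
        rw [cw_rot A k cf i j hij]
        have hlt := (j - i).isLt
        have hpos : ((j - i : Fin (k+1)) : ℕ) ≠ 0 := by
          intro h; exact hij (sub_eq_zero.1 (Fin.ext h)).symm
        refine le_trans (le_of_eq ?_) (hT ((j - i : Fin (k+1)) : ℕ) (k + 1 - ((j - i : Fin (k+1)) : ℕ)) (by omega) (by omega) (by omega))
        unfold phi
        rw [← sum_add_distrib]
        refine sum_congr rfl fun x _ => ?_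
        rw [← sum_add_distrib]
        refine sum_congr rfl fun y _ => ?_
        simp only [hcf]; ring
    _ = _ := by simp; ring

lemma core1 [DecidableEq V] [DecidableEq V'] [Fintype V] [Fintype V'] {K D : ℝ} {E : α → β → Prop} (h : ExtK K D E) {πA : α → V} {πB : β → V'} (hLI : LI E πA πB)
    (j : ℕ) (e0 eta C ga R ka F0 q : ℝ) (hq : q = (2 * (j:ℝ) + 8)^2)
    (hK : 100 ≤ K) (hgadef : ga = Gam E / sz E) (he0 : e0 = 1 / (8 * q)) (heta : eta = 1 / (16 * q * 4 ^ (j+4))) (hC : 10 ^ 3 ≤ C)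
    (hga : 1 ≤ ga) (hR : R = 2 ^ (j+4))
    (hka : ka = (eta / 2) * (e0 / 2) ^ (j+3) / ((10^6) ^ (j+2) * C ^ (j+2) * R))
    (hF0 : 0 ≤ F0) (hF1 : F0 * sz E ≤ ga ^ 3) (hF2 : K * C ^ 4 * R ≤ ka * F0) (hF3 : C ^ 10 * R ≤ ka ^ 3 * F0 ^ 2)
    (hKC : 16 ^ (2*j+7+1) * ((((2*j+7 : ℕ):ℝ)+1) ^ 2 / K + (((2*j+7 : ℕ):ℝ)+1) ^ 2 * 10 ^ 6 / C ^ 2) ≤ 1 / 16) :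
    PSeq E πA πB (2*j+7) := by
  classical
  by_contra hno
  have hN := h.pos
  have hC0 : 0 < C := by linarith
  have hG : 0 < Gam E := by
    have : 0 < ga := by linarith
    rw [hgadef] at this
    exact (div_pos_iff_of_pos_right hN).1 this
  set M := C * Real.sqrt ga with hMdef
  have hM0 : 0 < M := by positivity
  have hM2 : M ^ 2 = C ^ 2 * ga := by rw [hMdef, mul_pow, Real.sq_sqrt (by linarith)]
  have hs := hsum h hLI (2*j+7) (by omega) ⟨j+4, by omega⟩ hno C M hM0.le hK hC0 (by rw [← hgadef]; exact hM2) hG hKC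
  let Y := {p : α × β // Reg E p.1 p.2}
  let pa : Y → α := fun p => p.1.1
  let pb : Y → β := fun p => p.1.2
  have hF : FlagSys E pa pb := ⟨fun x y h1 h2 => Subtype.ext (Prod.ext h1 h2), fun x => x.2⟩
  set A := HM E M pa pb with hA
  have hsumA : Gam E / 2 ≤ ∑ x, ∑ y, A x y := by
    refine hs.trans (le_of_eq ?_)
    have := sum_sub2 (fun p : α × β => Reg E p.1 p.2) (fun p p' => ind (FAdj E M p.1 p.2 p'.1 p'.2))
    refine Eq.trans ?_ this.symm
    rw [Fintype.sum_prod_type]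
    refine sum_congr rfl fun a _ => ?_
    rw [sum_comm]
    refine sum_congr rfl fun b _ => ?_
    rw [Fintype.sum_prod_type, mul_sum]
    refine sum_congr rfl fun a' _ => ?_
    rw [mul_sum]
    refine sum_congr rfl fun b' _ => ?_
    ring
  have hcard : (Fintype.card Y : ℝ) ≤ sz E := by
    have := sum_ind_card (fun p : α × β => Reg E p.1 p.2)
    rw [← this, Fintype.sum_prod_type]
    exact sum_le_sum fun a _ => sum_le_sum fun b _ => ind_mono fun h => h.1
  have hcard0 : Fintype.card Y ≠ 0 := by
    intro hc
    have : IsEmpty Y := Fintype.card_eq_zero_iff.1 hc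
    simp at hsumA
    linarith
  have hcpos : (0:ℝ) < Fintype.card Y := by exact_mod_cast Nat.pos_of_ne_zero hcard0
  have htr : (ga / 2) ^ (2 * (j+4)) ≤ (A ^ (2 * (j+4))).trace := by
    have h1 := (trace_lower A (HM_herm _ _ _ _) (2 * (j+4)) ⟨j+4, by omega⟩).resolve_right hcard0
    refine le_trans (pow_le_pow_left₀ (by linarith) ?_ _) h1
    rw [le_div_iff₀ hcpos]
    calc ga / 2 * Fintype.card Y ≤ ga / 2 * sz E := by gcongr
      _ = Gam E / 2 := by rw [hgadef]; field_simp
      _ ≤ _ := hsumA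
  have hq0 : 0 < q := by rw [hq]; positivity
  have he00 : 0 < e0 := by rw [he0]; positivity
  have heta0 : 0 < eta := by rw [heta]; positivity
  have p1 := phi2 h hLI hF j e0 eta C ga M R ka F0 (by linarith) hgadef he00 heta0 hC hga hM0 hM2 hR hka hF0 hF1 hF2 hF3
  have p2 := phi2 h.flip hLI.flip hF.flip j e0 eta C ga M R ka F0 (by linarith) (by rw [Gam_flp, sz_flp]; exact hgadef) he00 heta0 hC hga hM0 hM2 hR hka hF0
    (by rw [sz_flp]; exact hF1) hF2 hF3
  rw [HM_flp, ← hA] at p2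
  rw [← hA] at p1
  set tr := (A ^ (2 * (j+4))).trace with htrdef
  have htr0 : 0 < tr := lt_of_lt_of_le (by positivity) htr
  have := tr_le (πA := πA) (πB := πB) hF (2*j+7) M hno (2 * (e0 * tr + eta * ga ^ (2 * (j+4)))) (by positivity) (by
    intro p q' hp hq' hpq
    have c1 := phi_conf hLI hF j M p q' hp hq' (by omega)
    have c2 := phi_conf hLI.flip hF.flip j M p q' hp hq' (by omega)
    rw [HM_flp] at c2
    linarith)
  rw [show 2*j+7+1 = 2*(j+4) by omega, ← hA, ← htrdef] at this
  have e1 : (((2*j+7 : ℕ):ℝ)+1)^2 = q := by rw [hq]; push_cast; ring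
  rw [e1] at this
  have e2 : q * (2 * (e0 * tr + eta * ga ^ (2 * (j+4)))) = tr / 4 + (ga / 2) ^ (2 * (j+4)) / 8 := by
    rw [he0, heta, div_pow, pow_mul (2:ℝ) 2]
    norm_num
    field_simp
    ring
  rw [e2] at this
  linarith

lemma PSeq.mono {E E' : α → β → Prop} {πA : α → V} {πB : β → V'} {k : ℕ} (hE : ∀ a b, E' a b → E a b) (h : PSeq E' πA πB k) :
    PSeq E πA πB k := by
  obtain ⟨a, b, h1, h2, h3⟩ := h
  exact ⟨a, b, fun i => ⟨hE _ _ (h1 i).1, hE _ _ (h1 i).2.1, hE _ _ (h1 i).2.2⟩, h2, h3⟩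

lemma LI.mono {E E' : α → β → Prop} {πA : α → V} {πB : β → V'} (hE : ∀ a b, E' a b → E a b) (h : LI E πA πB) :
    LI E' πA πB :=
  ⟨fun a b b' h1 h2 => h.hB a b b' (hE _ _ h1) (hE _ _ h2), fun a a' b h1 h2 => h.hA a a' b (hE _ _ h1) (hE _ _ h2)⟩

lemma Gam_of_sz_zero {E : α → β → Prop} (h : sz E = 0) : Gam E = 0 := by
  have h1 : ∀ a, dA E a = 0 := by
    rw [sz_eq] at h
    intro a
    exact (sum_eq_zero_iff_of_nonneg (fun a _ => dA_nonneg E a)).1 h a (mem_univ a)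
  unfold Gam
  refine sum_eq_zero fun a _ => sum_eq_zero fun a' _ => ?_
  have := cA_le E a a'
  rw [h1] at this
  rw [le_antisymm this (cA_nonneg _ _ _)]; norm_num

lemma exists_ext {K D : ℝ} {E : α → β → Prop} (hpos : 0 < sz E) (hA : ∀ a, dA E a ≤ D) (hB : ∀ b, dA (flp E) b ≤ D)
    (hd : K * D * sz E ≤ Gam E) : ∃ (E' : α → β → Prop) (D' : ℝ), (∀ a b, E' a b → E a b) ∧ ExtK K D' E' ∧
      Gam E ^ 3 / sz E ^ 4 ≤ Gam E' ^ 3 / sz E' ^ 4 := by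
  classical
  let S : Set (α → β → Prop) := {E' | (∀ a b, E' a b → E a b) ∧ 0 < sz E' ∧ ∃ D', (∀ a, dA E' a ≤ D') ∧ (∀ b, dA (flp E') b ≤ D') ∧
    K * D' * sz E' ≤ Gam E'}
  have hS : S.Finite := Set.toFinite S
  have hES : E ∈ S := ⟨fun _ _ h => h, hpos, D, hA, hB, hd⟩
  obtain ⟨E', hE', hmax⟩ := Set.exists_max_image S (fun E' => Gam E' ^ 3 / sz E' ^ 4) hS ⟨E, hES⟩
  obtain ⟨h1, h2, D', h3, h4, h5⟩ := hE'
  refine ⟨E', D', h1, ⟨h2, h3, h4, h5, ?_⟩, hmax E hES⟩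
  intro E2 D2 k1 k2 k3
  by_cases k4 : Gam E2 < K * D2 * sz E2
  · exact Or.inl k4
  right
  rcases (sz_nonneg E2).lt_or_eq with k5 | k5
  · have := hmax E2 ⟨fun a b h => h1 a b (k1 a b h), k5, D2, k2, k3, not_lt.1 k4⟩
    rwa [div_le_div_iff₀ (by positivity) (by positivity)] at this
  · rw [Gam_of_sz_zero k5.symm, ← k5]; norm_num

end core

lemma consts (j : ℕ) : ∃ K e0 eta C R ka F0 q : ℝ, q = (2 * (j:ℝ) + 8)^2 ∧ 100 ≤ K ∧
    e0 = 1 / (8 * q) ∧ eta = 1 / (16 * q * 4 ^ (j+4)) ∧ 10 ^ 3 ≤ C ∧ R = 2 ^ (j+4) ∧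
    ka = (eta / 2) * (e0 / 2) ^ (j+3) / ((10^6) ^ (j+2) * C ^ (j+2) * R) ∧ 1 ≤ F0 ∧ K * C ^ 4 * R ≤ ka * F0 ∧ C ^ 10 * R ≤ ka ^ 3 * F0 ^ 2 ∧
    16 ^ (2*j+7+1) * ((((2*j+7 : ℕ):ℝ)+1) ^ 2 / K + (((2*j+7 : ℕ):ℝ)+1) ^ 2 * 10 ^ 6 / C ^ 2) ≤ 1 / 16 := by
  obtain ⟨q, hq⟩ : ∃ q : ℝ, q = (2 * (j:ℝ) + 8)^2 := ⟨_, rfl⟩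
  have hq1 : 1 ≤ q := by rw [hq]; nlinarith [(Nat.cast_nonneg j : (0:ℝ) ≤ j)]
  obtain ⟨P, hP⟩ : ∃ P : ℝ, P = 16 ^ (2*j+7+1) := ⟨_, rfl⟩
  have hP1 : 1 ≤ P := by rw [hP]; exact one_le_pow₀ (by norm_num)
  have hPq : 1 ≤ P * q := one_le_mul_of_one_le_of_one_le hP1 hq1
  obtain ⟨K, hK⟩ : ∃ z : ℝ, z = 100 * (P * q) := ⟨_, rfl⟩
  obtain ⟨C, hC⟩ : ∃ z : ℝ, z = 10^4 * (P * q) := ⟨_, rfl⟩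
  obtain ⟨e0, he0⟩ : ∃ z : ℝ, z = 1 / (8 * q) := ⟨_, rfl⟩
  obtain ⟨eta, heta⟩ : ∃ z : ℝ, z = 1 / (16 * q * 4 ^ (j+4)) := ⟨_, rfl⟩
  obtain ⟨R, hR⟩ : ∃ z : ℝ, z = 2 ^ (j+4) := ⟨_, rfl⟩
  obtain ⟨ka, hka⟩ : ∃ z : ℝ, z = (eta / 2) * (e0 / 2) ^ (j+3) / ((10^6) ^ (j+2) * C ^ (j+2) * R) := ⟨_, rfl⟩
  have hq0 : 0 < q := by linarith
  have hP0 : 0 < P := by linarith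
  have hK0 : 0 < K := by rw [hK]; positivity
  have hC0 : 0 < C := by rw [hC]; positivity
  have hR0 : 0 < R := by rw [hR]; positivity
  have he00 : 0 < e0 := by rw [he0]; positivity
  have heta0 : 0 < eta := by rw [heta]; positivity
  have hka0 : 0 < ka := by rw [hka]; positivity
  simp_rw [← hP]
  refine ⟨K, e0, eta, C, R, ka, 1 + K * C ^ 4 * R / ka + C ^ 10 * R / ka ^ 3, q, hq, by linarith, he0, heta, by linarith, hR, hka, ?_, ?_, ?_, ?_⟩
  · have : 0 ≤ K * C ^ 4 * R / ka + C ^ 10 * R / ka ^ 3 := by positivity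
    linarith
  · have h1 : ka * (K * C ^ 4 * R / ka) = K * C ^ 4 * R := by field_simp
    have h2 : 0 ≤ ka * (1 + C ^ 10 * R / ka ^ 3) := by positivity
    linarith
  · obtain ⟨F, hF⟩ : ∃ z : ℝ, z = 1 + K * C ^ 4 * R / ka + C ^ 10 * R / ka ^ 3 := ⟨_, rfl⟩
    rw [← hF]
    have hF1 : 1 ≤ F := by
      have : 0 ≤ K * C ^ 4 * R / ka + C ^ 10 * R / ka ^ 3 := by positivity
      linarith
    have h1 : ka ^ 3 * (C ^ 10 * R / ka ^ 3) = C ^ 10 * R := by field_simp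
    have h2 : 0 ≤ K * C ^ 4 * R / ka := by positivity
    calc C ^ 10 * R = ka ^ 3 * (C ^ 10 * R / ka ^ 3) := h1.symm
      _ ≤ ka ^ 3 * F := by gcongr; linarith
      _ ≤ ka ^ 3 * F ^ 2 := by gcongr; nlinarith
  · have e1 : (((2*j+7 : ℕ):ℝ)+1)^2 = q := by rw [hq]; push_cast; ring
    rw [e1]
    have h1 : P * (q / K) = 1 / 100 := by rw [hK]; field_simp
    have h2 : P * (q * 10 ^ 6 / C ^ 2) ≤ 1 / 100 := by
      rw [hC]
      have : P * (q * 10 ^ 6 / (10 ^ 4 * (P * q)) ^ 2) = (1 / 100) * (1 / (P * q)) := by field_simp; norm_num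
      rw [this]
      have : 1 / (P * q) ≤ 1 := by rw [div_le_one (by positivity)]; exact hPq
      linarith
    rw [mul_add]; linarith

theorem core_thm (j : ℕ) : ∃ K F0 : ℝ, 1 ≤ K ∧ 1 ≤ F0 ∧ ∀ (α β V V' : Type) [Fintype α] [Fintype β] [Fintype V] [Fintype V']
    (E : α → β → Prop) (πA : α → V) (πB : β → V') (D : ℝ), LI E πA πB → 0 < sz E → (∀ a, dA E a ≤ D) → (∀ b, dA (flp E) b ≤ D) →
    K * D * sz E ≤ Gam E → F0 * sz E ^ 4 ≤ Gam E ^ 3 → PSeq E πA πB (2*j+7) := by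
  classical
  obtain ⟨K, e0, eta, C, R, ka, F0, q, hq, hK, he0, heta, hC, hR, hka, hF0, hF2, hF3, hKC⟩ := consts j
  refine ⟨K, F0, by linarith, hF0, ?_⟩
  intro α β V V' _ _ _ _ E πA πB D hLI hpos hA hB hd hF
  obtain ⟨E', D', hE, hext, hm⟩ := exists_ext hpos hA hB hd
  have hs := hext.pos
  have hs1 := sz_ge_one E' hs
  have h1 : F0 ≤ Gam E' ^ 3 / sz E' ^ 4 := le_trans (by rwa [le_div_iff₀ (by positivity)]) hm
  have h2 : F0 * sz E' ≤ (Gam E' / sz E') ^ 3 := by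
    calc _ ≤ Gam E' ^ 3 / sz E' ^ 4 * sz E' := by gcongr
      _ = _ := by field_simp
  have h3 : 1 ≤ Gam E' / sz E' := by
    have : 1 ≤ (Gam E' / sz E') ^ 3 := le_trans (one_le_mul_of_one_le_of_one_le hF0 hs1) h2
    by_contra hc
    have h0 : 0 ≤ Gam E' / sz E' := div_nonneg (Gam_nonneg _) hs.le
    have := pow_lt_one₀ h0 (not_le.1 hc) (n := 3) (by norm_num)
    linarith
  exact PSeq.mono hE (core1 hext (hLI.mono hE) j e0 eta C _ R ka F0 q hq hK rfl he0 heta hC h3 hR hka (by linarith) h2 hF2 hF3 hKC)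

open Finset
set_option linter.unusedSectionVars false

section splitting
open Classical
variable {n : ℕ}

/-- degree -/
noncomputable def dg (B : Fin n → Fin n → Prop) (x : Fin n) : ℕ := (univ.filter fun z => B x z).card
/-- rank -/
noncomputable def rk (B : Fin n → Fin n → Prop) (x y : Fin n) : ℕ := (univ.filter fun z => z < y ∧ B x z).card

lemma rk_le (B : Fin n → Fin n → Prop) (x y : Fin n) : rk B x y ≤ dg B x :=
  card_le_card (fun z hz => by simp at hz ⊢; exact hz.2)

lemma rk_lt (B : Fin n → Fin n → Prop) (x y y' : Fin n) (h : y < y') (hB : B x y) : rk B x y < rk B x y' := by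
  apply card_lt_card
  rw [Finset.ssubset_iff_of_subset]
  · exact ⟨y, by simp [h, hB], by simp⟩
  · intro z hz
    simp at hz ⊢
    exact ⟨hz.1.trans h, hz.2⟩

lemma rk_inj (B : Fin n → Fin n → Prop) (x y y' : Fin n) (hB : B x y) (hB' : B x y') (h : rk B x y = rk B x y') : y = y' := by
  rcases lt_trichotomy y y' with h1 | h1 | h1
  · have := rk_lt B x y y' h1 hB; omega
  · exact h1
  · have := rk_lt B x y' y h1 hB'; omega

abbrev SpV (B : Fin n → Fin n → Prop) (D : ℕ) : Type := Σ x : Fin n, Fin (dg B x / D + 1)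

def spl (B : Fin n → Fin n → Prop) (D : ℕ) : SpV B D → SpV (flp B) D → Prop :=
  fun a b => B a.1 b.1 ∧ rk B a.1 b.1 / D = (a.2 : ℕ) ∧ rk (flp B) b.1 a.1 / D = (b.2 : ℕ)

lemma spl_flp (B : Fin n → Fin n → Prop) (D : ℕ) : flp (spl B D) = spl (flp B) D := by
  funext b a
  apply propext
  constructor
  · rintro ⟨h1, h2, h3⟩; exact ⟨h1, h3, h2⟩
  · rintro ⟨h1, h2, h3⟩; exact ⟨h1, h3, h2⟩

lemma spl_LI (B : Fin n → Fin n → Prop) (D : ℕ) : LI (spl B D) (fun a => a.1) (fun b => b.1) where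
  hB := by
    rintro ⟨x, i⟩ ⟨y, j⟩ ⟨y', j'⟩ ⟨h1, h2, h3⟩ ⟨h4, h5, h6⟩ h
    dsimp only at *
    subst h
    have : j = j' := Fin.ext (h3.symm.trans h6)
    rw [this]
  hA := by
    rintro ⟨x, i⟩ ⟨x', i'⟩ ⟨y, j⟩ ⟨h1, h2, h3⟩ ⟨h4, h5, h6⟩ h
    dsimp only at *
    subst h
    have : i = i' := Fin.ext (h2.symm.trans h5)
    rw [this]

lemma spl_deg (B : Fin n → Fin n → Prop) (D : ℕ) (hD : 0 < D) (a : SpV B D) : dA (spl B D) a ≤ D := by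
  obtain ⟨x, i⟩ := a
  unfold dA
  rw [Fintype.sum_sigma]
  calc _ ≤ ∑ y, ind (B x y ∧ rk B x y / D = (i:ℕ)) := by
        refine sum_le_sum fun y _ => ?_
        have : ∀ j, ind (spl B D ⟨x, i⟩ ⟨y, j⟩) = ind (B x y ∧ rk B x y / D = (i:ℕ)) * ind (rk (flp B) y x / D = (j:ℕ)) := by
          intro j
          rw [← ind_and]; unfold spl; congr 1; apply propext; tauto
        simp_rw [this]
        rw [← mul_sum]
        refine mul_le_of_le_one_right (ind_nonneg _) ?_
        rw [sum_ind_card]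
        have : Fintype.card {j : Fin (dg (flp B) y / D + 1) // rk (flp B) y x / D = (j:ℕ)} ≤ 1 := by
          rw [Fintype.card_le_one_iff]
          rintro ⟨j, hj⟩ ⟨j', hj'⟩
          exact Subtype.ext (Fin.ext (hj.symm.trans hj'))
        exact_mod_cast this
    _ ≤ D := by
      rw [sum_ind_card, Fintype.card_subtype]
      have : (univ.filter fun y => B x y ∧ rk B x y / D = (i:ℕ)).card ≤ (Finset.Ico ((i:ℕ) * D) ((i:ℕ) * D + D)).card := by
        apply card_le_card_of_injOn (fun y => rk B x y)
        · intro y hy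
          simp at hy ⊢
          obtain ⟨h1, h2⟩ := hy
          rw [← h2]
          have := Nat.div_add_mod (rk B x y) D
          have h3 := Nat.mod_lt (rk B x y) hD
          rw [mul_comm] at this
          omega
        · intro y hy y' hy' h
          simp at hy hy'
          exact rk_inj B x y y' hy.1 hy'.1 h
      rw [Nat.card_Ico] at this
      have h2 : (i:ℕ) * D + D - i * D = D := by omega
      rw [h2] at this
      exact_mod_cast this

lemma spl_sz (B : Fin n → Fin n → Prop) (D : ℕ) : sz B ≤ sz (spl B D) := by
  unfold sz
  rw [Fintype.sum_sigma]
  refine sum_le_sum fun x _ => ?_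
  simp_rw [Fintype.sum_sigma]
  rw [sum_comm]
  refine sum_le_sum fun y _ => ?_
  by_cases hB : B x y
  swap
  · rw [ind_neg hB]; exact sum_nonneg fun _ _ => sum_nonneg fun _ _ => ind_nonneg _
  let i : Fin (dg B x / D + 1) := ⟨rk B x y / D, Nat.lt_succ_of_le (Nat.div_le_div_right (rk_le B x y))⟩
  let j : Fin (dg (flp B) y / D + 1) := ⟨rk (flp B) y x / D, Nat.lt_succ_of_le (Nat.div_le_div_right (rk_le (flp B) y x))⟩
  have h1 : ind (B x y) ≤ ind (spl B D ⟨x, i⟩ ⟨y, j⟩) := ind_mono fun h => ⟨h, rfl, rfl⟩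
  calc _ ≤ _ := h1
    _ ≤ ∑ j, ind (spl B D ⟨x, i⟩ ⟨y, j⟩) := single_le_sum (f := fun j => ind (spl B D ⟨x, i⟩ ⟨y, j⟩)) (fun _ _ => ind_nonneg _) (mem_univ j)
    _ ≤ _ := single_le_sum (f := fun i => ∑ j, ind (spl B D ⟨x, i⟩ ⟨y, j⟩)) (fun _ _ => sum_nonneg fun _ _ => ind_nonneg _) (mem_univ i)

lemma spl_card (B : Fin n → Fin n → Prop) (D : ℕ) (hD : 0 < D) (h : sz B ≤ n * D) : (Fintype.card (SpV B D) : ℝ) ≤ 2 * n := by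
  rw [Fintype.card_sigma]
  simp only [Fintype.card_fin]
  push_cast
  have hD' : (0:ℝ) < D := by exact_mod_cast hD
  calc ∑ x, (((dg B x / D : ℕ) : ℝ) + 1) ≤ ∑ x, (dA B x / D + 1) := by
        refine sum_le_sum fun x _ => ?_
        have : dA B x = (dg B x : ℝ) := by unfold dA ind dg; rw [sum_boole]
        rw [this]
        gcongr
        exact Nat.cast_div_le
    _ = sz B / D + n := by rw [sum_add_distrib, ← sum_div, ← sz_eq]; simp
    _ ≤ _ := by
      have : sz B / D ≤ n := by rw [div_le_iff₀ hD']; exact h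
      linarith

end splitting

lemma gam_lower {α β : Type} [Fintype α] [Fintype β] (E : α → β → Prop) :
    sz E ^ 4 ≤ (Fintype.card α : ℝ) ^ 2 * (Fintype.card β : ℝ) ^ 2 * Gam E := by
  have h1 : sz E ^ 2 ≤ Fintype.card α * ∑ a, dA E a ^ 2 := by
    rw [sz_eq]; have := sq_sum_le_card_mul_sum_sq (s := (univ : Finset α)) (f := fun a => dA E a)
    simpa using this
  have h2 : ∑ a, dA E a ^ 2 = ∑ p : β × β, cA (flp E) p.1 p.2 := by
    rw [Fintype.sum_prod_type]; exact (sum_cA (flp E)).symm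
  have h3 : (∑ a, dA E a ^ 2) ^ 2 ≤ (Fintype.card β : ℝ) ^ 2 * Gam E := by
    rw [h2, ← Gam_flp]
    have := sq_sum_le_card_mul_sum_sq (s := (univ : Finset (β × β))) (f := fun p => cA (flp E) p.1 p.2)
    rw [Fintype.sum_prod_type (f := fun p : β × β => cA (flp E) p.1 p.2 ^ 2)] at this
    simp only [card_univ, Fintype.card_prod] at this
    unfold Gam
    push_cast at this
    rw [pow_two (Fintype.card β : ℝ)]
    exact this
  calc sz E ^ 4 = (sz E ^ 2) ^ 2 := by ring
    _ ≤ (Fintype.card α * ∑ a, dA E a ^ 2) ^ 2 := by gcongr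
    _ = (Fintype.card α : ℝ) ^ 2 * (∑ a, dA E a ^ 2) ^ 2 := by ring
    _ ≤ (Fintype.card α : ℝ) ^ 2 * ((Fintype.card β : ℝ) ^ 2 * Gam E) := by gcongr
    _ = _ := by ring

theorem bip_thm (j : ℕ) : ∃ c : ℝ, 1 ≤ c ∧ ∀ (n : ℕ) (B : Fin n → Fin n → Prop), 0 < n → c * (n:ℝ) ^ 3 ≤ sz B ^ 2 →
    PSeq B id id (2*j+7) := by
  obtain ⟨K, F0, hK, hF0, H⟩ := core_thm j
  refine ⟨32 * K + 8 * F0, by linarith, ?_⟩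
  intro n B hn hc
  have hn1 : (1:ℝ) ≤ n := by exact_mod_cast hn
  have hn0 : (0:ℝ) < n := by linarith
  have hN0 : 0 ≤ sz B := sz_nonneg B
  set N := sz B with hN
  have hNn : (n:ℝ) ≤ N := by
    have h1 : (n:ℝ) ^ 2 ≤ N ^ 2 := by
      calc (n:ℝ) ^ 2 ≤ n ^ 3 := pow_le_pow_right₀ hn1 (by norm_num)
        _ ≤ (32 * K + 8 * F0) * n ^ 3 := le_mul_of_one_le_left (by positivity) (by linarith)
        _ ≤ _ := hc
    exact le_of_pow_le_pow_left₀ (by norm_num) hN0 h1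
  have hNpos : 0 < N := by linarith
  set D := ⌈N / n⌉₊ with hD
  have hD0 : 0 < D := Nat.ceil_pos.2 (by positivity)
  have hD1 : N ≤ n * D := by
    have := Nat.le_ceil (N / n)
    rw [div_le_iff₀ hn0] at this
    linarith
  have hD2 : (D:ℝ) * n ≤ 2 * N := by
    have := Nat.ceil_lt_add_one (a := N / n) (by positivity)
    have h2 : (D:ℝ) * n ≤ (N / n + 1) * n := by gcongr
    have h3 : (N / n + 1) * n = N + n := by field_simp
    linarith
  set E := spl B D with hE
  have hs : N ≤ sz E := spl_sz B D
  have hspos : 0 < sz E := by linarith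
  have hg := gam_lower E
  have hcA : (Fintype.card (SpV B D) : ℝ) ≤ 2 * n := spl_card B D hD0 hD1
  have hcB : (Fintype.card (SpV (flp B) D) : ℝ) ≤ 2 * n := spl_card (flp B) D hD0 (by rw [sz_flp]; exact hD1)
  set s := sz E with hsdef
  set Γ := Gam E with hΓ
  have hΓ0 : 0 ≤ Γ := Gam_nonneg E
  have hg2 : s ^ 4 ≤ 16 * n ^ 4 * Γ := by
    calc s ^ 4 ≤ _ := hg
      _ ≤ (2 * n) ^ 2 * (2 * n) ^ 2 * Γ := by gcongr
      _ = _ := by ring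
  have hs2 : (32 * K + 8 * F0) * n ^ 3 ≤ s ^ 2 := hc.trans (by gcongr)
  have hs2K : 32 * K * n ^ 3 ≤ s ^ 2 := by
    have : 0 ≤ 8 * F0 * (n:ℝ) ^ 3 := by positivity
    linarith
  have hs2F : 8 * F0 * n ^ 3 ≤ s ^ 2 := by
    have : 0 ≤ 32 * K * (n:ℝ) ^ 3 := by positivity
    linarith
  have p := H (SpV B D) (SpV (flp B) D) (Fin n) (Fin n) E (fun a => a.1) (fun b => b.1) D (spl_LI B D) hspos (spl_deg B D hD0)
    (by
      intro b
      rw [hE, spl_flp]; exact spl_deg (flp B) D hD0 b)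
    (by
      have : (K * D * s) * (16 * n ^ 4) ≤ Γ * (16 * n ^ 4) := by
        calc (K * D * s) * (16 * n ^ 4) = 16 * K * n ^ 3 * s * (D * n) := by ring
          _ ≤ 16 * K * n ^ 3 * s * (2 * s) := mul_le_mul_of_nonneg_left (by linarith) (by positivity)
          _ = (32 * K * n ^ 3) * s ^ 2 := by ring
          _ ≤ s ^ 2 * s ^ 2 := by gcongr
          _ = s ^ 4 := by ring
          _ ≤ _ := by rw [mul_comm]; exact hg2
      exact le_of_mul_le_mul_right this (by positivity))
    (by
      have : (F0 * s ^ 4) * (16 * n ^ 4) ^ 3 ≤ Γ ^ 3 * (16 * n ^ 4) ^ 3 := by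
        have h8 : F0 * (16 * (n:ℝ) ^ 4) ^ 3 ≤ s ^ 8 := by
          calc F0 * (16 * (n:ℝ) ^ 4) ^ 3 = F0 * (8 * n ^ 3) ^ 4 := by ring
            _ ≤ F0 ^ 4 * (8 * n ^ 3) ^ 4 := by
              gcongr
              exact le_self_pow₀ hF0 (by norm_num)
            _ = (8 * F0 * n ^ 3) ^ 4 := by ring
            _ ≤ (s ^ 2) ^ 4 := by gcongr
            _ = s ^ 8 := by ring
        calc _ = s ^ 4 * (F0 * (16 * n ^ 4) ^ 3) := by ring
          _ ≤ s ^ 4 * s ^ 8 := by gcongr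
          _ = (s ^ 4) ^ 3 := by ring
          _ ≤ (16 * n ^ 4 * Γ) ^ 3 := by gcongr
          _ = _ := by ring
      exact le_of_mul_le_mul_right this (by positivity))
  obtain ⟨a, b, h1, h2, h3⟩ := p
  exact ⟨fun i => (a i).1, fun i => (b i).1, fun i => ⟨(h1 i).1.1, (h1 i).2.1.1, (h1 i).2.2.1⟩, h2, h3⟩

open Finset

lemma cut_count {n : ℕ} (x y : Fin n) (hxy : x ≠ y) :
    ∑ g : Fin n → Bool, ind (g x = true ∧ g y = false) = 2 ^ n / 4 := by
  classical
  set cc : Bool → Bool → ℝ := fun p q => ∑ g : Fin n → Bool, ind (g x = p ∧ g y = q) with hcc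
  have inv : ∀ z : Fin n, Function.Involutive (fun g : Fin n → Bool => Function.update g z (!g z)) := by
    intro z g
    funext t
    by_cases ht : t = z
    · subst ht; simp
    · simp [ht]
  have h1 : ∀ p q, cc p q = cc (!p) q := by
    intro p q
    simp only [hcc]
    rw [← Equiv.sum_comp (inv x).toPerm]
    refine sum_congr rfl fun g _ => ?_
    congr 1
    simp only [Function.Involutive.coe_toPerm, Function.update_self, Function.update_of_ne hxy.symm]
    cases g x <;> cases p <;> simp
  have h2 : ∀ p q, cc p q = cc p (!q) := by
    intro p q
    simp only [hcc]
    rw [← Equiv.sum_comp (inv y).toPerm]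
    refine sum_congr rfl fun g _ => ?_
    congr 1
    simp only [Function.Involutive.coe_toPerm, Function.update_self, Function.update_of_ne hxy]
    cases g y <;> cases q <;> simp
  have h3 : cc true true + cc true false + cc false true + cc false false = 2 ^ n := by
    simp only [hcc]
    rw [← sum_add_distrib, ← sum_add_distrib, ← sum_add_distrib]
    have : ∀ g : Fin n → Bool, ind (g x = true ∧ g y = true) + ind (g x = true ∧ g y = false) +
        ind (g x = false ∧ g y = true) + ind (g x = false ∧ g y = false) = 1 := by
      intro g
      cases g x <;> cases g y <;> simp [ind]
    rw [sum_congr rfl fun g _ => this g]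
    simp
  have e1 := h1 true true
  have e2 := h2 true true
  have e3 := h1 true false
  simp only [Bool.not_true] at e1 e2 e3
  change cc true false = _
  linarith

lemma exists_cut {n : ℕ} (G : SimpleGraph (Fin n)) :
    ∃ g : Fin n → Bool, (G.edgeSet.ncard : ℝ) / 2 ≤ sz (fun x y => G.Adj x y ∧ g x = true ∧ g y = false) := by
  classical
  by_contra hc
  push Not at hc
  have hm : ∑ x, ∑ y, ind (G.Adj x y) = 2 * (G.edgeSet.ncard : ℝ) := by
    have h1 := G.sum_degrees_eq_twice_card_edges
    have h2 : G.edgeSet.ncard = G.edgeFinset.card := by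
      rw [Set.ncard_eq_toFinset_card']; rfl
    rw [h2]
    have h3 : ∀ x, ∑ y, ind (G.Adj x y) = (G.degree x : ℝ) := by
      intro x
      rw [sum_ind_card, Fintype.card_subtype, ← G.card_neighborFinset_eq_degree]
      congr 2
      ext y; simp
    rw [sum_congr rfl fun x _ => h3 x]
    exact_mod_cast h1
  have hs : ∑ g : Fin n → Bool, sz (fun x y => G.Adj x y ∧ g x = true ∧ g y = false) = (G.edgeSet.ncard : ℝ) / 2 * 2 ^ n := by
    unfold sz
    rw [sum_comm]
    have : ∀ x, ∑ g : Fin n → Bool, ∑ y, ind (G.Adj x y ∧ g x = true ∧ g y = false) = ∑ y, ind (G.Adj x y) * (2 ^ n / 4) := by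
      intro x
      rw [sum_comm]
      refine sum_congr rfl fun y _ => ?_
      simp_rw [ind_and (G.Adj x y)]
      rw [← mul_sum]
      by_cases hxy : G.Adj x y
      · rw [cut_count x y hxy.ne]
      · rw [ind_neg hxy]; simp
    rw [sum_congr rfl fun x _ => this x]
    simp_rw [← sum_mul]
    rw [hm]; ring
  have : ∑ g : Fin n → Bool, sz (fun x y => G.Adj x y ∧ g x = true ∧ g y = false) < ∑ g : Fin n → Bool, (G.edgeSet.ncard : ℝ) / 2 :=
    sum_lt_sum_of_nonempty univ_nonempty fun g _ => hc g
  rw [hs] at this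
  simp at this
  linarith

lemma par_succ (k : ℕ) (hk : Even (k+1)) (i : Fin (k+1)) : ((i + 1 : Fin (k+1)) : ℕ) % 2 = ((i:ℕ) + 1) % 2 := by
  rw [Fin.val_add, Nat.mod_mod_of_dvd _ hk.two_dvd, Nat.add_mod]
  have : ((1 : Fin (k+1)) : ℕ) % 2 = 1 := by
    cases k with
    | zero => simp at hk
    | succ m => simp
  rw [this]; omega

lemma prism_of_PSeq {n : ℕ} (G : SimpleGraph (Fin n)) (g : Fin n → Bool) (k : ℕ) (hk1 : 1 ≤ k) (hk : Even (k+1))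
    (h : PSeq (fun x y => G.Adj x y ∧ g x = true ∧ g y = false) id id k) :
    Contains (cycleGraph (k+1) □ (⊤ : SimpleGraph (Fin 2))) G := by
  obtain ⟨a, b, h1, h2, h3⟩ := h
  have ha : Function.Injective a := h2
  have hb : Function.Injective b := h3
  have hab : ∀ i j, a i ≠ b j := by
    intro i j hij
    have e1 := (h1 i).1.2.1
    have e2 := (h1 j).1.2.2
    rw [hij, e2] at e1
    exact Bool.noConfusion e1
  obtain ⟨m, rfl⟩ : ∃ m, k = m + 1 := ⟨k - 1, by omega⟩
  set f : Fin (m+1+1) × Fin 2 → Fin n := fun p => if ((p.1:ℕ) + (p.2:ℕ)) % 2 = 0 then a p.1 else b p.1 with hf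
  have hstep : ∀ i e, G.Adj (f (i, e)) (f (i+1, e)) := by
    intro i e
    have hp := par_succ (m+1) hk i
    simp only [hf]
    by_cases hc : ((i:ℕ) + (e:ℕ)) % 2 = 0
    · rw [if_pos hc, if_neg (by omega)]
      exact (h1 i).2.1.1
    · rw [if_neg hc, if_pos (by omega)]
      exact (h1 i).2.2.1.symm
  refine ⟨f, ?_, ?_⟩
  · rintro ⟨i, e⟩ ⟨i', e'⟩ hee
    simp only [hf] at hee
    have l1 := e.isLt
    have l2 := e'.isLt
    split_ifs at hee with c1 c2 c2
    · have := ha hee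
      subst this
      have : e = e' := Fin.ext (by omega)
      rw [this]
    · exact absurd hee (hab _ _)
    · exact absurd hee.symm (hab _ _)
    · have := hb hee
      subst this
      have : e = e' := Fin.ext (by omega)
      rw [this]
  · rintro ⟨i, e⟩ ⟨i', e'⟩ hadj
    rw [boxProd_adj] at hadj
    rcases hadj with ⟨h, h'⟩ | ⟨h, h'⟩
    · dsimp only at h h'
      subst h'
      rw [cycleGraph_adj] at h
      rcases h with h | h
      · have : i = i' + 1 := by rw [← h]; simp
        rw [this]; exact (hstep i' e).symm
      · have : i' = i + 1 := by rw [← h]; simp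
        rw [this]; exact hstep i e
    · dsimp only at h h'
      subst h'
      have hne : (e:ℕ) ≠ e' := fun hc => h.ne (Fin.ext hc)
      have l1 := e.isLt
      have l2 := e'.isLt
      simp only [hf]
      by_cases hc : ((i:ℕ) + (e:ℕ)) % 2 = 0
      · rw [if_pos hc, if_neg (by omega)]
        exact (h1 i).1.1
      · rw [if_neg hc, if_pos (by omega)]
        exact (h1 i).1.1.symm

/-- For every `ℓ ≥ 4` there is a constant `c(ℓ)` such that every `n`-vertex graph with
more than `c(ℓ)·n^{3/2}` edges contains the `2ℓ`-prism; i.e.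
`ex(n, C_{2ℓ}□K₂) = O_ℓ(n^{3/2})`. -/
theorem turan_prism_upper (l : ℕ) (hl : 4 ≤ l) :
    ∃ c : ℝ, 0 < c ∧ ∀ n : ℕ, ∀ G : SimpleGraph (Fin n),
      ¬ Contains (prism l) G →
      (G.edgeSet.ncard : ℝ) ≤ c * (n : ℝ) ^ ((3 : ℝ) / 2) := by
  obtain ⟨j, rfl⟩ : ∃ j, l = j + 4 := ⟨l - 4, by omega⟩
  obtain ⟨c, hc1, H⟩ := bip_thm j
  refine ⟨2 * c, by linarith, ?_⟩
  intro n G hno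
  by_contra hlt
  push Not at hlt
  obtain ⟨g, hg⟩ := exists_cut G
  have hpow : ((n:ℝ) ^ ((3:ℝ)/2)) ^ 2 = (n:ℝ) ^ 3 := by
    rw [← Real.rpow_natCast, ← Real.rpow_mul (Nat.cast_nonneg n), ← Real.rpow_natCast]
    norm_num
  have hp0 : 0 ≤ (n:ℝ) ^ ((3:ℝ)/2) := Real.rpow_nonneg (Nat.cast_nonneg n) _
  have hn : 0 < n := by
    rcases Nat.eq_zero_or_pos n with h | h
    · subst h
      have : G.edgeSet.ncard = 0 := by
        rw [Set.ncard_eq_zero]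
        ext e
        induction e with
        | _ x y => exact x.elim0
      rw [this] at hlt
      have : 0 ≤ 2 * c * ((0:ℕ):ℝ) ^ ((3:ℝ)/2) := mul_nonneg (by linarith) hp0
      simp only [Nat.cast_zero] at *
      linarith
    · exact h
  have p := H n (fun x y => G.Adj x y ∧ g x = true ∧ g y = false) hn (by
    have h1 : c * (n:ℝ) ^ ((3:ℝ)/2) ≤ sz (fun x y => G.Adj x y ∧ g x = true ∧ g y = false) := by linarith
    calc c * (n:ℝ) ^ 3 ≤ c ^ 2 * (n:ℝ) ^ 3 := by
          gcongr
          nlinarith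
      _ = (c * (n:ℝ) ^ ((3:ℝ)/2)) ^ 2 := by rw [mul_pow, hpow]
      _ ≤ _ := by gcongr)
  apply hno
  have e : 2 * (j + 4) = 2 * j + 7 + 1 := by ring
  unfold prism
  rw [e]
  exact prism_of_PSeq G g (2*j+7) (by omega) ⟨j+4, by omega⟩ p
end
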